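/- Suppose r divides N and let h(z) = (z^r+h_1)⋯(z^r+h_{N/r}) with h_1,…,h_{N/r} ∈ ℂ^× generic (i.e. this holds for all (h_1,…,h_{N/r}) in a dense Zariski-open subset of (ℂ^×)^{N/r}). Then the number of C_r-fixed points in the fibre X(h) equals the number of standard Young tableaux of rectangular shape Rect = (n−d)^d that are fixed by 𝑗^{N/r}, the (N/r)-th power of jeu de taquin promotion. -/

import Mathlib

open Polynomial

noncomputable section

/-! ### The Grassmannian `X = Gr(d, ℂ_{n-1}[z])` and the Wronski map -/

/-- The Wronskian determinant of a `d`-tuple of polynomials. -/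
def wronskDet (d : ℕ) (f : Fin d → Polynomial ℂ) : Polynomial ℂ :=
  Matrix.det (Matrix.of fun i j : Fin d =>
    (fun p : Polynomial ℂ => Polynomial.derivative p)^[(j : ℕ)] (f i))

/-- `x` is a point of the Grassmannian `Gr(d, ℂ_{n-1}[z])`. -/
def IsGrPoint (n d : ℕ) (x : Submodule ℂ (Polynomial ℂ)) : Prop :=
  x ≤ Polynomial.degreeLT ℂ n ∧ Module.finrank ℂ x = d

/-- `x` lies in the fibre of the Wronski map over `h` (an element of the
projective space `ℙ(ℂ_N[z])`, i.e. the Wronskian of a basis of `x` is a nonzero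
scalar multiple of `h`). -/
def InFibre (d : ℕ) (x : Submodule ℂ (Polynomial ℂ)) (h : Polynomial ℂ) : Prop :=
  ∃ (f : Fin d → Polynomial ℂ) (c : ℂ), c ≠ 0 ∧ LinearIndependent ℂ f ∧
    Submodule.span ℂ (Set.range f) = x ∧ wronskDet d f = c • h

/-- The linear substitution `f(z) ↦ f(c·z)` on polynomials. -/
def rotMap (c : ℂ) : Polynomial ℂ →ₗ[ℂ] Polynomial ℂ :=
  (Polynomial.aeval (Polynomial.C c * Polynomial.X) :
    Polynomial ℂ →ₐ[ℂ] Polynomial ℂ).toLinearMap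

/-- `x` is fixed by the cyclic group `C_r ⊂ PGL₂(ℂ)` of classes of
`diag(e^{πij/r}, e^{-πij/r})`, `j = 0, …, r-1`; the induced (projective) action on
`Gr(d, ℂ_{n-1}[z])` is via the substitutions `z ↦ e^{-2πij/r} z`. -/
def CrFixed (r : ℕ) (x : Submodule ℂ (Polynomial ℂ)) : Prop :=
  ∀ j : Fin r,
    Submodule.map
      (rotMap (Complex.exp (-(2 * (Real.pi : ℂ) * Complex.I * ((j : ℕ) : ℂ)) / (r : ℂ)))) x = x

/-- The linear map `f(z) ↦ z^{n-1} f(1/z)` on `ℂ_{n-1}[z]`,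
realizing the reflection `(0 1; 1 0) ∈ PGL₂(ℂ)`. -/
def reflectMap (n : ℕ) : Polynomial ℂ →ₗ[ℂ] Polynomial ℂ :=
  ∑ k ∈ Finset.range n,
    (Polynomial.lcoeff ℂ k).smulRight ((Polynomial.X : Polynomial ℂ) ^ (n - 1 - k))

/-- `x` is fixed by the dihedral group `D_r ⊂ PGL₂(ℂ)` generated by `C_r` and the
reflection `z ↦ 1/z`. -/
def DrFixed (n r : ℕ) (x : Submodule ℂ (Polynomial ℂ)) : Prop :=
  CrFixed r x ∧ Submodule.map (reflectMap n) x = x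

/-! ### Partitions, Richardson varieties, compatibility -/

/-- A partition with at most `d` parts, each of size at most `w`
(recorded as a function `ℕ → ℕ` vanishing from index `d` on; part `i` (0-based)
is the `(i+1)`-st part). -/
structure PartitionIn (d w : ℕ) where
  part : ℕ → ℕ
  antitone : ∀ ⦃i j : ℕ⦄, i ≤ j → part j ≤ part i
  le_w : ∀ i, part i ≤ w
  eq_zero : ∀ i, d ≤ i → part i = 0

/-- The size `|λ|` of a partition. -/
def PartitionIn.size {d w : ℕ} (lam : PartitionIn d w) : ℕ :=
  ∑ i ∈ Finset.range d, lam.part i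

/-- Containment `μ ⊆ λ` of partitions. -/
def SubPartition {d w : ℕ} (mu lam : PartitionIn d w) : Prop :=
  ∀ i, mu.part i ≤ lam.part i

/-- The full rectangular partition `(w)^d`. -/
def rectPart (d w : ℕ) : PartitionIn d w :=
  { part := fun i => if i < d then w else 0
    antitone := by
      intro i j hij
      by_cases hj : j < d
      · have hi : i < d := lt_of_le_of_lt hij hj
        simp [hi, hj]
      · simp [hj]
    le_w := by intro i; by_cases hi : i < d <;> simp [hi]
    eq_zero := by intro i hi; simp [Nat.not_lt.mpr hi] }

/-- The empty partition. -/
def zeroPart (d w : ℕ) : PartitionIn d w :=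
  { part := fun _ => 0
    antitone := by intro i j _; exact le_rfl
    le_w := fun _ => Nat.zero_le _
    eq_zero := fun _ _ => rfl }

/-- The flag `F_i = z^{n-i} ℂ_{i-1}[z]` inside `ℂ_{n-1}[z]`. -/
def Fflag (n i : ℕ) : Submodule ℂ (Polynomial ℂ) :=
  Polynomial.degreeLT ℂ n ⊓
    Submodule.restrictScalars ℂ (Ideal.span {(Polynomial.X : Polynomial ℂ) ^ (n - i)})

/-- The flag `F̃_i = ℂ_{i-1}[z]`. -/
def Ftilde (i : ℕ) : Submodule ℂ (Polynomial ℂ) := Polynomial.degreeLT ℂ i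

/-- Membership in the Richardson variety `X_{λ/μ}`. -/
def InRichardson (n d : ℕ) (lam mu : PartitionIn d (n - d))
    (x : Submodule ℂ (Polynomial ℂ)) : Prop :=
  ∀ i : ℕ, i < d →
    i + 1 ≤ Module.finrank ℂ ↥(x ⊓ Fflag n (n - d - mu.part i + (i + 1))) ∧
    i + 1 ≤ Module.finrank ℂ ↥(x ⊓ Ftilde (lam.part (d - 1 - i) + (i + 1)))

/-- The Richardson variety `X_{λ/μ}` is compatible with the polynomial `h`:
`μ ⊆ λ`, `|λ| = deg h` and `|μ| = mindeg h`. -/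
def Compatible (n d : ℕ) (lam mu : PartitionIn d (n - d)) (h : Polynomial ℂ) : Prop :=
  SubPartition mu lam ∧ lam.size = h.natDegree ∧ mu.size = h.rootMultiplicity 0

/-! ### Ribbons and tableaux -/

/-- Two boxes (row, column) are adjacent. -/
def BoxAdj (p q : ℕ × ℕ) : Prop :=
  (p.1 = q.1 ∧ (p.2 + 1 = q.2 ∨ q.2 + 1 = p.2)) ∨
  (p.2 = q.2 ∧ (p.1 + 1 = q.1 ∨ q.1 + 1 = p.1))

/-- A set of boxes is an `r`-ribbon: it has `r` boxes, is connected,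
and contains no 2×2 square. -/
def IsRibbon (r : ℕ) (S : Set (ℕ × ℕ)) : Prop :=
  S.ncard = r ∧
  (∀ p ∈ S, ∀ q ∈ S, Relation.ReflTransGen (fun u v => u ∈ S ∧ v ∈ S ∧ BoxAdj u v) p q) ∧
  ¬ ∃ i j : ℕ, (i, j) ∈ S ∧ (i + 1, j) ∈ S ∧ (i, j + 1) ∈ S ∧ (i + 1, j + 1) ∈ S

/-- The box `(i,j)` (0-based row and column) lies in the skew diagram `λ/μ`. -/
def InShape {d w : ℕ} (lam mu : PartitionIn d w) (i j : ℕ) : Prop :=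
  i < d ∧ mu.part i ≤ j ∧ j < lam.part i

/-- `E` is a standard `r`-ribbon tableau of skew shape `λ/μ` with entries `1, …, ℓ`
(recorded as a function on boxes, normalized to `0` off the shape). -/
def IsSRT {d w : ℕ} (r ℓ : ℕ) (lam mu : PartitionIn d w) (E : ℕ → ℕ → ℕ) : Prop :=
  (∀ i j, ¬ InShape lam mu i j → E i j = 0) ∧
  (∀ i j, InShape lam mu i j → 1 ≤ E i j ∧ E i j ≤ ℓ) ∧
  (∀ i j j', InShape lam mu i j → InShape lam mu i j' → j ≤ j' → E i j ≤ E i j') ∧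
  (∀ i i' j, InShape lam mu i j → InShape lam mu i' j → i ≤ i' → E i j ≤ E i' j) ∧
  (∀ k, 1 ≤ k → k ≤ ℓ → IsRibbon r {p : ℕ × ℕ | InShape lam mu p.1 p.2 ∧ E p.1 p.2 = k})

/-- A tableau (with boxes inside the `d × w` rectangle and largest entry `m`) is
rotationally invariant: it is fixed by rotating `180°` inside the rectangle and
replacing each entry `k` by `m + 1 - k`. -/
def RotInvariant {d w : ℕ} (m : ℕ) (lam mu : PartitionIn d w) (E : ℕ → ℕ → ℕ) : Prop :=
  ∀ i j, InShape lam mu i j →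
    InShape lam mu (d - 1 - i) (w - 1 - j) ∧
    E (d - 1 - i) (w - 1 - j) = m + 1 - E i j

/-- For `ℓ` even: a tableau of shape `λ/μ` with entries `1, …, ℓ-1`, in which the
boxes with entry `k ≠ ℓ/2` form `r`-ribbons and the boxes with entry `ℓ/2`
form a `2r`-ribbon. -/
def IsHatSRT {d w : ℕ} (r ℓ : ℕ) (lam mu : PartitionIn d w) (E : ℕ → ℕ → ℕ) : Prop :=
  (∀ i j, ¬ InShape lam mu i j → E i j = 0) ∧
  (∀ i j, InShape lam mu i j → 1 ≤ E i j ∧ E i j ≤ ℓ - 1) ∧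
  (∀ i j j', InShape lam mu i j → InShape lam mu i j' → j ≤ j' → E i j ≤ E i j') ∧
  (∀ i i' j, InShape lam mu i j → InShape lam mu i' j → i ≤ i' → E i j ≤ E i' j) ∧
  (∀ k, 1 ≤ k → k ≤ ℓ - 1 → k ≠ ℓ / 2 →
    IsRibbon r {p : ℕ × ℕ | InShape lam mu p.1 p.2 ∧ E p.1 p.2 = k}) ∧
  IsRibbon (2 * r) {p : ℕ × ℕ | InShape lam mu p.1 p.2 ∧ E p.1 p.2 = ℓ / 2}

/-! ### Rectangular standard Young tableaux, promotion and evacuation -/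

/-- `E` is a standard Young tableau of rectangular shape `d × w`
(normalized to `0` outside the rectangle). -/
def IsSYT (d w : ℕ) (E : ℕ → ℕ → ℕ) : Prop :=
  (∀ i j, d ≤ i ∨ w ≤ j → E i j = 0) ∧
  (∀ i j, i < d → j < w → 1 ≤ E i j ∧ E i j ≤ d * w) ∧
  (∀ i j, i < d → j + 1 < w → E i j < E i (j + 1)) ∧
  (∀ i j, i + 1 < d → j < w → E i j < E (i + 1) j) ∧
  (∀ m, 1 ≤ m → m ≤ d * w → ∃ i j, i < d ∧ j < w ∧ E i j = m)

/-- One step of the jeu de taquin slide of the empty box, restricted to the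
subtableau of entries `≤ i₀`: the empty box swaps with the smaller of its east
and south neighbours (among entries `≤ i₀`), if any. -/
def slideStep (d w i₀ : ℕ) (E : ℕ → ℕ → ℕ) (p : ℕ × ℕ) : ℕ × ℕ :=
  if (p.1 + 1 < d ∧ E (p.1 + 1) p.2 ≤ i₀) ∧ (p.2 + 1 < w ∧ E p.1 (p.2 + 1) ≤ i₀) then
    (if E (p.1 + 1) p.2 < E p.1 (p.2 + 1) then (p.1 + 1, p.2) else (p.1, p.2 + 1))
  else if p.1 + 1 < d ∧ E (p.1 + 1) p.2 ≤ i₀ then (p.1 + 1, p.2)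
  else if p.2 + 1 < w ∧ E p.1 (p.2 + 1) ≤ i₀ then (p.1, p.2 + 1)
  else p

/-- The path of the empty box in the jeu de taquin slide, starting in the
northwest corner. -/
def slidePath (d w i₀ : ℕ) (E : ℕ → ℕ → ℕ) : ℕ → ℕ × ℕ
  | 0 => (0, 0)
  | k + 1 => slideStep d w i₀ E (slidePath d w i₀ E k)

/-- Promotion restricted to the entries `1, …, i₀` (the operator `𝑗_{i₀}`):
delete the entry `1`, slide the empty box through the entries `≤ i₀`, decrement
those entries by one and place `i₀` in the final empty box. -/
def partialPromo (d w i₀ : ℕ) (E : ℕ → ℕ → ℕ) : ℕ → ℕ → ℕ := fun i j =>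
  if d ≤ i ∨ w ≤ j then 0
  else if (i, j) = slidePath d w i₀ E i₀ then i₀
  else if slidePath d w i₀ E (i + j) = (i, j) then
    E (slidePath d w i₀ E (i + j + 1)).1 (slidePath d w i₀ E (i + j + 1)).2 - 1
  else if E i j ≤ i₀ then E i j - 1
  else E i j

/-- Jeu de taquin promotion `𝑗` on fillings of the `d × w` rectangle. -/
def promo (d w : ℕ) (E : ℕ → ℕ → ℕ) : ℕ → ℕ → ℕ := partialPromo d w (d * w) E

/-- `evacAux d w i = 𝑗_1 ∘ 𝑗_2 ∘ ⋯ ∘ 𝑗_i`. -/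
def evacAux (d w : ℕ) : ℕ → (ℕ → ℕ → ℕ) → (ℕ → ℕ → ℕ)
  | 0, E => E
  | i + 1, E => evacAux d w i (partialPromo d w (i + 1) E)

/-- Evacuation `𝑒 = 𝑗_1 ∘ 𝑗_2 ∘ ⋯ ∘ 𝑗_N` on fillings of the `d × w` rectangle. -/
def evac (d w : ℕ) (E : ℕ → ℕ → ℕ) : ℕ → ℕ → ℕ := evacAux d w (d * w) E

/-- The `C_r`-fixed polynomial `z^m (z^r + h_1) ⋯ (z^r + h_ℓ)`. -/
def crPoly (r m ℓ : ℕ) (hs : Fin ℓ → ℂ) : Polynomial ℂ :=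
  Polynomial.X ^ m * ∏ i : Fin ℓ, (Polynomial.X ^ r + Polynomial.C (hs i))

/-- The product `∏ (z^r + a_i)(z^r + a_i⁻¹)` of generic inverse pairs. -/
def pairsPoly (r t : ℕ) (a : Fin t → ℂ) : Polynomial ℂ :=
  ∏ i : Fin t,
    ((Polynomial.X ^ r + Polynomial.C (a i)) * (Polynomial.X ^ r + Polynomial.C (a i)⁻¹))

/-- A `D_r`-fixed polynomial of type (1). -/
def type1poly (r m t : ℕ) (ε : ℂ) (a : Fin t → ℂ) : Polynomial ℂ :=
  Polynomial.X ^ m * (Polynomial.X ^ r + Polynomial.C ε) * pairsPoly r t a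

/-- A `D_r`-fixed polynomial of type (2). -/
def type2poly (r m t : ℕ) (a : Fin t → ℂ) : Polynomial ℂ :=
  Polynomial.X ^ m * pairsPoly r t a

/-- A `D_r`-fixed polynomial of type (3). -/
def type3poly (r m t : ℕ) (a : Fin t → ℂ) : Polynomial ℂ :=
  Polynomial.X ^ m * (Polynomial.X ^ r + 1) * (Polynomial.X ^ r - 1) * pairsPoly r t a

/-- `x` is an even-odd point: it has a basis each of whose members is an even or
an odd polynomial. -/
def IsEvenOddPoint (d : ℕ) (x : Submodule ℂ (Polynomial ℂ)) : Prop :=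
  ∃ f : Fin d → Polynomial ℂ, LinearIndependent ℂ f ∧
    Submodule.span ℂ (Set.range f) = x ∧
    ∀ i, (f i).comp (-Polynomial.X) = f i ∨ (f i).comp (-Polynomial.X) = -(f i)

/-- `x` is a real point: it has a basis of polynomials with real coefficients. -/
def IsRealPoint (d : ℕ) (x : Submodule ℂ (Polynomial ℂ)) : Prop :=
  ∃ f : Fin d → Polynomial ℂ, LinearIndependent ℂ f ∧
    Submodule.span ℂ (Set.range f) = x ∧
    ∀ i k, ((f i).coeff k).im = 0

/-- The Möbius action of a matrix on `ℂℙ¹ = ℂ ∪ {∞}` (modelled by `Option ℂ`,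
with `none` playing the role of `∞`). -/
def mobP1 (M : Matrix (Fin 2) (Fin 2) ℂ) : Option ℂ → Option ℂ := fun p =>
  match p with
  | none => if M 1 0 = 0 then none else some (M 0 0 / M 1 0)
  | some a =>
      if M 1 0 * a + M 1 1 = 0 then none
      else some ((M 0 0 * a + M 0 1) / (M 1 0 * a + M 1 1))

/-- The action of a matrix `φ` on `ℂ_{n-1}[z] `:
`(φf)(z) = (φ₂₁ z + φ₁₁)^{n-1} f((φ₂₂ z + φ₁₂)/(φ₂₁ z + φ₁₁))`. -/
def mobiusMap (n : ℕ) (M : Matrix (Fin 2) (Fin 2) ℂ) : Polynomial ℂ →ₗ[ℂ] Polynomial ℂ :=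
  ∑ k ∈ Finset.range n, (Polynomial.lcoeff ℂ k).smulRight
    ((Polynomial.C (M 1 1) * Polynomial.X + Polynomial.C (M 0 1)) ^ k *
     (Polynomial.C (M 1 0) * Polynomial.X + Polynomial.C (M 0 0)) ^ (n - 1 - k))

/-- The polynomial `∏_{a_i ≠ ∞} (z + a_i)` attached to a tuple of points of `ℂℙ¹`. -/
def rootsPoly (N : ℕ) (a : Fin N → Option ℂ) : Polynomial ℂ :=
  ∏ i : Fin N, (a i).elim 1 (fun c => Polynomial.X + Polynomial.C c)

/-- The eigenspace `M_k`: the span of the monomials `z^j`, `j < n`, `j ≡ k (mod r)`. -/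
def eigSpace (n r : ℕ) (k : Fin r) : Submodule ℂ (Polynomial ℂ) :=
  Submodule.span ℂ {p : Polynomial ℂ | ∃ j : ℕ, j < n ∧ j % r = (k : ℕ) ∧ p = Polynomial.X ^ j}

/-- The operator `c` on `ℂ_{n-1}[z]` with `c · z^k = ζ^{n-1-2k} z^k`, `ζ = e^{πi/r}`. -/
def cMap (n r : ℕ) : Polynomial ℂ →ₗ[ℂ] Polynomial ℂ :=
  (Complex.exp ((Real.pi : ℂ) * Complex.I / (r : ℂ))) ^ (n - 1) •
    (Polynomial.aeval
        (Polynomial.C (((Complex.exp ((Real.pi : ℂ) * Complex.I / (r : ℂ))) ^ 2)⁻¹) *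
          Polynomial.X) :
      Polynomial ℂ →ₐ[ℂ] Polynomial ℂ).toLinearMap

/-- `μ` is obtained from `λ` by removing a single `r`-ribbon. -/
def RibbonStep {d w : ℕ} (r : ℕ) (lam mu : PartitionIn d w) : Prop :=
  SubPartition mu lam ∧ IsRibbon r {p : ℕ × ℕ | InShape lam mu p.1 p.2}

/-- `λ` and `μ` have the same `r`-core: they are related by the equivalence
relation generated by removal of a single `r`-ribbon. -/
def RibbonEquiv {d w : ℕ} (r : ℕ) (lam mu : PartitionIn d w) : Prop :=
  Relation.EqvGen (fun a b => RibbonStep r a b) lam mu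

/-- `κ` is an `r`-core: no `r`-ribbon can be removed from it. -/
def IsRCore {d w : ℕ} (r : ℕ) (kappa : PartitionIn d w) : Prop :=
  ¬ ∃ mu : PartitionIn d w, RibbonStep r kappa mu

/-- The column set `J(λ) = {i - 1 + λ^{d+1-i} : 1 ≤ i ≤ d}` of the Plücker
coordinate `p_λ`, as a function of `i`. -/
def pluckerIndex {d w : ℕ} (lam : PartitionIn d w) (i : Fin d) : ℕ :=
  (i : ℕ) + lam.part (d - 1 - (i : ℕ))

/-- The Plücker coordinate `p_λ(x)` of `x` is nonzero (this does not depend on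
the choice of basis of `x`). -/
def PluckerNonzero (d : ℕ) {w : ℕ} (lam : PartitionIn d w)
    (x : Submodule ℂ (Polynomial ℂ)) : Prop :=
  ∃ f : Fin d → Polynomial ℂ, LinearIndependent ℂ f ∧
    Submodule.span ℂ (Set.range f) = x ∧
    Matrix.det (Matrix.of fun i i' : Fin d => (f i).coeff (pluckerIndex lam i')) ≠ 0

end

-- Part MN1
/-! ### Partial fractions and the Murnaghan-Nakayama recursion -/

theorem pfrac_one {ι : Type*} [DecidableEq ι] (s : Finset ι) (hs : s.Nonempty) (c : ι → ℝ)
    (hc : Set.InjOn c s) (y : ℝ) (hy : ∀ i ∈ s, y ≠ c i) :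
    ∑ i ∈ s, (y - c i)⁻¹ * ∏ j ∈ s.erase i, (c i - c j)⁻¹ = ∏ i ∈ s, (y - c i)⁻¹ := by
  have h := congrArg (Polynomial.eval y) (Lagrange.sum_basis hc hs)
  rw [Polynomial.eval_finsetSum] at h
  simp only [Polynomial.eval_one] at h
  have h2 : ∏ i ∈ s, (y - c i)⁻¹ = (∏ i ∈ s, (y - c i)⁻¹) * ∑ i ∈ s, Polynomial.eval y (Lagrange.basis s c i) := by
    rw [h, mul_one]
  rw [h2, Finset.mul_sum]
  refine Finset.sum_congr rfl fun i hi => ?_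
  rw [← Finset.mul_prod_erase s _ hi, Lagrange.basis, Polynomial.eval_prod, mul_assoc,
    ← Finset.prod_mul_distrib]
  congr 1
  refine Finset.prod_congr rfl fun j hj => ?_
  have := sub_ne_zero.2 (hy j (Finset.mem_of_mem_erase hj))
  simp [Lagrange.basisDivisor]
  field_simp

theorem pfrac_zero {ι : Type*} [DecidableEq ι] (s : Finset ι) (hs : 2 ≤ s.card) (c : ι → ℝ)
    (hc : Set.InjOn c s) :
    ∑ i ∈ s, ∏ j ∈ s.erase i, (c i - c j)⁻¹ = 0 := by
  obtain ⟨k, hk⟩ : s.Nonempty := Finset.card_pos.1 (by omega)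
  rw [← Finset.add_sum_erase s _ hk]
  have hne : (s.erase k).Nonempty := by
    rw [← Finset.card_pos, Finset.card_erase_of_mem hk]; omega
  rw [← pfrac_one (s.erase k) hne c (hc.mono (by simp)) (c k) ?_, ← Finset.sum_add_distrib]
  · refine Finset.sum_eq_zero fun i hi => ?_
    have hki : k ∈ s.erase i := by
      simp only [Finset.mem_erase] at hi ⊢; exact ⟨fun h => hi.1 h.symm, hk⟩
    rw [← Finset.mul_prod_erase _ _ hki, Finset.erase_right_comm]
    have : (c i - c k)⁻¹ = -(c k - c i)⁻¹ := by rw [← inv_neg, neg_sub]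
    rw [this]; ring
  · intro i hi h
    have := hc hk (Finset.mem_of_mem_erase hi) h
    simp [this] at hi

/-- sum over all displacement vectors with total `k` -/
noncomputable def Cfun {d : ℕ} (Z : (Fin d → ℤ) → ℝ) (k : ℕ) (s : Fin d → ℤ) (y : ℝ) : ℝ :=
  ∑ a ∈ Finset.piAntidiag (Finset.univ : Finset (Fin d)) k,
    Z (fun i => s i - a i) * ∏ i ∈ Finset.univ.filter (fun i => a i ≠ 0), (y - (s i - 1))⁻¹

theorem Cfun_zero {d : ℕ} (Z : (Fin d → ℤ) → ℝ) (s : Fin d → ℤ) (y : ℝ) :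
    Cfun Z 0 s y = Z s := by
  simp [Cfun]

/-- alternating function -/
def Alt {d : ℕ} (Z : (Fin d → ℤ) → ℝ) : Prop :=
  ∀ (s : Fin d → ℤ) (i j : Fin d), i ≠ j → Z (s ∘ Equiv.swap i j) = - Z s

theorem Cfun_alt {d : ℕ} {Z : (Fin d → ℤ) → ℝ} (hZ : Alt Z) (k : ℕ) (y : ℝ) :
    Alt (fun s => Cfun Z k s y) := by
  intro s i j hij
  simp only [Cfun]
  rw [← Finset.sum_neg_distrib]
  refine Finset.sum_nbij' (fun a => a ∘ Equiv.swap i j) (fun a => a ∘ Equiv.swap i j) ?_ ?_ ?_ ?_ ?_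
  · intro a ha
    simp only [Finset.mem_piAntidiag, Finset.mem_univ, implies_true, and_true] at ha ⊢
    rw [← ha]; exact Equiv.sum_comp (Equiv.swap i j) a
  · intro a ha
    simp only [Finset.mem_piAntidiag, Finset.mem_univ, implies_true, and_true] at ha ⊢
    rw [← ha]; exact Equiv.sum_comp (Equiv.swap i j) a
  · intro a _; ext x; simp
  · intro a _; ext x; simp
  · intro a _
    have h1 : (fun x => (s ∘ Equiv.swap i j) x - ((a x : ℕ) : ℤ)) =
        (fun x => s x - (((a ∘ Equiv.swap i j) x : ℕ) : ℤ)) ∘ Equiv.swap i j := by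
      ext x; simp
    rw [h1, hZ _ i j hij, neg_mul]
    congr 2
    refine Finset.prod_nbij' (Equiv.swap i j) (Equiv.swap i j) ?_ ?_ ?_ ?_ ?_ <;> simp

theorem Alt.eq_zero {d : ℕ} {Z : (Fin d → ℤ) → ℝ} (hZ : Alt Z) (s : Fin d → ℤ) (i j : Fin d)
    (hij : i ≠ j) (h : s i = s j) : Z s = 0 := by
  have h1 := hZ s i j hij
  have h2 : s ∘ Equiv.swap i j = s := by
    ext x; simp only [Function.comp_apply, Equiv.swap_apply_def]; split_ifs with h3 h4
    · rw [h3, h]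
    · rw [h4, h]
    · rfl
  rw [h2] at h1; linarith

/-- generic reindexing: summing over `i` and `a` of total `k` vs. total `k+1` with `i` in support -/
theorem sum_piAntidiag_succ {d : ℕ} (k : ℕ) (F : Fin d → (Fin d → ℕ) → ℝ) :
    ∑ i, ∑ a ∈ Finset.piAntidiag (Finset.univ : Finset (Fin d)) k, F i (a + Pi.single i 1) =
    ∑ a ∈ Finset.piAntidiag (Finset.univ : Finset (Fin d)) (k+1),
      ∑ i ∈ Finset.univ.filter (fun i => a i ≠ 0), F i a := by
  rw [Finset.sum_comm' (t' := Finset.univ) (s' := fun i =>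
    (Finset.piAntidiag (Finset.univ : Finset (Fin d)) (k+1)).filter (fun a => a i ≠ 0))]
  · refine Finset.sum_congr rfl fun i _ => ?_
    refine Finset.sum_nbij' (fun a => a + Pi.single i 1) (fun a => a - Pi.single i 1) ?_ ?_ ?_ ?_ ?_
    · intro a ha
      simp only [Finset.mem_piAntidiag, Finset.mem_univ, implies_true, and_true,
        Finset.mem_filter] at ha ⊢
      constructor
      · simp only [Pi.add_apply, Finset.sum_add_distrib, Finset.univ.sum_pi_single']
        simp [ha]
      · simp
    · intro a ha
      simp only [Finset.mem_piAntidiag, Finset.mem_univ, implies_true, and_true,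
        Finset.mem_filter] at ha ⊢
      have hh : a = (a - Pi.single i 1) + Pi.single i 1 := by
        ext x; by_cases hx : x = i
        · subst hx; simp; omega
        · simp [hx]
      have := ha.1
      rw [hh] at this
      simp only [Pi.add_apply, Finset.sum_add_distrib, Finset.univ.sum_pi_single'] at this
      simp at this
      simpa using this
    · intro a _; ext x; simp
    · intro a ha
      simp only [Finset.mem_filter] at ha
      ext x; by_cases hx : x = i
      · subst hx; simp; omega
      · simp [hx]
    · intro a _; rfl
  · intro a i; simp

theorem Cfun_key {d : ℕ} (Z : (Fin d → ℤ) → ℝ) (k : ℕ) (s : Fin d → ℤ) (g : Fin d → ℝ) :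
    ∑ i, g i * Cfun Z k (s - Pi.single i 1) ((s i : ℝ) - 1) =
    ∑ a ∈ Finset.piAntidiag (Finset.univ : Finset (Fin d)) (k+1),
      Z (fun i => s i - a i) * ∑ i ∈ Finset.univ.filter (fun i => a i ≠ 0),
        g i * ∏ j ∈ (Finset.univ.filter (fun i => a i ≠ 0)).erase i,
          (((s i : ℝ) - 1) - ((s j : ℝ) - 1))⁻¹ := by
  simp only [Finset.mul_sum]
  rw [← sum_piAntidiag_succ k (fun i a => Z (fun i => s i - a i) * (g i * ∏ j ∈ (Finset.univ.filter (fun i => a i ≠ 0)).erase i,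
          (((s i : ℝ) - 1) - ((s j : ℝ) - 1))⁻¹))]
  refine Finset.sum_congr rfl fun i _ => ?_
  rw [Cfun, Finset.mul_sum]
  refine Finset.sum_congr rfl fun a _ => ?_
  have h1 : (fun j => (s - Pi.single i 1 : Fin d → ℤ) j - ((a j : ℕ) : ℤ)) =
      fun j => s j - (((a + Pi.single i 1 : Fin d → ℕ) j : ℕ) : ℤ) := by
    ext j; by_cases hj : j = i
    · subst hj; simp; ring
    · simp [hj]
  rw [h1]
  have h2 : ∏ j ∈ Finset.univ.filter (fun j => a j ≠ 0),
      ((s i : ℝ) - 1 - ((((s - Pi.single i 1 : Fin d → ℤ) j : ℤ) : ℝ) - 1))⁻¹ =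
      ∏ j ∈ (Finset.univ.filter (fun j => (a + Pi.single i 1 : Fin d → ℕ) j ≠ 0)).erase i,
          (((s i : ℝ) - 1) - ((s j : ℝ) - 1))⁻¹ := by
    rw [← Finset.prod_subset (s₁ := (Finset.univ.filter (fun j => a j ≠ 0)).erase i)]
    · refine Finset.prod_congr ?_ ?_
      · ext j; by_cases hj : j = i <;> simp [hj]
      · intro j hj
        have : j ≠ i := by
          intro h; simp [h] at hj
        simp [this]
    · exact Finset.erase_subset _ _
    · intro j hj hj2
      have : j = i := by
        by_contra h; exact hj2 (Finset.mem_erase.2 ⟨h, hj⟩)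
      subst this; simp
  rw [h2]; ring

theorem Cfun_succ {d : ℕ} (Z : (Fin d → ℤ) → ℝ) (k : ℕ) (s : Fin d → ℤ)
    (hs : Function.Injective s) (y : ℝ) (hy : ∀ i, y ≠ (s i : ℝ) - 1) :
    Cfun Z (k+1) s y =
      ∑ i, (y - ((s i : ℝ) - 1))⁻¹ * Cfun Z k (s - Pi.single i 1) ((s i : ℝ) - 1) := by
  rw [Cfun_key, Cfun]
  refine Finset.sum_congr rfl fun a ha => ?_
  rw [pfrac_one _ _ (fun i => (s i : ℝ) - 1)]
  · intro i _ j _ h; exact hs (by simpa using h)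
  · intro i _; exact hy i
  · by_contra h
    rw [Finset.not_nonempty_iff_eq_empty, Finset.filter_eq_empty_iff] at h
    have hsum : ∑ i, a i = k+1 := by simpa using ha
    have : ∑ i, a i = 0 := Finset.sum_eq_zero fun i hi => by simpa using h hi
    omega

theorem Cfun_end {d : ℕ} (Z : (Fin d → ℤ) → ℝ) (k : ℕ) (s : Fin d → ℤ)
    (hs : Function.Injective s) :
    ∑ i, Cfun Z k (s - Pi.single i 1) ((s i : ℝ) - 1) =
      ∑ i, Z (s - Pi.single i ((k:ℤ)+1)) := by
  have := Cfun_key Z k s (fun _ => 1)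
  simp only [one_mul] at this
  rw [this]
  symm
  refine Finset.sum_of_injOn (fun i => Pi.single i (k+1)) ?_ ?_ ?_ ?_
  · intro i _ j _ h
    by_contra hij
    have := congrFun h i
    simp [hij] at this
  · intro i _
    simp
  · intro a ha hna
    rw [pfrac_zero _ _ (fun i => (s i : ℝ) - 1), mul_zero]
    · intro i _ j _ h; exact hs (by simpa using h)
    · by_contra hlt
      have hsum : ∑ i, a i = k+1 := by simpa using ha
      have hc : (Finset.univ.filter (fun i => a i ≠ 0)).card = 1 := by
        have : (Finset.univ.filter (fun i => a i ≠ 0)).card ≠ 0 := by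
          intro h
          rw [Finset.card_eq_zero, Finset.filter_eq_empty_iff] at h
          have : ∑ i, a i = 0 := Finset.sum_eq_zero fun i hi => by simpa using h hi
          omega
        omega
      obtain ⟨i, hi⟩ := Finset.card_eq_one.1 hc
      apply hna
      refine ⟨i, by simp, ?_⟩
      have h0 : ∀ j, j ≠ i → a j = 0 := by
        intro j hj
        by_contra h
        have : j ∈ Finset.univ.filter (fun i => a i ≠ 0) := by simp [h]
        rw [hi] at this; simp at this; exact hj this
      have : a i = k+1 := by
        rw [← hsum]; symm; exact Finset.sum_eq_single i (fun j _ hj => h0 j hj) (by simp)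
      ext j; by_cases hj : j = i
      · subst hj; simp [this]
      · simp [hj, h0 j hj]
  · intro i _
    have h1 : Finset.univ.filter (fun j => (Pi.single i (k+1) : Fin d → ℕ) j ≠ 0) = {i} := by
      ext j; by_cases hj : j = i
      · subst hj; simp
      · simp [hj]
    rw [h1]
    simp
    congr 1
    ext j; by_cases hj : j = i
    · subst hj; simp
    · simp [hj]

-- Part W1
/-! ### Ballot words -/
namespace Wd

/-- number of letters `i` among the first `k` letters of `w` -/
def cnt (w : ℕ → ℕ) (i k : ℕ) : ℕ := Nat.count (fun t => w t = i) k

theorem cnt_zero (w : ℕ → ℕ) (i : ℕ) : cnt w i 0 = 0 := by simp [cnt]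

theorem cnt_succ (w : ℕ → ℕ) (i k : ℕ) :
    cnt w i (k+1) = cnt w i k + if w k = i then 1 else 0 := by
  simp [cnt, Nat.count_succ]

theorem cnt_mono (w : ℕ → ℕ) (i : ℕ) {k l : ℕ} (h : k ≤ l) : cnt w i k ≤ cnt w i l :=
  Nat.count_monotone _ h

theorem cnt_congr {w w' : ℕ → ℕ} (i k : ℕ) (h : ∀ t < k, w t = w' t) : cnt w i k = cnt w' i k := by
  induction k with
  | zero => simp [cnt_zero]
  | succ k ih =>
    rw [cnt_succ, cnt_succ, ih (fun t ht => h t (by omega)), h k (by omega)]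

/-- swapping letters at positions `i` and `i+1` -/
def swp (i : ℕ) (w : ℕ → ℕ) : ℕ → ℕ := w ∘ Equiv.swap i (i+1)

theorem swp_at (i : ℕ) (w : ℕ → ℕ) : swp i w i = w (i+1) := by simp [swp]
theorem swp_at' (i : ℕ) (w : ℕ → ℕ) : swp i w (i+1) = w i := by simp [swp]
theorem swp_of_ne (i : ℕ) (w : ℕ → ℕ) (t : ℕ) (h1 : t ≠ i) (h2 : t ≠ i+1) : swp i w t = w t := by
  simp [swp, Equiv.swap_apply_of_ne_of_ne h1 h2]
theorem swp_swp (i : ℕ) (w : ℕ → ℕ) : swp i (swp i w) = w := by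
  ext t; simp [swp]

theorem cnt_swp (i : ℕ) (w : ℕ → ℕ) (j k : ℕ) (hk : k ≠ i+1) : cnt (swp i w) j k = cnt w j k := by
  rcases Nat.lt_or_ge k (i+1) with h | h
  · exact cnt_congr _ _ fun t ht => swp_of_ne _ _ _ (by omega) (by omega)
  · have h : i + 2 ≤ k := by omega
    induction k, h using Nat.le_induction with
    | base =>
      rw [cnt_succ, cnt_succ, cnt_succ w, cnt_succ w, swp_at, swp_at',
        cnt_congr (w := swp i w) (w' := w) j i fun t ht => swp_of_ne _ _ _ (by omega) (by omega)]
      omega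
    | succ k hk ih =>
      rw [cnt_succ, cnt_succ, ih (by omega) (by omega), swp_of_ne _ _ _ (by omega) (by omega)]

theorem cnt_swp' (i : ℕ) (w : ℕ → ℕ) (j : ℕ) :
    cnt (swp i w) j (i+1) = cnt w j i + if w (i+1) = j then 1 else 0 := by
  rw [cnt_succ, swp_at, cnt_swp _ _ _ _ (by omega)]

/-- the content of the box of the letter at position `t` -/
def con (w : ℕ → ℕ) (t : ℕ) : ℤ := (cnt w (w t) t : ℤ) - w t

/-- words of rectangular standard tableaux -/
structure Valid (d m : ℕ) (w : ℕ → ℕ) : Prop where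
  lt : ∀ t < d * m, w t < d
  eq : ∀ t, d * m ≤ t → w t = d
  bal : ∀ i k, i + 1 < d → cnt w (i+1) k ≤ cnt w i k
  fin : ∀ i < d, cnt w i (d * m) = m

variable {d m : ℕ} {w : ℕ → ℕ}

theorem Valid.anti (h : Valid d m w) {p p' : ℕ} (hp : p ≤ p') (hd : p' < d) (k : ℕ) :
    cnt w p' k ≤ cnt w p k := by
  induction p', hp using Nat.le_induction with
  | base => rfl
  | succ p' hp ih => exact (h.bal p' k hd).trans (ih (by omega))

theorem Valid.con_cases (h : Valid d m w) {i : ℕ} (hi : i + 1 < d * m) :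
    (w i = w (i+1) ∧ con w (i+1) = con w i + 1) ∨ (w i < w (i+1) ∧ con w (i+1) < con w i) ∨
    (w (i+1) < w i ∧ con w i + 2 ≤ con w (i+1)) := by
  have h0 := h.lt i (by omega)
  have h1 := h.lt (i+1) hi
  rcases Nat.lt_trichotomy (w i) (w (i+1)) with h2 | h2 | h2
  · right; left
    refine ⟨h2, ?_⟩
    have := h.anti h2.le h1 i
    simp only [con, cnt_succ, if_neg h2.ne]; omega
  · left
    refine ⟨h2, ?_⟩
    simp only [con, cnt_succ, ← h2]
    simp; omega
  · right; right
    refine ⟨h2, ?_⟩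
    have := h.anti h2.le h0 (i+1)
    simp only [cnt_succ, if_true, if_neg h2.ne'] at this
    simp only [con, cnt_succ, if_neg h2.ne']; omega

theorem Valid.con_ne (h : Valid d m w) {i : ℕ} (hi : i + 1 < d * m) : con w i ≠ con w (i+1) := by
  rcases h.con_cases hi with h | h | h <;> omega

theorem Valid.con_ne2 (h : Valid d m w) {i : ℕ} (hi : i + 2 < d * m) : con w i ≠ con w (i+2) := by
  have h0 := h.lt i (by omega)
  have h1 := h.lt (i+1) (by omega)
  have h2 := h.lt (i+2) hi
  intro he
  have e : ∀ p, cnt w p (i+1) = cnt w p i + if w i = p then 1 else 0 := fun p => cnt_succ w p i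
  have e1 : ∀ p, cnt w p (i+2) = cnt w p (i+1) + if w (i+1) = p then 1 else 0 := fun p => cnt_succ w p (i+1)
  have e2 : ∀ p, cnt w p (i+3) = cnt w p (i+2) + if w (i+2) = p then 1 else 0 := fun p => cnt_succ w p (i+2)
  simp only [con] at he
  rcases Nat.lt_trichotomy (w i) (w (i+2)) with h3 | h3 | h3
  · have a1 := h.anti h3.le h2 (i+3)
    have a2 := h.anti h3.le h2 i
    have f1 := e (w i); have f2 := e (w (i+2)); have f3 := e1 (w i); have f4 := e1 (w (i+2))
    have f5 := e2 (w i); have f6 := e2 (w (i+2))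
    rw [if_pos rfl] at f1 f6
    rw [if_neg h3.ne] at f2
    rw [if_neg h3.ne'] at f5
    split_ifs at f3 f4 <;> omega
  · rw [← h3, e1, e, if_pos rfl] at he
    split_ifs at he <;> push_cast at he <;> omega
  · have a1 := h.anti h3.le h0 (i+1)
    have f1 := e (w i)
    rw [if_pos rfl] at f1
    have := cnt_mono w (w (i+2)) (show i+1 ≤ i+2 by omega)
    omega

theorem Valid.swp (h : Valid d m w) {i : ℕ} (hi : i + 1 < d * m) (ha : con w (i+1) ≠ con w i - 1) :
    Valid d m (swp i w) := by
  refine ⟨?_, ?_, ?_, ?_⟩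
  · intro t ht
    simp only [Wd.swp, Function.comp_apply, Equiv.swap_apply_def]
    split_ifs
    · exact h.lt _ hi
    · exact h.lt _ (by omega)
    · exact h.lt _ ht
  · intro t ht
    rw [swp_of_ne _ _ _ (by omega) (by omega)]
    exact h.eq t ht
  · intro j k hj
    by_cases hk : k = i+1
    · subst hk
      rw [cnt_swp', cnt_swp']
      by_contra hlt
      have b0 := h.bal j i hj
      have b2 := h.bal j (i+2) hj
      have e : ∀ p, cnt w p (i+2) = cnt w p i + (if w i = p then 1 else 0) + if w (i+1) = p then 1 else 0 := by
        intro p; rw [cnt_succ, cnt_succ]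
      rw [e, e] at b2
      have h1 : w (i+1) = j+1 := by
        by_contra hc; rw [if_neg hc] at hlt; omega
      have h2 : w i = j := by
        by_contra hc; rw [if_neg hc] at b2; omega
      apply ha
      simp only [con]
      rw [h1, h2, cnt_succ, h2, if_neg (by omega)]
      rw [if_pos h1, if_neg (by omega)] at hlt
      push_cast; omega
    · rw [cnt_swp _ _ _ _ hk, cnt_swp _ _ _ _ hk]; exact h.bal _ _ hj
  · intro j hj
    rw [cnt_swp _ _ _ _ (by omega)]; exact h.fin j hj

theorem con_swp_of_ne (i : ℕ) (w : ℕ → ℕ) (t : ℕ) (h1 : t ≠ i) (h2 : t ≠ i+1) :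
    con (swp i w) t = con w t := by
  simp only [con]
  rw [swp_of_ne _ _ _ h1 h2, cnt_swp _ _ _ _ h2]

theorem con_swp (i : ℕ) (w : ℕ → ℕ) (h : w i ≠ w (i+1)) : con (swp i w) i = con w (i+1) := by
  simp only [con]
  rw [swp_at, cnt_swp _ _ _ _ (by omega), cnt_succ, if_neg h]; simp

theorem con_swp' (i : ℕ) (w : ℕ → ℕ) (h : w i ≠ w (i+1)) : con (swp i w) (i+1) = con w i := by
  simp only [con]
  rw [swp_at', cnt_swp', if_neg h.symm]; simp

theorem swp_eq_self (i : ℕ) (w : ℕ → ℕ) (h : w i = w (i+1)) : swp i w = w := by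
  ext t; simp only [swp, Function.comp_apply, Equiv.swap_apply_def]
  split_ifs with h1 h2
  · rw [h1, h]
  · rw [h2, h]
  · rfl

theorem swp_comm (i j : ℕ) (hij : i + 2 ≤ j) (w : ℕ → ℕ) : swp i (swp j w) = swp j (swp i w) := by
  ext t; simp only [swp, Function.comp_apply]
  congr 1
  simp only [Equiv.swap_apply_def]
  split_ifs <;> omega

theorem swp_braid (i : ℕ) (w : ℕ → ℕ) :
    swp i (swp (i+1) (swp i w)) = swp (i+1) (swp i (swp (i+1) w)) := by
  ext t; simp only [swp, Function.comp_apply]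
  congr 1
  simp only [Equiv.swap_apply_def]
  split_ifs <;> omega

/-- the finite type of valid words -/
@[ext]
structure Y (d m : ℕ) : Type where
  val : ℕ → ℕ
  property : Valid d m val

instance : Finite (Y d m) := by
  let f : Y d m → (Fin (d * m) → Fin (d+1)) := fun w t => ⟨w.1 t, by have := w.2.lt t t.2; omega⟩
  refine Finite.of_injective f ?_
  intro w w' h
  apply Y.ext
  ext t
  by_cases ht : t < d * m
  · have := congrFun h ⟨t, ht⟩
    simpa [f] using this
  · rw [w.2.eq t (by omega), w'.2.eq t (by omega)]

noncomputable instance : Fintype (Y d m) := Fintype.ofFinite _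
noncomputable instance : DecidableEq (Y d m) := Classical.decEq _

open Classical in
/-- total swapping map on valid words -/
noncomputable def sw (i : ℕ) (w : Y d m) : Y d m :=
  if h : Valid d m (swp i w.1) then ⟨swp i w.1, h⟩ else w

theorem sw_of_valid {i : ℕ} {w : Y d m} (h : Valid d m (swp i w.1)) :
    (sw i w).1 = swp i w.1 := by
  rw [sw, dif_pos h]

end Wd

-- Part W2
/-! ### Young seminormal operators -/
namespace Wd
variable {d m : ℕ}

theorem con_sw_of_ne (i : ℕ) (w : Y d m) (t : ℕ) (h1 : t ≠ i) (h2 : t ≠ i+1) :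
    con (sw i w).1 t = con w.1 t := by
  unfold sw; split_ifs
  · exact con_swp_of_ne _ _ _ h1 h2
  · rfl

/-- the two-parameter operator -/
noncomputable def op (α β : ℤ → ℤ → ℝ) (i : ℕ) : Module.End ℝ (Y d m → ℝ) where
  toFun f w := α (con w.1 i) (con w.1 (i+1)) * f w + β (con w.1 i) (con w.1 (i+1)) * f (sw i w)
  map_add' f g := by ext w; simp; ring
  map_smul' c f := by ext w; simp; ring

theorem op_apply (α β : ℤ → ℤ → ℝ) (i : ℕ) (f : Y d m → ℝ) (w : Y d m) :
    op α β i f w =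
      α (con w.1 i) (con w.1 (i+1)) * f w + β (con w.1 i) (con w.1 (i+1)) * f (sw i w) := rfl

/-- conditions on the off-diagonal coefficients -/
def Off (β : ℤ → ℤ → ℝ) : Prop := ∀ x, β x (x+1) = 0 ∧ β x (x-1) = 0

theorem Off.move {β : ℤ → ℤ → ℝ} (hβ : Off β) {i : ℕ} (hi : i + 1 < d * m) (w : Y d m)
    (h : β (con w.1 i) (con w.1 (i+1)) ≠ 0) :
    (sw i w).1 = swp i w.1 ∧ con (sw i w).1 i = con w.1 (i+1) ∧
    con (sw i w).1 (i+1) = con w.1 i := by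
  have h1 : con w.1 (i+1) ≠ con w.1 i - 1 := by
    intro hc; rw [hc, (hβ _).2] at h; exact h rfl
  have h2 : con w.1 (i+1) ≠ con w.1 i + 1 := by
    intro hc; rw [hc, (hβ _).1] at h; exact h rfl
  have h3 : w.1 i ≠ w.1 (i+1) := by
    rcases w.2.con_cases hi with h | h | h <;> omega
  have h4 := sw_of_valid (w.2.swp hi h1)
  rw [h4]
  exact ⟨rfl, con_swp _ _ h3, con_swp' _ _ h3⟩

theorem op_sq {α β : ℤ → ℤ → ℝ} (hβ : Off β) {i : ℕ} (hi : i + 1 < d * m)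
    (h1 : ∀ x y, x ≠ y → α x y * α x y + β x y * β y x = 1)
    (h2 : ∀ x y, x ≠ y → α x y + α y x = 0) : (op α β i : Module.End ℝ (Y d m → ℝ)) * op α β i = 1 := by
  refine LinearMap.ext fun f => funext fun w => ?_
  simp only [Module.End.mul_apply, op_apply, Module.End.one_apply]
  have hne := w.2.con_ne hi
  by_cases hb : β (con w.1 i) (con w.1 (i+1)) = 0
  · have := h1 _ _ hne
    rw [hb] at this ⊢
    linear_combination f w * this
  · obtain ⟨m1, m2, m3⟩ := hβ.move hi w hb
    rw [m2, m3]
    have e : sw i (sw i w) = w := by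
      apply Y.ext
      rw [sw_of_valid] <;> rw [m1, swp_swp]
      exact w.2
    rw [e]
    linear_combination f w * h1 _ _ hne + β (con w.1 i) (con w.1 (i+1)) * f (sw i w) * h2 _ _ hne

theorem op_comm {α β : ℤ → ℤ → ℝ} {α' β' : ℤ → ℤ → ℝ} (hβ : Off β) (hβ' : Off β') {i j : ℕ} (hij : i + 2 ≤ j)
    (hj : j + 1 < d * m) :
    (op α β i : Module.End ℝ (Y d m → ℝ)) * op α' β' j = op α' β' j * op α β i := by
  refine LinearMap.ext fun f => funext fun w => ?_
  simp only [Module.End.mul_apply, op_apply]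
  rw [con_sw_of_ne j w i (by omega) (by omega), con_sw_of_ne j w (i+1) (by omega) (by omega),
    con_sw_of_ne i w j (by omega) (by omega), con_sw_of_ne i w (j+1) (by omega) (by omega)]
  by_cases hb : β (con w.1 i) (con w.1 (i+1)) = 0
  · rw [hb]; ring
  by_cases hb' : β' (con w.1 j) (con w.1 (j+1)) = 0
  · rw [hb']; ring
  have e : sw j (sw i w) = sw i (sw j w) := by
    apply Y.ext
    rw [(hβ'.move hj (sw i w) _).1, (hβ.move (by omega) (sw j w) _).1, (hβ'.move hj w hb').1,
      (hβ.move (by omega) w hb).1, swp_comm _ _ hij]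
    · rw [con_sw_of_ne j w i (by omega) (by omega), con_sw_of_ne j w (i+1) (by omega) (by omega)]
      exact hb
    · rw [con_sw_of_ne i w j (by omega) (by omega), con_sw_of_ne i w (j+1) (by omega) (by omega)]
      exact hb'
  rw [e]; ring

theorem op_braid {α β : ℤ → ℤ → ℝ} (hβ : Off β) {i : ℕ} (hi : i + 2 < d * m)
    (r1 : ∀ x y z, x ≠ y → y ≠ z → x ≠ z → α x y * α y z + α x z * α y x = α y z * α x z)
    (r2 : ∀ x y z, x ≠ y → y ≠ z → x ≠ z → α x y * α x z = α y z * α x y + α x z * α z y)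
    (r3 : ∀ x y z, x ≠ y → y ≠ z → x ≠ z → α x y ^ 2 * α y z + β x y * β y x * α x z =
      α y z ^ 2 * α x y + β y z * β z y * α x z) :
    (op α β i : Module.End ℝ (Y d m → ℝ)) * op α β (i+1) * op α β i =
      op α β (i+1) * op α β i * op α β (i+1) := by
  refine LinearMap.ext fun f => funext fun w => ?_
  have hxy := w.2.con_ne (i := i) (by omega)
  have hyz := w.2.con_ne (i := i+1) (by omega)
  have hxz := w.2.con_ne2 hi
  have R1 := r1 _ _ _ hxy hyz hxz
  have R2 := r2 _ _ _ hxy hyz hxz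
  have R3 := r3 _ _ _ hxy hyz hxz
  have A1 : con (sw i w).1 (i+2) = con w.1 (i+2) := con_sw_of_ne _ _ _ (by omega) (by omega)
  have A2 : con (sw (i+1) w).1 i = con w.1 i := con_sw_of_ne _ _ _ (by omega) (by omega)
  have A3 : con (sw (i+1) (sw i w)).1 i = con (sw i w).1 i := con_sw_of_ne _ _ _ (by omega) (by omega)
  have A4 : con (sw i (sw (i+1) w)).1 (i+2) = con (sw (i+1) w).1 (i+2) :=
    con_sw_of_ne _ _ _ (by omega) (by omega)
  have M1 := hβ.move (i := i) (by omega) w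
  have M2 := hβ.move (i := i+1) (by omega) w
  have M3 := hβ.move (i := i+1) (by omega) (sw i w)
  have M4 := hβ.move (i := i) (by omega) (sw (i+1) w)
  have M5 := hβ.move (i := i) (by omega) (sw (i+1) (sw i w))
  have M6 := hβ.move (i := i+1) (by omega) (sw i (sw (i+1) w))
  have I1 : (sw i w).1 = swp i w.1 → sw i (sw i w) = w := fun h => by
    apply Y.ext
    rw [sw_of_valid] <;> rw [h, swp_swp]
    exact w.2
  have I2 : (sw (i+1) w).1 = swp (i+1) w.1 → sw (i+1) (sw (i+1) w) = w := fun h => by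
    apply Y.ext
    rw [sw_of_valid] <;> rw [h, swp_swp]
    exact w.2
  have I3 : (sw i w).1 = swp i w.1 → (sw (i+1) w).1 = swp (i+1) w.1 →
     (sw (i+1) (sw i w)).1 = swp (i+1) (sw i w).1 → (sw i (sw (i+1) w)).1 = swp i (sw (i+1) w).1 →
     (sw i (sw (i+1) (sw i w))).1 = swp i (sw (i+1) (sw i w)).1 →
     (sw (i+1) (sw i (sw (i+1) w))).1 = swp (i+1) (sw i (sw (i+1) w)).1 →
     sw i (sw (i+1) (sw i w)) = sw (i+1) (sw i (sw (i+1) w)) := by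
    intro h1 h2 h3 h4 h5 h6
    apply Y.ext
    rw [h5, h6, h3, h4, h1, h2, swp_braid]
  have e : i + 1 + 1 = i + 2 := rfl
  simp only [Module.End.mul_apply, op_apply, e, A1, A2, A3, A4] at M1 M2 M3 M4 M5 M6 ⊢
  generalize con w.1 i = x at *
  generalize con w.1 (i+1) = y at *
  generalize con w.1 (i+2) = z at *
  by_cases h1 : β x y = 0
  · by_cases h2 : β y z = 0
    · simp only [h1, h2, zero_mul, add_zero] at R3 ⊢
      linear_combination f w * R3
    · obtain ⟨m1, m2, m3⟩ := M2 h2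
      rw [I2 m1]
      simp only [m2, m3, h1, zero_mul, add_zero] at M4 M5 M6 R3 ⊢
      by_cases h3 : β x z = 0
      · simp only [h3, zero_mul, add_zero] at R3 ⊢
        linear_combination f w * R3 + β y z * f (sw (i+1) w) * R2
      · obtain ⟨n1, n2, n3⟩ := M4 h3
        simp only [n2, n3, h1, zero_mul, add_zero]
        linear_combination f w * R3 + β y z * f (sw (i+1) w) * R2
  · obtain ⟨k1, k2, k3⟩ := M1 h1
    rw [I1 k1]
    simp only [k2, k3] at M3 M5 ⊢
    by_cases h2 : β y z = 0
    · simp only [h2, zero_mul, add_zero] at R3 ⊢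
      by_cases h3 : β x z = 0
      · simp only [h3, zero_mul, add_zero] at R3 ⊢
        linear_combination f w * R3 + β x y * f (sw i w) * R1
      · obtain ⟨n1, n2, n3⟩ := M3 h3
        simp only [n2, n3, h2, zero_mul, add_zero]
        linear_combination f w * R3 + β x y * f (sw i w) * R1
    · obtain ⟨m1, m2, m3⟩ := M2 h2
      rw [I2 m1]
      simp only [m2, m3] at M4 M5 M6 R3 ⊢
      by_cases h3 : β x z = 0
      · simp only [h3, zero_mul, add_zero] at R3 ⊢
        linear_combination f w * R3 + β x y * f (sw i w) * R1 + β y z * f (sw (i+1) w) * R2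
      · obtain ⟨n1, n2, n3⟩ := M4 h3
        obtain ⟨p1, p2, p3⟩ := M3 h3
        simp only [n2, n3, p2, p3] at M5 M6 ⊢
        rw [I3 k1 m1 p1 n1 (M5 h2).1 (M6 h1).1]
        linear_combination f w * R3 + β x y * f (sw i w) * R1 + β y z * f (sw (i+1) w) * R2
end Wd

-- Part W3
/-! ### Full twists in monoids with braid relations -/
namespace Wd
section braid
variable {M : Type*} [Monoid M]

/-- `σ 0 * ⋯ * σ (n-1)` -/
def dl (σ : ℕ → M) : ℕ → M
  | 0 => 1
  | n+1 => dl σ n * σ n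

/-- `σ (k) * σ (k-1) * ⋯` with `j` factors -/
def rh (σ : ℕ → M) (k : ℕ) : ℕ → M
  | 0 => 1
  | j+1 => rh σ k j * σ (k - j)

variable (σ : ℕ → M) (K : ℕ)

theorem dl_comm (hc : ∀ i j, i + 2 ≤ j → j < K → σ i * σ j = σ j * σ i)
    (n j : ℕ) (hj : n + 1 ≤ j) (hK : j < K) : dl σ n * σ j = σ j * dl σ n := by
  induction n with
  | zero => simp [dl]
  | succ n ih =>
    rw [dl, mul_assoc, hc n j (by omega) hK, ← mul_assoc, ih (by omega), mul_assoc]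

theorem dl_shift (hb : ∀ i, i + 1 < K → σ i * σ (i+1) * σ i = σ (i+1) * σ i * σ (i+1))
    (hc : ∀ i j, i + 2 ≤ j → j < K → σ i * σ j = σ j * σ i)
    (n i : ℕ) (hi : i + 1 < n) (hn : n ≤ K) : dl σ n * σ i = σ (i+1) * dl σ n := by
  have hi' : i + 2 ≤ n := hi
  induction n, hi' using Nat.le_induction with
  | base =>
    rw [dl, dl, mul_assoc, mul_assoc, ← mul_assoc (σ i), hb i (by omega), ← mul_assoc, ← mul_assoc,
      dl_comm σ K hc i (i+1) (by omega) (by omega), mul_assoc, mul_assoc, mul_assoc]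
  | succ n hn ih =>
    rw [dl, mul_assoc, ← hc i n (by omega) (by omega), ← mul_assoc, ih (by omega) (by omega), mul_assoc]

theorem rh_dl (hb : ∀ i, i + 1 < K → σ i * σ (i+1) * σ i = σ (i+1) * σ i * σ (i+1))
    (hc : ∀ i j, i + 2 ≤ j → j < K → σ i * σ j = σ j * σ i)
    (k j : ℕ) (hj : j ≤ k) (hk : k < K) :
    rh σ k j * dl σ (k+1) = dl σ k * rh σ k (j+1) := by
  induction j with
  | zero => simp [rh, dl]
  | succ j ih =>
    have e : k - j = (k - (j+1)) + 1 := by omega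
    rw [rh, mul_assoc, e, ← dl_shift σ K hb hc (k+1) (k - (j+1)) (by omega) (by omega), ← mul_assoc,
      ih (by omega), mul_assoc]
    rfl

theorem dl_pow (hb : ∀ i, i + 1 < K → σ i * σ (i+1) * σ i = σ (i+1) * σ i * σ (i+1))
    (hc : ∀ i j, i + 2 ≤ j → j < K → σ i * σ j = σ j * σ i)
    (k j : ℕ) (hj : j ≤ k + 1) (hk : k < K) : dl σ (k+1) ^ j = dl σ k ^ j * rh σ k j := by
  induction j with
  | zero => simp [rh]
  | succ j ih =>
    rw [pow_succ, ih (by omega), mul_assoc, rh_dl σ K hb hc k j (by omega) hk, ← mul_assoc, ← pow_succ]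

theorem rh_succ (k j : ℕ) (hj : j ≤ k + 1) : rh σ (k+1) (j+1) = σ (k+1) * rh σ k j := by
  induction j with
  | zero => simp [rh]
  | succ j ih =>
    have e : k + 1 - (j+1) = k - j := by omega
    rw [rh, ih (by omega), rh, e, mul_assoc]

theorem twist_J (G : ℕ → M) (h0 : G 0 = 1) (hG : ∀ k < K, G (k+1) = σ k * G k * σ k) (k : ℕ) (hk : k < K) :
    rh σ k (k+1) * dl σ (k+1) = G (k+1) := by
  induction k with
  | zero => rw [hG 0 hk, h0]; simp [rh, dl]
  | succ k ih =>
    rw [rh_succ σ k (k+1) (by omega), dl, hG (k+1) hk, ← ih (by omega)]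
    simp only [mul_assoc]

theorem twist (hb : ∀ i, i + 1 < K → σ i * σ (i+1) * σ i = σ (i+1) * σ i * σ (i+1))
    (hc : ∀ i j, i + 2 ≤ j → j < K → σ i * σ j = σ j * σ i)
    (G : ℕ → M) (h0 : G 0 = 1) (hG : ∀ k < K, G (k+1) = σ k * G k * σ k) (k : ℕ) (hk : k < K) :
    dl σ (k+1) ^ (k+2) = dl σ k ^ (k+1) * G (k+1) := by
  rw [pow_succ, dl_pow σ K hb hc k (k+1) le_rfl hk, mul_assoc, twist_J σ K G h0 hG k hk]
end braid
end Wd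

-- Part W4
/-! ### The deformation operators `t_i(q)` -/
namespace Wd
variable {d m : ℕ}

/-- the inverse quantum integer -/
noncomputable def uq (q : ℝ) (a : ℤ) : ℝ :=
  (a.sign : ℝ) * (q ^ (a.natAbs - 1) / ∑ k ∈ Finset.range a.natAbs, q ^ (2 * k))

noncomputable def bq (q : ℝ) (a : ℤ) : ℝ := Real.sqrt (1 - uq q a ^ 2)

theorem uq_neg (q : ℝ) (a : ℤ) : uq q (-a) = - uq q a := by simp [uq]
theorem bq_neg (q : ℝ) (a : ℤ) : bq q (-a) = bq q a := by simp [bq, uq_neg]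
theorem uq_one (q : ℝ) : uq q 1 = 1 := by simp [uq]
theorem bq_one (q : ℝ) : bq q 1 = 0 := by simp [bq, uq_one]

theorem den_ge (q : ℝ) (hq : 0 ≤ q) (a : ℤ) (ha : a ≠ 0) :
    1 ≤ ∑ k ∈ Finset.range a.natAbs, q ^ (2 * k) := by
  have h : 0 < a.natAbs := Int.natAbs_pos.2 ha
  have := Finset.single_le_sum (f := fun k => q ^ (2 * k)) (s := Finset.range a.natAbs)
    (fun i _ => by positivity) (Finset.mem_range.2 h)
  simpa using this

theorem uq_sq_le (q : ℝ) (hq : 0 ≤ q) (hq1 : q ≤ 1) (a : ℤ) : uq q a ^ 2 ≤ 1 := by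
  by_cases ha : a = 0
  · simp [uq, ha]
  have h1 := den_ge q hq a ha
  have h2 : q ^ (a.natAbs - 1) ≤ 1 := pow_le_one₀ hq hq1
  have h3 : 0 ≤ q ^ (a.natAbs - 1) := by positivity
  have h4 : (a.sign : ℝ) ^ 2 = 1 := by
    rcases Int.lt_trichotomy a 0 with h | h | h
    · simp [Int.sign_eq_neg_one_of_neg h]
    · exact absurd h ha
    · simp [Int.sign_eq_one_of_pos h]
  rw [uq, mul_pow, h4, one_mul, div_pow, div_le_one (by positivity)]
  apply pow_le_pow_left₀ h3 (h2.trans h1)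

theorem bq_sq (q : ℝ) (hq : 0 ≤ q) (hq1 : q ≤ 1) (a : ℤ) : bq q a * bq q a = 1 - uq q a ^ 2 := by
  rw [bq, Real.mul_self_sqrt]
  have := uq_sq_le q hq hq1 a
  linarith

theorem uq_cont (a : ℤ) (ha : a ≠ 0) : ContinuousOn (fun q => uq q a) (Set.Icc 0 1) := by
  unfold uq
  refine ContinuousOn.mul continuousOn_const (ContinuousOn.div (by fun_prop) (by fun_prop) ?_)
  intro q hq
  have := den_ge q hq.1 a ha
  linarith

theorem bq_cont (a : ℤ) (ha : a ≠ 0) : ContinuousOn (fun q => bq q a) (Set.Icc 0 1) := by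
  unfold bq
  have := uq_cont a ha
  fun_prop

theorem uq_at_one (a : ℤ) : uq 1 a = (a : ℝ)⁻¹ := by
  by_cases ha : a = 0
  · simp [uq, ha]
  simp only [uq, one_pow, Finset.sum_const, Finset.card_range, nsmul_eq_mul, mul_one]
  rcases Int.lt_trichotomy a 0 with h | h | h
  · have e : (a.natAbs : ℝ) = -(a:ℝ) := by
      have : (a.natAbs : ℤ) = -a := by omega
      rw [← Int.cast_natCast (R := ℝ), this, Int.cast_neg]
    rw [Int.sign_eq_neg_one_of_neg h, e]; simp [div_eq_mul_inv]
  · exact absurd h ha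
  · have e : (a.natAbs : ℝ) = (a:ℝ) := by
      have : (a.natAbs : ℤ) = a := by omega
      rw [← Int.cast_natCast (R := ℝ), this]
    rw [Int.sign_eq_one_of_pos h, e]; simp

theorem uq_at_zero (a : ℤ) (h : 2 ≤ a.natAbs) : uq 0 a = 0 := by
  have : a.natAbs - 1 ≠ 0 := by omega
  simp [uq, this]

theorem uq_closed_nat (q : ℝ) (hq : 0 < q) (hq1 : q < 1) (n : ℕ) (hn : n ≠ 0) :
    uq q n = (q - q⁻¹) / (q ^ (n:ℤ) - q ^ (-(n:ℤ))) := by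
  have hq2 : q ^ 2 ≠ 1 := by nlinarith
  simp only [uq, Int.natAbs_natCast, Int.sign_natCast_of_ne_zero hn, pow_mul]
  rw [geom_sum_eq hq2, zpow_neg, zpow_natCast]
  obtain ⟨k, rfl⟩ := Nat.exists_eq_succ_of_ne_zero hn
  have h1 : q ^ k.succ < 1 := pow_lt_one₀ hq.le hq1 hn
  have h0 : 0 < q ^ k.succ := by positivity
  have h2 : (q^2)^k.succ - 1 ≠ 0 := by
    rw [← pow_mul, mul_comm, pow_mul]; nlinarith
  have h3 : q ^ k.succ - (q^k.succ)⁻¹ ≠ 0 := by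
    have := (one_lt_inv₀ h0).2 h1
    linarith
  have h4 : q^2 - 1 ≠ 0 := sub_ne_zero.2 hq2
  have h5 : ((q^2)^k.succ - 1) / (q^2-1) ≠ 0 := div_ne_zero h2 h4
  rw [eq_div_iff h3]
  simp only [Int.cast_one, one_mul, Nat.succ_sub_one]
  have e1 : (q^2)^k.succ = q^k * q^k * q^2 := by rw [pow_succ]; ring
  have e2 : q^k.succ = q^k * q := pow_succ _ _
  rw [e1] at h2
  rw [e1, e2]
  have h6 : q ^ k ≠ 0 := by positivity
  field_simp
  refine div_self ?_
  convert h2 using 2; ring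

theorem uq_closed (q : ℝ) (hq : 0 < q) (hq1 : q < 1) (a : ℤ) (ha : a ≠ 0) :
    uq q a = (q - q⁻¹) / (q ^ a - q ^ (-a)) := by
  obtain ⟨n, rfl | rfl⟩ := a.eq_nat_or_neg
  · exact uq_closed_nat q hq hq1 n (by simpa using ha)
  · rw [uq_neg, uq_closed_nat q hq hq1 n (by simpa using ha), neg_neg, ← div_neg, neg_sub]

theorem alq_closed (q : ℝ) (hq : 0 < q) (hq1 : q < 1) (x y : ℤ) (hxy : x ≠ y) :
    q ^ (y - x) * uq q (y - x) = (q - q⁻¹) * q ^ (2*y) / (q ^ (2*y) - q ^ (2*x)) := by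
  have hq0 := hq.ne'
  rw [uq_closed q hq hq1 _ (by omega)]
  have hX := zpow_ne_zero x hq0
  have hY := zpow_ne_zero y hq0
  have hinj : q ^ (y - x) ≠ q ^ (-(y-x)) := by
    intro h
    have := zpow_right_injective₀ hq hq1.ne h
    omega
  have e1 : q ^ (2*y) = q ^ y * q ^ y := by rw [← zpow_add₀ hq0]; congr 1; ring
  have e2 : q ^ (2*x) = q ^ x * q ^ x := by rw [← zpow_add₀ hq0]; congr 1; ring
  have e3 : q ^ (-(y - x)) = q ^ x / q ^ y := by rw [← zpow_sub₀ hq0]; congr 1; ring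
  have e4 : q ^ (y - x) = q ^ y / q ^ x := zpow_sub₀ hq0 _ _
  have h5 : q ^ y / q ^ x - q ^ x / q ^ y ≠ 0 := by rw [← e3, ← e4]; exact sub_ne_zero.2 hinj
  have h6 : q ^ y * q ^ y - q ^ x * q ^ x ≠ 0 := by
    intro h; apply h5; field_simp; linear_combination h
  rw [e1, e2, e3, e4, mul_div_assoc']
  rw [div_eq_div_iff h5 h6]
  field_simp

/-- the operators `t_i(q)` -/
noncomputable def tq (q : ℝ) (i : ℕ) : Module.End ℝ (Y d m → ℝ) :=
  op (fun x y => uq q (y - x)) (fun x y => bq q (y - x)) i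

/-- the Hecke operators -/
noncomputable def Tq (q : ℝ) (i : ℕ) : Module.End ℝ (Y d m → ℝ) :=
  op (fun x y => q ^ (y - x) * uq q (y - x)) (fun x y => bq q (y - x)) i

theorem off_bq (q : ℝ) : Off (fun x y => bq q (y - x)) := by
  intro x
  have h1 : x + 1 - x = 1 := by ring
  have h2 : x - 1 - x = -1 := by ring
  simp [h1, h2, bq_one, bq_neg]

theorem tq_sq (q : ℝ) (hq : 0 ≤ q) (hq1 : q ≤ 1) {i : ℕ} (hi : i + 1 < d * m) :
    (tq q i : Module.End ℝ (Y d m → ℝ)) * tq q i = 1 := by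
  refine op_sq (off_bq q) hi ?_ ?_
  · intro x y _
    rw [← neg_sub y x, bq_neg, bq_sq q hq hq1]; ring
  · intro x y _
    rw [← neg_sub y x, uq_neg]; ring

theorem tq_comm (q : ℝ) {i j : ℕ} (hij : i + 2 ≤ j) (hj : j + 1 < d * m) :
    (tq q i : Module.End ℝ (Y d m → ℝ)) * tq q j = tq q j * tq q i :=
  op_comm (off_bq q) (off_bq q) hij hj

theorem Tq_comm (q : ℝ) {i j : ℕ} (hij : i + 2 ≤ j) (hj : j + 1 < d * m) :
    (Tq q i : Module.End ℝ (Y d m → ℝ)) * Tq q j = Tq q j * Tq q i :=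
  op_comm (off_bq q) (off_bq q) hij hj

theorem Tq_braid (q : ℝ) (hq : 0 < q) (hq1 : q < 1) {i : ℕ} (hi : i + 2 < d * m) :
    (Tq q i : Module.End ℝ (Y d m → ℝ)) * Tq q (i+1) * Tq q i = Tq q (i+1) * Tq q i * Tq q (i+1) := by
  have hinj : ∀ x y : ℤ, x ≠ y → q ^ (2*y) - q ^ (2*x) ≠ 0 := by
    intro x y h h2
    have := zpow_right_injective₀ hq hq1.ne (sub_eq_zero.1 h2)
    omega
  have hbb : ∀ x y : ℤ, bq q (y - x) * bq q (x - y) =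
      1 + (q ^ (y - x) * uq q (y - x)) * (q ^ (x - y) * uq q (x - y)) := by
    intro x y
    rw [← neg_sub y x, bq_neg, bq_sq q hq.le hq1.le, uq_neg, zpow_neg]
    have := zpow_ne_zero (y - x) hq.ne'
    field_simp
    ring
  refine op_braid (off_bq q) hi ?_ ?_ ?_
  · intro x y z h1 h2 h3
    rw [alq_closed q hq hq1 x y h1, alq_closed q hq hq1 y z h2, alq_closed q hq hq1 x z h3,
      alq_closed q hq hq1 y x h1.symm]
    have a1 := hinj x y h1; have a2 := hinj y z h2; have a3 := hinj x z h3; have a4 := hinj y x h1.symm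
    generalize q ^ (2*x) = X at *
    generalize q ^ (2*y) = Y at *
    generalize q ^ (2*z) = Z at *
    generalize q - q⁻¹ = k at *
    rw [← neg_sub Y X]
    field_simp
    ring
  · intro x y z h1 h2 h3
    rw [alq_closed q hq hq1 x y h1, alq_closed q hq hq1 y z h2, alq_closed q hq hq1 x z h3,
      alq_closed q hq hq1 z y h2.symm]
    have a1 := hinj x y h1; have a2 := hinj y z h2; have a3 := hinj x z h3; have a4 := hinj z y h2.symm
    generalize q ^ (2*x) = X at *
    generalize q ^ (2*y) = Y at *
    generalize q ^ (2*z) = Z at *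
    generalize q - q⁻¹ = k at *
    rw [← neg_sub Z Y]
    field_simp
    ring
  · intro x y z h1 h2 h3
    rw [hbb, hbb]
    rw [alq_closed q hq hq1 x y h1, alq_closed q hq hq1 y z h2, alq_closed q hq hq1 x z h3,
      alq_closed q hq hq1 z y h2.symm, alq_closed q hq hq1 y x h1.symm]
    have a1 := hinj x y h1; have a2 := hinj y z h2; have a3 := hinj x z h3; have a4 := hinj z y h2.symm
    generalize q ^ (2*x) = X at *
    generalize q ^ (2*y) = Y at *
    generalize q ^ (2*z) = Z at *
    generalize q - q⁻¹ = k at *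
    rw [← neg_sub Z Y, ← neg_sub Y X]
    field_simp
    ring

theorem t1_braid {i : ℕ} (hi : i + 2 < d * m) :
    (tq 1 i : Module.End ℝ (Y d m → ℝ)) * tq 1 (i+1) * tq 1 i = tq 1 (i+1) * tq 1 i * tq 1 (i+1) := by
  have hne : ∀ x y : ℤ, x ≠ y → (y:ℝ) - x ≠ 0 := by
    intro x y h h2
    apply h; have := sub_eq_zero.1 h2; exact_mod_cast this.symm
  refine op_braid (off_bq 1) hi ?_ ?_ ?_
  · intro x y z h1 h2 h3
    simp only [uq_at_one]; push_cast
    have a1 := hne x y h1; have a2 := hne y z h2; have a3 := hne x z h3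
    rw [← neg_sub (y:ℝ) x]
    field_simp
    ring
  · intro x y z h1 h2 h3
    simp only [uq_at_one]; push_cast
    have a1 := hne x y h1; have a2 := hne y z h2; have a3 := hne x z h3
    rw [← neg_sub (z:ℝ) y]
    field_simp
    ring
  · intro x y z h1 h2 h3
    rw [← neg_sub y x, ← neg_sub z y, bq_neg, bq_neg, bq_sq 1 (by norm_num) le_rfl, bq_sq 1 (by norm_num) le_rfl]
    simp only [uq_at_one]; push_cast
    have a1 := hne x y h1; have a2 := hne y z h2; have a3 := hne x z h3
    field_simp
    ring
end Wd

-- Part W5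
/-! ### `P_q ^ N = 1` -/
namespace Wd
variable {d m : ℕ}

/-- diagonal operators -/
noncomputable def dg (g : Y d m → ℝ) : Module.End ℝ (Y d m → ℝ) where
  toFun f w := g w * f w
  map_add' f g := by ext w; simp; ring
  map_smul' c f := by ext w; simp; ring

theorem dg_apply (g f : Y d m → ℝ) (w : Y d m) : dg g f w = g w * f w := rfl

theorem dg_mul (g h : Y d m → ℝ) : dg g * dg h = dg (fun w => g w * h w) := by
  refine LinearMap.ext fun f => funext fun w => ?_
  simp only [Module.End.mul_apply, dg_apply]; ring

theorem dg_const (c : ℝ) : (dg (fun _ => c) : Module.End ℝ (Y d m → ℝ)) = c • 1 := by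
  refine LinearMap.ext fun f => funext fun w => ?_
  simp [dg_apply]

theorem dg_comm_tq (q : ℝ) (i : ℕ) (g : Y d m → ℝ) (h : ∀ w, g (sw i w) = g w) :
    tq q i * dg g = dg g * tq q i := by
  refine LinearMap.ext fun f => funext fun w => ?_
  simp only [Module.End.mul_apply, dg_apply, tq, op_apply, h]; ring

theorem con_sw_add (i : ℕ) (w : Y d m) :
    con (sw i w).1 i + con (sw i w).1 (i+1) = con w.1 i + con w.1 (i+1) := by
  by_cases h : Valid d m (swp i w.1)
  · rw [sw_of_valid h]
    by_cases h2 : w.1 i = w.1 (i+1)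
    · rw [swp_eq_self _ _ h2]
    · rw [con_swp _ _ h2, con_swp' _ _ h2]; ring
  · rw [sw, dif_neg h]

noncomputable def Dq (q : ℝ) (k : ℕ) : Module.End ℝ (Y d m → ℝ) := dg (fun w => q ^ con w.1 k)
noncomputable def Di (q : ℝ) (k : ℕ) : Module.End ℝ (Y d m → ℝ) := dg (fun w => q ^ (-con w.1 k))

theorem Tq_eq (q : ℝ) (hq : 0 < q) {i : ℕ} (hi : i + 1 < d * m) :
    (Tq q i : Module.End ℝ (Y d m → ℝ)) = Dq q (i+1) * tq q i * Di q i := by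
  refine LinearMap.ext fun f => funext fun w => ?_
  simp only [Module.End.mul_apply, dg_apply, tq, Tq, Dq, Di, op_apply]
  have e : q ^ con w.1 (i+1) * q ^ (- con w.1 i) = q ^ (con w.1 (i+1) - con w.1 i) := by
    rw [← zpow_add₀ hq.ne']; rfl
  by_cases h : bq q (con w.1 (i+1) - con w.1 i) = 0
  · rw [h, ← e]; ring
  · have e2 := ((off_bq q).move hi w h).2.1
    have e3 : q ^ con w.1 (i+1) * q ^ (- con (sw i w).1 i) = 1 := by
      rw [e2, ← zpow_add₀ hq.ne']; simp
    rw [← e]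
    linear_combination (- bq q (con w.1 (i+1) - con w.1 i) * f (sw i w)) * e3

theorem Tq_J (q : ℝ) (hq : 0 < q) (hq1 : q < 1) {k : ℕ} (hk : k + 1 < d * m) :
    (dg (fun w => q ^ (2 * con w.1 (k+1))) : Module.End ℝ (Y d m → ℝ)) =
      Tq q k * dg (fun w => q ^ (2 * con w.1 k)) * Tq q k := by
  have hq0 := hq.ne'
  have h1 : (Di q k * dg (fun w => q ^ (2 * con w.1 k)) * Dq q (k+1) : Module.End ℝ (Y d m → ℝ)) =
      dg (fun w => q ^ (con w.1 k + con w.1 (k+1))) := by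
    rw [Di, Dq, dg_mul, dg_mul]; congr 1; ext w
    rw [← zpow_add₀ hq0, ← zpow_add₀ hq0]; congr 1; ring
  have h2 : tq q k * dg (fun w => q ^ (con w.1 k + con w.1 (k+1))) =
     dg (fun w : Y d m => q ^ (con w.1 k + con w.1 (k+1))) * tq q k :=
    dg_comm_tq q k _ (fun w => by rw [con_sw_add])
  have h3 : (Dq q (k+1) * dg (fun w => q ^ (con w.1 k + con w.1 (k+1))) * Di q k :  Module.End ℝ (Y d m → ℝ)) =
      dg (fun w => q ^ (2 * con w.1 (k+1))) := by
    rw [Di, Dq, dg_mul, dg_mul]; congr 1; ext w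
    rw [← zpow_add₀ hq0, ← zpow_add₀ hq0]; congr 1; ring
  rw [Tq_eq q hq hk, ← h3]
  calc _ = Dq q (k+1) * dg (fun w => q ^ (con w.1 k + con w.1 (k+1))) * (tq q k * tq q k) * Di q k := by
        rw [tq_sq q hq.le hq1.le hk, mul_one]
    _ = Dq q (k+1) * (dg (fun w => q ^ (con w.1 k + con w.1 (k+1))) * tq q k) * tq q k * Di q k := by
        simp only [mul_assoc]
    _ = Dq q (k+1) * (tq q k * (Di q k * dg (fun w => q ^ (2 * con w.1 k)) * Dq q (k+1))) * tq q k * Di q k := by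
        rw [h1, h2]
    _ = _ := by simp only [mul_assoc]

/-- the cyclic-shift operator -/
noncomputable def Pq (d m : ℕ) (q : ℝ) : Module.End ℝ (Y d m → ℝ) := dl (tq q) (d * m - 1)

theorem dl_tq_comm (q : ℝ) (n : ℕ) (g : Y d m → ℝ) (h : ∀ i < n, ∀ w, g (sw i w) = g w) :
    dl (tq q) n * dg g = dg g * dl (tq q) n := by
  induction n with
  | zero => simp [dl]
  | succ n ih =>
    rw [dl, mul_assoc, dg_comm_tq q n g (h n (by omega)), ← mul_assoc, ih fun i hi => h i (by omega), mul_assoc]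

theorem dl_Tq (q : ℝ) (hq : 0 < q) (n : ℕ) (hn : n < d * m) :
    (dl (Tq q) n : Module.End ℝ (Y d m → ℝ)) =
      dg (fun w => q ^ (∑ k ∈ Finset.range n, con w.1 (k+1))) * dl (tq q) n *
      dg (fun w => q ^ (-∑ k ∈ Finset.range n, con w.1 k)) := by
  have hq0 := hq.ne'
  induction n with
  | zero => simp [dl, dg_const]
  | succ n ih =>
    have e1 : (dg (fun w => q ^ (∑ k ∈ Finset.range (n+1), con w.1 (k+1))) : Module.End ℝ (Y d m → ℝ)) =
      dg (fun w => q ^ (∑ k ∈ Finset.range n, con w.1 (k+1))) * Dq q (n+1) := by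
      rw [Dq, dg_mul]; congr 1; ext w; rw [← zpow_add₀ hq0, Finset.sum_range_succ]
    have e2 : (dg (fun w => q ^ (-∑ k ∈ Finset.range (n+1), con w.1 k)) : Module.End ℝ (Y d m → ℝ)) =
      dg (fun w => q ^ (-∑ k ∈ Finset.range n, con w.1 k)) * Di q n := by
      rw [Di, dg_mul]; congr 1; ext w; rw [← zpow_add₀ hq0, Finset.sum_range_succ]; congr 1; ring
    have c1 : (dl (tq q) n * Dq q (n+1) : Module.End ℝ (Y d m → ℝ)) = Dq q (n+1) * dl (tq q) n :=
      dl_tq_comm q n _ fun i hi w => by rw [con_sw_of_ne _ _ _ (by omega) (by omega)]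
    have c2 : (tq q n * dg (fun w => q ^ (-∑ k ∈ Finset.range n, con w.1 k)) : Module.End ℝ (Y d m → ℝ)) =
       dg (fun w => q ^ (-∑ k ∈ Finset.range n, con w.1 k)) * tq q n := by
      refine dg_comm_tq q n _ fun w => ?_
      congr 2
      refine Finset.sum_congr rfl fun k hk => ?_
      have := Finset.mem_range.1 hk
      rw [con_sw_of_ne _ _ _ (by omega) (by omega)]
    have c3 : (dg (fun w => q ^ (-∑ k ∈ Finset.range n, con w.1 k)) * Dq q (n+1) : Module.End ℝ (Y d m → ℝ)) =
       Dq q (n+1) * dg (fun w => q ^ (-∑ k ∈ Finset.range n, con w.1 k)) := by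
      rw [Dq, dg_mul, dg_mul]; congr 1; ext w; ring
    rw [dl, ih (by omega), Tq_eq q hq (by omega), e1, e2, dl]
    generalize (dg (fun w => q ^ (-∑ k ∈ Finset.range n, con w.1 k)) : Module.End ℝ (Y d m → ℝ)) = A at *
    generalize (dg (fun w => q ^ (∑ k ∈ Finset.range n, con w.1 (k+1))) : Module.End ℝ (Y d m → ℝ)) = B at *
    generalize (dl (tq q) n : Module.End ℝ (Y d m → ℝ)) = F at *
    calc B * F * A * (Dq q (n+1) * tq q n * Di q n) = B * F * (A * Dq q (n+1)) * tq q n * Di q n := by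
          simp only [mul_assoc]
      _ = B * (F * Dq q (n+1)) * (A * tq q n) * Di q n := by rw [c3]; simp only [mul_assoc]
      _ = _ := by rw [c1, ← c2]; simp only [mul_assoc]

theorem dl_Tq_pow (q : ℝ) (hq : 0 < q) (hq1 : q < 1) (h0 : ∀ w : Y d m, con w.1 0 = 0) (n : ℕ) (hn : n < d * m) :
    (dl (Tq q) n ^ (n+1) : Module.End ℝ (Y d m → ℝ)) =
      dg (fun w => q ^ (2 * ∑ k ∈ Finset.range (n+1), con w.1 k)) := by
  induction n with
  | zero => simp [dl, h0, dg_const]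
  | succ n ih =>
    rw [twist (Tq q) (d * m - 1) (fun i hi => Tq_braid q hq hq1 (by omega))
      (fun i j h1 h2 => Tq_comm q h1 (by omega)) (fun k => dg (fun w => q ^ (2 * con w.1 k)))
      (by simp [h0, dg_const]) (fun k hk => Tq_J q hq hq1 (by omega)) n (by omega), ih (by omega), dg_mul]
    congr 1; ext w
    rw [← zpow_add₀ hq.ne', Finset.sum_range_succ _ (n+1)]; congr 1; ring

theorem Valid.zero {w : ℕ → ℕ} (h : Valid d m w) (hN : 0 < d * m) : w 0 = 0 := by
  have h0 := h.lt 0 hN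
  have := h.anti (Nat.zero_le (w 0)) h0 1
  rw [cnt_succ, cnt_succ, cnt_zero, cnt_zero, if_pos rfl] at this
  by_contra hc
  rw [if_neg hc] at this; omega

theorem Valid.con_zero {w : ℕ → ℕ} (h : Valid d m w) (hN : 0 < d * m) : con w 0 = 0 := by
  simp [con, h.zero hN, cnt_zero]

theorem Valid.last {w : ℕ → ℕ} (h : Valid d m w) {n : ℕ} (hN : d * m = n + 1) : w n = d - 1 := by
  have h0 := h.lt n (by omega)
  by_contra hc
  have h1 := h.fin (d-1) (by omega)
  have h2 := h.fin (w n) h0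
  rw [hN, cnt_succ] at h1 h2
  rw [if_neg hc] at h1
  rw [if_pos rfl] at h2
  have := h.anti (show w n ≤ d - 1 by omega) (by omega) n
  omega

theorem Valid.con_last {w : ℕ → ℕ} (h : Valid d m w) {n : ℕ} (hN : d * m = n + 1) :
    con w n = (m:ℤ) - d := by
  have h0 := h.lt n (by omega)
  have h2 := h.fin (w n) h0
  rw [hN, cnt_succ, if_pos rfl, h.last hN] at h2
  rw [con, h.last hN]; omega

theorem Valid.sum_con {w : ℕ → ℕ} (h : Valid d m w) (k : ℕ) (hk : k ≤ d * m) :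
    2 * ∑ t ∈ Finset.range k, con w t =
      ∑ i ∈ Finset.range d, ((cnt w i k : ℤ) * (cnt w i k - 1) - 2 * i * cnt w i k) := by
  induction k with
  | zero => simp [cnt_zero]
  | succ k ih =>
    rw [Finset.sum_range_succ, mul_add, ih (by omega)]
    have e : ∀ i ∈ Finset.range d, ((cnt w i (k+1) : ℤ) * (cnt w i (k+1) - 1) - 2 * i * cnt w i (k+1)) =
      ((cnt w i k : ℤ) * (cnt w i k - 1) - 2 * i * cnt w i k) + if w k = i then 2 * con w k else 0 := by
      intro i _
      rw [cnt_succ]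
      split_ifs with h1
      · subst h1; simp only [con]; push_cast; ring
      · simp
    rw [Finset.sum_congr rfl e, Finset.sum_add_distrib, Finset.sum_ite_eq, if_pos]
    exact Finset.mem_range.2 (h.lt k (by omega))

theorem Valid.sum_con_all {w : ℕ → ℕ} (h : Valid d m w) :
    2 * ∑ t ∈ Finset.range (d * m), con w t = (d * m : ℕ) * ((m:ℤ) - d) := by
  rw [h.sum_con _ le_rfl]
  have : ∀ i ∈ Finset.range d, ((cnt w i (d*m) : ℤ) * (cnt w i (d*m) - 1) - 2 * i * cnt w i (d*m)) =
     (m:ℤ) * (m - 1) - m * (2 * (i:ℤ)) := by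
    intro i hi; rw [h.fin i (Finset.mem_range.1 hi)]; ring
  rw [Finset.sum_congr rfl this, Finset.sum_sub_distrib, ← Finset.mul_sum, ← Finset.mul_sum]
  have g : 2 * ∑ i ∈ Finset.range d, (i:ℤ) = d * (d - 1) := by
    clear * -
    induction d with
    | zero => simp
    | succ k ih => rw [Finset.sum_range_succ, mul_add, ih]; push_cast; ring
  rw [← Finset.mul_sum (Finset.range d) (fun i : ℕ => (i:ℤ)) 2, g]; simp; ring

theorem Pq_pow (q : ℝ) (hq : 0 < q) (hq1 : q < 1) (hN : 0 < d * m) : Pq d m q ^ (d * m) = 1 := by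
  obtain ⟨n, hn⟩ : ∃ n, d * m = n + 1 := ⟨d * m - 1, by omega⟩
  have hq0 := hq.ne'
  have h0 : ∀ w : Y d m, con w.1 0 = 0 := fun w => w.2.con_zero hN
  have hP := dl_Tq_pow q hq hq1 h0 n (by omega)
  have hS : ∀ w : Y d m, 2 * ∑ k ∈ Finset.range (n+1), con w.1 k = ((n+1 : ℕ) : ℤ) * ((m:ℤ) - d) := by
    intro w; have := w.2.sum_con_all; rw [hn] at this; exact this
  have e1 : (dl (Tq q) n : Module.End ℝ (Y d m → ℝ)) = q ^ ((m:ℤ) - d) • Pq d m q := by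
    have hc : ∃ S : ℤ, ∀ w : Y d m, ∑ k ∈ Finset.range (n+1), con w.1 k = S := by
      refine ⟨((n+1 : ℕ) : ℤ) * ((m:ℤ) - d) / 2, fun w => ?_⟩
      rw [← hS w]; simp
    obtain ⟨S, hS'⟩ := hc
    have a1 : ∀ w : Y d m, ∑ k ∈ Finset.range n, con w.1 (k+1) = S := by
      intro w; rw [← hS' w, Finset.sum_range_succ', h0, add_zero]
    have a2 : ∀ w : Y d m, -∑ k ∈ Finset.range n, con w.1 k = (m:ℤ) - d - S := by
      intro w; rw [← hS' w, Finset.sum_range_succ, w.2.con_last hn]; ring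
    rw [dl_Tq q hq n (by omega)]
    simp only [a1, a2, dg_const]
    rw [Pq, hn]
    simp only [smul_mul_assoc, one_mul, mul_smul_comm, mul_one, smul_smul, Nat.add_sub_cancel]
    rw [← zpow_add₀ hq0]; congr 2; ring
  rw [e1, _root_.smul_pow, ← hn] at hP
  have e2 : (dg (fun w => q ^ (2 * ∑ k ∈ Finset.range (d*m), con w.1 k)) : Module.End ℝ (Y d m → ℝ)) =
     (q ^ ((m:ℤ) - d)) ^ (d * m) • 1 := by
    rw [← dg_const]; congr 1; ext w
    rw [hn, hS w, mul_comm, zpow_mul, zpow_natCast]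
  rw [e2] at hP
  exact smul_right_injective _ (pow_ne_zero _ (zpow_ne_zero _ hq0)) hP

end Wd

-- Part W6
/-! ### The trace does not depend on `q` -/
namespace Wd
variable {d m : ℕ}

theorem tr_eq (A : Module.End ℝ (Y d m → ℝ)) :
    LinearMap.trace ℝ _ A = ∑ w, A (Pi.single w 1) w := by
  rw [LinearMap.trace_eq_matrix_trace ℝ (Pi.basisFun ℝ (Y d m)), Matrix.trace]
  refine Finset.sum_congr rfl fun w _ => ?_
  simp [LinearMap.toMatrix_apply]

theorem trace_alg {ι : Type*} [Fintype ι] [DecidableEq ι] (A : Matrix ι ι ℝ) (n : ℕ) (hn : 0 < n)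
    (h : A ^ n = 1) : IsAlgebraic ℚ A.trace := by
  let B : Matrix ι ι ℂ := A.map Complex.ofRealHom
  have hB : B ^ n = 1 := by
    have := congrArg (Complex.ofRealHom.mapMatrix (m := ι)) h
    rw [map_pow, map_one] at this
    exact this
  have ht : (A.trace : ℂ) = B.trace := by
    simp [B, Matrix.trace]
  have hIntg : IsIntegral ℚ (A.trace : ℂ) := by
    rw [ht, Matrix.trace_eq_sum_roots_charpoly]
    refine IsIntegral.multiset_sum fun x hx => ?_
    have hx1 : IsRoot B.charpoly x := (Polynomial.mem_roots'.1 hx).2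
    have hx2 := Matrix.mem_spectrum_of_isRoot_charpoly hx1
    have hx3 := spectrum.pow_mem_pow B n hx2
    rw [hB] at hx3
    have hne : Nontrivial (Matrix ι ι ℂ) := by
      by_contra hc
      rw [not_nontrivial_iff_subsingleton] at hc
      rw [spectrum.of_subsingleton] at hx2
      exact hx2
    rw [spectrum.one_eq] at hx3
    have : x ^ n = 1 := by simpa using hx3
    exact IsIntegral.of_pow hn (by rw [this]; exact isIntegral_one)
  have := (isIntegral_algebraMap_iff (R := ℚ) (algebraMap ℝ ℂ).injective).1 hIntg
  exact this.isAlgebraic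

theorem tr_alg (A : Module.End ℝ (Y d m → ℝ)) (n : ℕ) (hn : 0 < n) (h : A ^ n = 1) :
    IsAlgebraic ℚ (LinearMap.trace ℝ _ A) := by
  rw [LinearMap.trace_eq_matrix_trace ℝ (Pi.basisFun ℝ (Y d m))]
  refine trace_alg _ n hn ?_
  rw [LinearMap.toMatrix_pow, h]
  simp

/-- coordinatewise continuous families of operators -/
def CO (A : ℝ → Module.End ℝ (Y d m → ℝ)) : Prop :=
  ∀ F : ℝ → (Y d m → ℝ), (∀ w, ContinuousOn (fun q => F q w) (Set.Icc 0 1)) →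
    ∀ w, ContinuousOn (fun q => A q (F q) w) (Set.Icc 0 1)

theorem CO.mul {A B : ℝ → Module.End ℝ (Y d m → ℝ)} (hA : CO A) (hB : CO B) :
    CO (fun q => A q * B q) := fun F hF => hA (fun q => B q (F q)) (hB F hF)

theorem CO.one : CO (fun _ => (1 : Module.End ℝ (Y d m → ℝ))) := fun _ hF => hF

theorem CO.pow {A : ℝ → Module.End ℝ (Y d m → ℝ)} (hA : CO A) (n : ℕ) : CO (fun q => A q ^ n) := by
  induction n with
  | zero => simpa using CO.one
  | succ n ih => simp only [pow_succ]; exact ih.mul hA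

theorem CO.tq {i : ℕ} (hi : i + 1 < d * m) : CO (fun q => (tq q i : Module.End ℝ (Y d m → ℝ))) := by
  intro F hF w
  simp only [Wd.tq, op_apply]
  have := sub_ne_zero.2 (w.2.con_ne hi).symm
  exact ((uq_cont _ this).mul (hF w)).add ((bq_cont _ this).mul (hF _))

theorem CO.dl (n : ℕ) (hn : n < d * m) :
    CO (fun q => (dl (Wd.tq q) n : Module.End ℝ (Y d m → ℝ))) := by
  induction n with
  | zero => exact CO.one
  | succ n ih => exact (ih (by omega)).mul (CO.tq hn)

theorem CO.trace {A : ℝ → Module.End ℝ (Y d m → ℝ)} (hA : CO A) :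
    ContinuousOn (fun q => LinearMap.trace ℝ _ (A q)) (Set.Icc 0 1) := by
  simp only [tr_eq]
  refine continuousOn_finsetSum _ fun w _ => ?_
  exact hA (fun _ => Pi.single w 1) (fun _ => continuousOn_const) w

theorem tr_const (hN : 0 < d * m) (l : ℕ) :
    LinearMap.trace ℝ _ (Pq d m 0 ^ l) = LinearMap.trace ℝ _ (Pq d m 1 ^ l) := by
  have hc : ContinuousOn (fun q => LinearMap.trace ℝ _ (Pq d m q ^ l)) (Set.Icc 0 1) :=
    ((CO.dl (d * m - 1) (by omega)).pow l).trace
  set f : ℝ → ℝ := fun q => LinearMap.trace ℝ _ (Pq d m q ^ l) with hf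
  have halg : ∀ q ∈ Set.Ioo (0:ℝ) 1, IsAlgebraic ℚ (f q) := by
    intro q hq
    refine tr_alg _ (d * m) hN ?_
    rw [← pow_mul, mul_comm, pow_mul, Pq_pow q hq.1 hq.2 hN, one_pow]
  have hsub : (f '' Set.Ioo 0 1).Subsingleton := by
    refine (Algebraic.countable ℚ ℝ).isTotallyDisconnected _ ?_ ?_
    · rintro _ ⟨q, hq, rfl⟩; exact halg q hq
    · exact isPreconnected_Ioo.image f (hc.mono Set.Ioo_subset_Icc_self)
  have hK : ∀ q ∈ Set.Ioo (0:ℝ) 1, f q = f (1/2) := fun q hq =>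
    hsub ⟨q, hq, rfl⟩ ⟨1/2, by norm_num, rfl⟩
  have hall : ∀ q ∈ Set.Icc (0:ℝ) 1, f q = f (1/2) := by
    have hcl : Set.Icc (0:ℝ) 1 ⊆ closure (Set.Ioo 0 1) := by rw [closure_Ioo (by norm_num)]
    exact Set.EqOn.of_subset_closure (f := f) (g := fun _ => f (1/2)) hK hc continuousOn_const
      Set.Ioo_subset_Icc_self hcl
  exact (hall 0 (by simp)).trans (hall 1 (by simp)).symm
end Wd

-- Part S1
/-! ### Coxeter relations and the symmetric group -/
namespace Wd
section cox
variable {M : Type*} [Monoid M]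

/-- product of the `σ i`, `i < n`, with `p i` -/
noncomputable def dlp (σ : ℕ → M) (p : ℕ → Prop) [DecidablePred p] : ℕ → M
  | 0 => 1
  | n+1 => dlp σ p n * if p n then σ n else 1

structure Cox (σ : ℕ → M) (K : ℕ) : Prop where
  sq : ∀ i, i < K → σ i * σ i = 1
  braid : ∀ i, i + 1 < K → σ i * σ (i+1) * σ i = σ (i+1) * σ i * σ (i+1)
  comm : ∀ i j, i + 2 ≤ j → j < K → σ i * σ j = σ j * σ i

theorem Cox.rh_comm {σ : ℕ → M} {K : ℕ} (h : Cox σ K) (k j i : ℕ) (hk : k < K) (hj : j ≤ k)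
    (hi : i + j < k) : rh σ k j * σ i = σ i * rh σ k j := by
  induction j with
  | zero => simp [rh]
  | succ j ih =>
    rw [rh, mul_assoc, ← h.comm i (k-j) (by omega) (by omega), ← mul_assoc, ih (by omega) (by omega), mul_assoc]

theorem Cox.rh_shift {σ : ℕ → M} {K : ℕ} (h : Cox σ K) (k j i : ℕ) (hk : k < K) (hj : j ≤ k + 1)
    (hi : k + 1 < i + 1 + j) (hik : i + 1 ≤ k) : rh σ k j * σ (i+1) = σ i * rh σ k j := by
  have hj2 : k + 1 - i ≤ j := by omega
  induction j, hj2 using Nat.le_induction with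
  | base =>
    obtain ⟨u, rfl⟩ : ∃ u, k = i + 1 + u := ⟨k - i - 1, by omega⟩
    have e : i + 1 + u + 1 - i = u + 1 + 1 := by omega
    rw [e, rh, rh]
    have e1 : i + 1 + u - u = i + 1 := by omega
    have e2 : i + 1 + u - (u+1) = i := by omega
    rw [e1, e2, mul_assoc, mul_assoc, ← mul_assoc (σ (i+1)), ← h.braid i (by omega), ← mul_assoc, ← mul_assoc,
      h.rh_comm _ _ _ hk (by omega) (by omega)]
    simp only [mul_assoc]
  | succ j hj2 ih =>
    rw [rh, mul_assoc, h.comm (k-j) (i+1) (by omega) (by omega), ← mul_assoc, ih (by omega) (by omega), mul_assoc]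

open Classical in
/-- normal forms -/
noncomputable def nf (σ : ℕ → M) : ℕ → Finset M
  | 0 => {1}
  | k+1 => Finset.image₂ (fun g j => g * rh σ k j) (nf σ k) (Finset.range (k+2))

theorem nf_card (σ : ℕ → M) (k : ℕ) : (nf σ k).card ≤ (k+1).factorial := by
  classical
  induction k with
  | zero => simp [nf]
  | succ k ih =>
    rw [nf]
    refine (Finset.card_image₂_le _ _ _).trans ?_
    rw [Finset.card_range, Nat.factorial_succ (k+1), mul_comm]
    exact Nat.mul_le_mul_left _ ih

theorem nf_one (σ : ℕ → M) (k : ℕ) : 1 ∈ nf σ k := by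
  classical
  induction k with
  | zero => simp [nf]
  | succ k ih =>
    rw [nf, Finset.mem_image₂]
    exact ⟨1, ih, 0, by simp, by simp [rh]⟩

theorem Cox.nf_mul {σ : ℕ → M} {K : ℕ} (h : Cox σ K) (k : ℕ) (hk : k ≤ K) (i : ℕ) (hi : i < k) (x : M)
    (hx : x ∈ nf σ k) : x * σ i ∈ nf σ k := by
  classical
  induction k generalizing i x with
  | zero => omega
  | succ k ih =>
    rw [nf, Finset.mem_image₂] at hx ⊢
    obtain ⟨g, hg, j, hj, rfl⟩ := hx
    rw [Finset.mem_range] at hj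
    rcases Nat.lt_trichotomy (i + j) k with h1 | h1 | h1
    · exact ⟨g * σ i, ih (by omega) i (by omega) g hg, j, by simpa using hj, by
        rw [mul_assoc, mul_assoc, h.rh_comm k j i (by omega) (by omega) (by omega)]⟩
    · refine ⟨g, hg, j+1, by simp; omega, ?_⟩
      rw [rh, mul_assoc]; congr 3; omega
    · rcases Nat.lt_or_ge (k+1) (i + j) with h2 | h2
      · obtain ⟨i, rfl⟩ : ∃ i', i = i' + 1 := ⟨i - 1, by omega⟩
        exact ⟨g * σ i, ih (by omega) i (by omega) g hg, j, by simpa using hj, by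
          rw [mul_assoc, mul_assoc, h.rh_shift k j i (by omega) (by omega) (by omega) (by omega)]⟩
      · obtain ⟨j, rfl⟩ : ∃ j', j = j' + 1 := ⟨j - 1, by omega⟩
        refine ⟨g, hg, j, by simp; omega, ?_⟩
        have : k - j = i := by omega
        rw [rh, this, mul_assoc, mul_assoc, h.sq i (by omega), mul_one]

/-- adjacent transposition in `Fin (n+1)` -/
def adj (n : ℕ) (i : ℕ) : Equiv.Perm (Fin (n+1)) :=
  Equiv.swap (Fin.ofNat (n+1) i) (Fin.ofNat (n+1) (i+1))

theorem adj_val (n i : ℕ) (hi : i < n) (x : Fin (n+1)) :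
    (adj n i x : ℕ) = if (x:ℕ) = i then i + 1 else if (x:ℕ) = i + 1 then i else x := by
  have h1 : (Fin.ofNat (n+1) i : ℕ) = i := by simp [Fin.ofNat]; omega
  have h2 : (Fin.ofNat (n+1) (i+1) : ℕ) = i+1 := by simp [Fin.ofNat]; omega
  rw [adj, Equiv.swap_apply_def]
  simp only [Fin.ext_iff, h1, h2]
  split_ifs <;> simp_all

theorem adj_cox (n : ℕ) : Cox (adj n) n := by
  refine ⟨?_, ?_, ?_⟩
  · intro i _; simp [adj]
  · intro i hi; ext x; simp only [Equiv.Perm.mul_apply]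
    simp only [adj_val n i (by omega), adj_val n (i+1) (by omega)]
    split_ifs <;> omega
  · intro i j hij hj; ext x; simp only [Equiv.Perm.mul_apply]
    simp only [adj_val n i (by omega), adj_val n j (by omega)]
    split_ifs <;> omega

theorem adj_induction (n : ℕ) (p : Equiv.Perm (Fin (n+1)) → Prop) (h1 : p 1)
    (hm : ∀ x i, i < n → p x → p (x * adj n i)) (x : Equiv.Perm (Fin (n+1))) : p x := by
  have hx : x ∈ Submonoid.closure (Set.range fun i : Fin n => Equiv.swap i.castSucc i.succ) := by
    rw [Equiv.Perm.mclosure_swap_castSucc_succ]; trivial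
  induction hx using Submonoid.closure_induction_right with
  | one => exact h1
  | mul_right x _ y hy ih =>
    obtain ⟨i, rfl⟩ := hy
    have : adj n i = Equiv.swap i.castSucc i.succ := by
      rw [adj]; congr 1
      · ext; simp [Fin.ofNat]
      · ext; simp [Fin.ofNat]
    simp only [← this]
    exact hm x i i.2 ih

theorem Cox.pair {σ : ℕ → M} {n : ℕ} (h : Cox σ n) :
    Cox (fun i => ((σ i, adj n i) : M × Equiv.Perm (Fin (n+1)))) n := by
  have ha := adj_cox n
  refine ⟨?_, ?_, ?_⟩
  · intro i hi; ext1
    · exact h.sq i hi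
    · exact ha.sq i hi
  · intro i hi; ext1
    · exact h.braid i hi
    · exact ha.braid i hi
  · intro i j hij hj; ext1
    · exact h.comm i j hij hj
    · exact ha.comm i j hij hj

theorem Cox.exists_hom {σ : ℕ → M} {n : ℕ} (h : Cox σ n) :
    ∃ φ : Equiv.Perm (Fin (n+1)) →* M, ∀ i < n, φ (adj n i) = σ i := by
  classical
  set τ := fun i => ((σ i, adj n i) : M × Equiv.Perm (Fin (n+1))) with hτ
  have hp : Cox τ n := h.pair
  have hsurj : ∀ x : Equiv.Perm (Fin (n+1)), ∃ y ∈ nf τ n, y.2 = x := by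
    refine adj_induction n _ ⟨1, nf_one _ _, rfl⟩ ?_
    rintro x i hi ⟨y, hy, rfl⟩
    exact ⟨y * τ i, hp.nf_mul n le_rfl i hi y hy, rfl⟩
  have himg : (nf τ n).image Prod.snd = Finset.univ := by
    ext x; simp only [Finset.mem_image, Finset.mem_univ, iff_true]; exact hsurj x
  have hinj : Set.InjOn Prod.snd (nf τ n : Set (M × Equiv.Perm (Fin (n+1)))) := by
    apply Finset.injOn_of_card_image_eq
    apply le_antisymm Finset.card_image_le
    rw [himg, Finset.card_univ, Fintype.card_perm, Fintype.card_fin]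
    exact nf_card _ _
  choose g hg hg2 using hsurj
  have hg1 : g 1 = 1 := hinj (hg 1) (nf_one _ _) (hg2 1)
  have hgs : ∀ x i, i < n → g (x * adj n i) = g x * τ i := fun x i hi =>
    hinj (hg _) (hp.nf_mul n le_rfl i hi _ (hg x)) (by rw [hg2]; simp [hg2, hτ])
  have hgm : ∀ x y, g (x * y) = g x * g y := by
    intro x
    refine adj_induction n _ (by rw [hg1, mul_one, mul_one]) ?_
    intro y i hi ih
    rw [← mul_assoc, hgs _ _ hi, hgs _ _ hi, ih, mul_assoc]
  refine ⟨⟨⟨fun x => (g x).1, by rw [hg1]; rfl⟩, fun x y => congrArg Prod.fst (hgm x y)⟩, ?_⟩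
  intro i hi
  have := hgs 1 i hi
  rw [one_mul, hg1, one_mul] at this
  simp only [MonoidHom.coe_mk, OneHom.coe_mk, this, hτ]

theorem map_dl {M' : Type*} [Monoid M'] (φ : M →* M') (σ : ℕ → M) (τ : ℕ → M') (n : ℕ)
    (h : ∀ i < n, φ (σ i) = τ i) : φ (dl σ n) = dl τ n := by
  induction n with
  | zero => simp [dl]
  | succ n ih => rw [dl, dl, map_mul, ih (fun i hi => h i (by omega)), h n (by omega)]

theorem map_dlp {M' : Type*} [Monoid M'] (φ : M →* M') (σ : ℕ → M) (τ : ℕ → M') (p : ℕ → Prop)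
    [DecidablePred p] (n : ℕ)
    (h : ∀ i < n, φ (σ i) = τ i) : φ (dlp σ p n) = dlp τ p n := by
  induction n with
  | zero => simp [dlp]
  | succ n ih =>
    rw [dlp, dlp, map_mul, ih (fun i hi => h i (by omega))]
    split_ifs
    · rw [h n (by omega)]
    · rw [map_one]

theorem dl_adj (n k : ℕ) (hk : k ≤ n) (x : Fin (n+1)) :
    (dl (adj n) k x : ℕ) = if (x:ℕ) < k then (x:ℕ) + 1 else if (x:ℕ) = k then 0 else x := by
  induction k generalizing x with
  | zero => simp only [dl, Equiv.Perm.one_apply]; split_ifs <;> omega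
  | succ k ih =>
    rw [dl, Equiv.Perm.mul_apply, ih (by omega), adj_val n k (by omega)]
    split_ifs <;> omega

theorem dl_adj_pow (n k : ℕ) (x : Fin (n+1)) :
    ((dl (adj n) n ^ k) x : ℕ) = (x + k) % (n+1) := by
  induction k with
  | zero => simp [Nat.mod_eq_of_lt x.2]
  | succ k ih =>
    rw [pow_succ', Equiv.Perm.mul_apply, dl_adj n n le_rfl, ih]
    have h3 := Nat.mod_lt (x+k) (Nat.succ_pos n)
    rw [← add_assoc, Nat.add_mod (↑x + k) 1]
    split_ifs with h1 h2
    · rcases Nat.eq_zero_or_pos n with rfl | hn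
      · omega
      · rw [Nat.mod_eq_of_lt (a := 1) (by omega), Nat.mod_eq_of_lt (a := (↑x+k) % (n+1) + 1) (by omega)]
    · rcases Nat.eq_zero_or_pos n with rfl | hn
      · omega
      · rw [Nat.mod_eq_of_lt (a := 1) (by omega), h2, Nat.mod_self]
    · omega

/-- start of the block of `x` -/
theorem dlp_adj (n r k : ℕ) (hr : 0 < r) (hk : k ≤ n) (x : Fin (n+1)) :
    (dlp (adj n) (fun i => (i+1) % r ≠ 0) k x : ℕ) =
      if (x:ℕ) < k ∧ ((x:ℕ)+1) % r ≠ 0 then (x:ℕ) + 1 else if (x:ℕ) ≤ k then x / r * r else x := by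
  induction k generalizing x with
  | zero =>
    simp only [dlp, Equiv.Perm.one_apply]
    split_ifs with h1 h2
    · omega
    · have : (x:ℕ) = 0 := by omega
      simp [this]
    · rfl
  | succ k ih =>
    rw [dlp, Equiv.Perm.mul_apply, ih (by omega)]
    have hdiv : (k+1) % r ≠ 0 → (k+1)/r = k / r := by
      intro h; rw [Nat.succ_div]; rw [if_neg]; · rfl
      · intro hd; exact h (Nat.mod_eq_zero_of_dvd hd)
    have hdiv2 : (k+1) % r = 0 → (k+1) / r * r = k+1 := fun h => Nat.div_mul_cancel (Nat.dvd_of_mod_eq_zero h)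
    by_cases hp : (k+1) % r ≠ 0
    · simp only [if_pos hp]
      rw [adj_val n k (by omega)]
      by_cases h1 : (x:ℕ) = k
      · rw [if_pos h1]; simp [h1, hp]
      · rw [if_neg h1]
        by_cases h2 : (x:ℕ) = k+1
        · simp [h2, hp, hdiv hp]
        · rw [if_neg h2]
          by_cases h3 : (x:ℕ) < k
          · simp [h3, show (x:ℕ) < k+1 by omega, show (x:ℕ) ≤ k by omega, show (x:ℕ) ≤ k+1 by omega]
          · simp [h3, show ¬ (x:ℕ) < k+1 by omega, show ¬ (x:ℕ) ≤ k by omega, show ¬ (x:ℕ) ≤ k+1 by omega]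
    · simp only [if_neg hp, Equiv.Perm.one_apply]
      push Not at hp
      by_cases h1 : (x:ℕ) = k
      · simp [h1, hp]
      · by_cases h2 : (x:ℕ) = k+1
        · simp [h2, hdiv2 hp]
        · by_cases h3 : (x:ℕ) < k
          · simp [h3, show (x:ℕ) < k+1 by omega, show (x:ℕ) ≤ k by omega, show (x:ℕ) ≤ k+1 by omega]
          · simp [h3, show ¬ (x:ℕ) < k+1 by omega, show ¬ (x:ℕ) ≤ k by omega, show ¬ (x:ℕ) ≤ k+1 by omega]

theorem perm_conj (n r l : ℕ) (hr : 0 < r) (h : r * l = n + 1) :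
    ∃ π : Equiv.Perm (Fin (n+1)), π * dlp (adj n) (fun i => (i+1) % r ≠ 0) n = dl (adj n) n ^ l * π := by
  have hl : 0 < l := by rcases Nat.eq_zero_or_pos l with rfl | hl; · simp at h
                        · exact hl
  let π : Equiv.Perm (Fin (n+1)) :=
    (finCongr (show n+1 = l * r by rw [← h, mul_comm])).trans (finProdFinEquiv.symm.trans
      ((Equiv.prodComm _ _).trans (finProdFinEquiv.trans (finCongr h))))
  have hπ : ∀ x, (π x : ℕ) = x / r + l * (x % r) := by
    intro x
    simp [π, finProdFinEquiv, Fin.divNat, Fin.modNat]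
  refine ⟨π, ?_⟩
  ext x
  rw [Equiv.Perm.mul_apply, Equiv.Perm.mul_apply, hπ, dl_adj_pow, hπ, dlp_adj n r n hr le_rfl]
  have hx := x.2
  obtain ⟨q, t, ht, hq⟩ : ∃ q t, t < r ∧ (x:ℕ) = t + r * q :=
    ⟨x / r, x % r, Nat.mod_lt _ hr, (Nat.mod_add_div _ _).symm⟩
  have hql : q < l := by
    by_contra hc
    have := Nat.mul_le_mul_left r (not_lt.1 hc)
    omega
  rw [hq]
  have e1 : (t + r * q) / r = q := by rw [Nat.add_mul_div_left _ _ hr, Nat.div_eq_of_lt ht, zero_add]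
  have e2 : (t + r * q) % r = t := by rw [Nat.add_mul_mod_self_left, Nat.mod_eq_of_lt ht]
  rw [e1, e2]
  by_cases htr : t + 1 = r
  · have e3 : (t + r * q + 1) % r = 0 := by
      rw [show t + r * q + 1 = r * (q+1) by rw [← htr]; ring]; simp
    rw [if_neg (by simp [e3]), if_pos (by omega), Nat.mul_div_cancel _ hr, Nat.mul_mod_left]
    rw [show q + l * t + l = q + r * l by rw [← htr]; ring, h, Nat.add_mod_right, Nat.mod_eq_of_lt]
    · simp
    · nlinarith
  · have e3 : (t + r * q + 1) % r = t + 1 := by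
      rw [show t + r * q + 1 = t + 1 + r * q by ring, Nat.add_mul_mod_self_left, Nat.mod_eq_of_lt (by omega)]
    have e4 : (t + r * q + 1) / r = q := by
      rw [show t + r * q + 1 = t + 1 + r * q by ring, Nat.add_mul_div_left _ _ hr, Nat.div_eq_of_lt (by omega), zero_add]
    have e5 : t + r * q < n := by
      have := Nat.mul_le_mul_left r (show q + 1 ≤ l from hql)
      rw [mul_add] at this
      omega
    rw [if_pos ⟨e5, by rw [e3]; omega⟩, e3, e4, Nat.mod_eq_of_lt]
    · ring
    · rw [← h]
      have := Nat.mul_le_mul_right l (show t + 2 ≤ r by omega)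
      nlinarith
end cox

variable {d m : ℕ}
theorem tr_sym (r l n : ℕ) (hr : 0 < r) (h : r * l = n + 1) (hN : d * m = n + 1) :
    LinearMap.trace ℝ _ (Pq d m 1 ^ l) =
    LinearMap.trace ℝ _ (dlp (tq 1) (fun i => (i+1) % r ≠ 0) n : Module.End ℝ (Y d m → ℝ)) := by
  have hc : Cox (tq 1 : ℕ → Module.End ℝ (Y d m → ℝ)) n :=
    ⟨fun i hi => tq_sq 1 (by norm_num) le_rfl (by omega), fun i hi => t1_braid (by omega),
      fun i j hij hj => tq_comm 1 hij (by omega)⟩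
  obtain ⟨φ, hφ⟩ := hc.exists_hom
  obtain ⟨π, hπ⟩ := perm_conj n r l hr h
  have h2 : dl (adj n) n ^ l = π * dlp (adj n) (fun i => (i+1) % r ≠ 0) n * π⁻¹ := by
    rw [hπ, mul_inv_cancel_right]
  have h3 := congrArg φ h2
  rw [map_pow, map_mul, map_mul, map_dl φ _ _ n hφ, map_dlp φ _ _ _ n hφ] at h3
  have e : Pq d m 1 = dl (tq 1) n := by rw [Pq, hN]; rfl
  rw [e, h3, LinearMap.trace_mul_comm, ← mul_assoc, ← map_mul, inv_mul_cancel, map_one, one_mul]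
end Wd

-- Part S2
namespace Wd
variable {d m : ℕ}

/-- weight of a word -/
noncomputable def wwt (p : ℕ → Prop) [DecidablePred p] (w : ℕ → ℕ) (k : ℕ) : ℝ :=
  ∏ i ∈ Finset.range k, if p i then ((con w (i+1) : ℝ) - con w i)⁻¹ else 1

theorem dlp_diag (p : ℕ → Prop) [DecidablePred p] (k : ℕ) (hk : k < d * m) (f : Y d m → ℝ) (w : Y d m)
    (hf : ∀ w'' : Y d m, w'' ≠ w → (∀ t, k < t → w''.1 t = w.1 t) → f w'' = 0) :
    (dlp (tq 1) p k : Module.End ℝ (Y d m → ℝ)) f w = wwt p w.1 k * f w := by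
  induction k generalizing f with
  | zero => simp [dlp, wwt]
  | succ k ih =>
    rw [dlp, Module.End.mul_apply, wwt, Finset.prod_range_succ, ← wwt]
    by_cases hp : p k
    · rw [if_pos hp, if_pos hp, ih (by omega)]
      · rw [tq, op_apply, uq_at_one]
        have : bq 1 (con w.1 (k+1) - con w.1 k) * f (sw k w) = 0 := by
          by_contra hne
          obtain ⟨hb, hfn⟩ := ne_zero_and_ne_zero_of_mul hne
          obtain ⟨h1, h2, h3⟩ := (off_bq 1).move hk w hb
          refine hfn (hf _ ?_ ?_)
          · intro he; rw [he] at h2; exact w.2.con_ne hk h2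
          · intro t ht; rw [h1, swp_of_ne _ _ _ (by omega) (by omega)]
        rw [this, add_zero, mul_assoc]; push_cast; ring
      · intro w'' hw ht
        have h0 : f w'' = 0 := hf w'' hw (fun t h => ht t (by omega))
        rw [tq, op_apply, h0, mul_zero, zero_add]
        by_contra hne
        obtain ⟨hb, hfn⟩ := ne_zero_and_ne_zero_of_mul hne
        obtain ⟨h1, h2, h3⟩ := (off_bq 1).move hk w'' hb
        refine hfn (hf _ ?_ ?_)
        · intro he
          rw [he] at h1
          have e1 : w.1 (k+1) = w''.1 k := by rw [h1, swp_at']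
          have e2 := ht (k+1) (by omega)
          have e3 := swp_eq_self k w''.1 (by rw [e2, e1])
          apply hw; apply Y.ext; rw [h1, e3]
        · intro t h; rw [h1, swp_of_ne _ _ _ (by omega) (by omega)]; exact ht t (by omega)
    · rw [if_neg hp, if_neg hp, mul_one, Module.End.one_apply, ih (by omega)]
      intro w'' hw ht; exact hf w'' hw (fun t h => ht t (by omega))

theorem tr_dlp (p : ℕ → Prop) [DecidablePred p] (k : ℕ) (hk : k < d * m) :
    LinearMap.trace ℝ _ (dlp (tq 1) p k : Module.End ℝ (Y d m → ℝ)) = ∑ w : Y d m, wwt p w.1 k := by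
  rw [tr_eq]
  refine Finset.sum_congr rfl fun w _ => ?_
  rw [dlp_diag p k hk]
  · simp
  · intro w'' hw _; simp [hw]
end Wd

-- Part MN2
/-! ### The word sum -/
namespace Wd
variable {d m : ℕ}

/-- the initial state -/
def st0 (d : ℕ) (i : Fin d) : ℤ := (d:ℤ) - 1 - i

open Classical in
/-- partial words of length `k` with final state `s` -/
noncomputable def WS (d : ℕ) : ℕ → (Fin d → ℤ) → Finset (ℕ → ℕ)
  | 0, s => if s = st0 d then {fun _ => d} else ∅
  | k+1, s => Finset.univ.biUnion fun i : Fin d =>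
      if StrictAnti (s - Pi.single i 1) then
        (WS d k (s - Pi.single i 1)).image (fun w => Function.update w k i) else ∅

theorem cnt_update (w : ℕ → ℕ) (j k a k' : ℕ) (h : k' ≤ k) :
    cnt (Function.update w k a) j k' = cnt w j k' :=
  cnt_congr _ _ fun t ht => by rw [Function.update_of_ne (by omega)]

theorem mem_WS (k : ℕ) (s : Fin d → ℤ) (hs : StrictAnti s) (w : ℕ → ℕ) :
    w ∈ WS d k s ↔ (∀ t < k, w t < d) ∧ (∀ t, k ≤ t → w t = d) ∧
      (∀ k' ≤ k, ∀ i i', i < i' → i' < d → cnt w i' k' ≤ cnt w i k') ∧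
      (∀ i : Fin d, (cnt w i k : ℤ) = s i - st0 d i) := by
  classical
  induction k generalizing s w with
  | zero =>
    rw [WS]
    constructor
    · intro h
      split_ifs at h with h1
      · rw [Finset.mem_singleton] at h
        subst h
        refine ⟨by simp, by simp, ?_, by simp [cnt_zero, h1]⟩
        intro k' hk' i i' _ _
        simp [Nat.le_zero.1 hk', cnt_zero]
      · simp at h
    · rintro ⟨_, h2, _, h4⟩
      rw [if_pos]
      · rw [Finset.mem_singleton]; ext t; exact h2 t (by omega)
      · ext i; have := h4 i; rw [cnt_zero] at this; simp at this; omega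
  | succ k ih =>
    rw [WS, Finset.mem_biUnion]
    constructor
    · rintro ⟨i, -, h⟩
      split_ifs at h with h1
      · obtain ⟨w', hw', rfl⟩ := Finset.mem_image.1 h
        obtain ⟨a1, a2, a3, a4⟩ := (ih _ h1 _).1 hw'
        have hc : ∀ j : Fin d, (cnt (Function.update w' k ↑i) ↑j (k + 1) : ℤ) = s j - st0 d j := by
          intro j
          rw [cnt_succ, cnt_update _ _ _ _ _ le_rfl, Function.update_self, Nat.cast_add, a4]
          by_cases hij : i = j
          · subst hij; simp; ring
          · rw [if_neg (fun h => hij (Fin.ext h))]; simp [Ne.symm hij]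
        refine ⟨?_, ?_, ?_, hc⟩
        · intro t ht
          by_cases htk : t = k
          · subst htk; simp
          · rw [Function.update_of_ne htk]; exact a1 t (by omega)
        · intro t ht; rw [Function.update_of_ne (by omega)]; exact a2 t (by omega)
        · intro k' hk' j j' hj hj'
          rcases Nat.lt_or_ge k k' with h2 | h2
          · obtain rfl : k' = k + 1 := by omega
            have e1 := hc ⟨j, by omega⟩
            have e2 := hc ⟨j', hj'⟩
            have e3 : s ⟨j', hj'⟩ < s ⟨j, by omega⟩ := hs (by simpa using hj)
            have e4 : (cnt (Function.update w' k ↑i) j' (k + 1) : ℤ) ≤ cnt (Function.update w' k ↑i) j (k+1) := by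
              have hS : ∀ (a b : Fin d), a < b → s b + (b:ℤ) ≤ s a + a := by
                intro a b hab
                have : ∀ (c : ℕ) (hc : a.1 + c < d), s ⟨a.1 + c, hc⟩ + c ≤ s a := by
                  intro c
                  induction c with
                  | zero => intro hc; simp
                  | succ c ihc =>
                    intro hc
                    have f1 := ihc (by omega)
                    have f2 : s ⟨a.1 + (c+1), hc⟩ < s ⟨a.1 + c, by omega⟩ := hs (by simp)
                    push_cast; omega
                have hab' : a.1 < b.1 := hab
                have f3 := this (b.1 - a.1) (by omega)
                have f4 : (⟨a.1 + (b.1 - a.1), by omega⟩ : Fin d) = b := Fin.ext (by simp; omega)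
                rw [f4] at f3
                push_cast [Nat.cast_sub hab'.le] at f3
                omega
              have := hS ⟨j, by omega⟩ ⟨j', hj'⟩ (by simpa using hj)
              simp only at e1 e2 this
              rw [e1, e2]; simp only [st0]; omega
            exact_mod_cast e4
          · rw [cnt_update _ _ _ _ _ h2, cnt_update _ _ _ _ _ h2]; exact a3 k' h2 j j' hj hj'
      · simp at h
    · rintro ⟨a1, a2, a3, a4⟩
      have hwk := a1 k (by omega)
      refine ⟨⟨w k, hwk⟩, Finset.mem_univ _, ?_⟩
      have hc : ∀ i : Fin d, (cnt (Function.update w k d) i k : ℤ) = (s - Pi.single ⟨w k, hwk⟩ 1 : Fin d → ℤ) i - st0 d i := by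
        intro i
        have := a4 i
        rw [cnt_succ] at this
        rw [cnt_update _ _ _ _ _ le_rfl]
        by_cases hi : (i : ℕ) = w k
        · have hi' : i = ⟨w k, hwk⟩ := Fin.ext hi
          rw [if_pos hi.symm] at this
          rw [hi'] at this ⊢
          simp only [Pi.sub_apply, Pi.single_eq_same]
          push_cast at this; omega
        · have hi' : i ≠ ⟨w k, hwk⟩ := fun h => hi (congrArg Fin.val h)
          rw [if_neg (Ne.symm hi)] at this
          simp only [Pi.sub_apply, Pi.single_eq_of_ne hi']
          push_cast at this; omega
      have hSA : StrictAnti (s - Pi.single ⟨w k, hwk⟩ 1) := by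
        intro i j hij
        have e1 := hc i
        have e2 := hc j
        rw [cnt_update _ _ _ _ _ le_rfl] at e1 e2
        have e3 := a3 k (by omega) i j hij j.2
        have : (i:ℕ) < j := hij
        simp only [st0] at e1 e2; omega
      rw [if_pos hSA, Finset.mem_image]
      refine ⟨Function.update w k d, (ih _ hSA _).2 ⟨?_, ?_, ?_, hc⟩, by simp⟩
      · intro t ht; rw [Function.update_of_ne (by omega)]; exact a1 t (by omega)
      · intro t ht
        by_cases htk : t = k
        · subst htk; simp
        · rw [Function.update_of_ne htk]; exact a2 t (by omega)
      · intro k' hk' j j' hj hj'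
        rw [cnt_update _ _ _ _ _ hk', cnt_update _ _ _ _ _ hk']; exact a3 k' (by omega) j j' hj hj'

/-- weight with the next shifted content `y` -/
noncomputable def gw (d : ℕ) (p : ℕ → Prop) [DecidablePred p] (w : ℕ → ℕ) (y : ℝ) : ℕ → ℝ
  | 0 => 1
  | k+1 => (if p k then (y - (con w k + ((d:ℝ) - 1)))⁻¹ else 1) * gw d p w (con w k + ((d:ℝ) - 1)) k

theorem gw_congr (p : ℕ → Prop) [DecidablePred p] (w w' : ℕ → ℕ) (y : ℝ) (k : ℕ)
    (h : ∀ t < k, w t = w' t) : gw d p w y k = gw d p w' y k := by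
  induction k generalizing y with
  | zero => rfl
  | succ k ih =>
    have : con w k = con w' k := by
      rw [con, con, h k (by omega), cnt_congr _ _ (fun t ht => h t (by omega))]
    rw [gw, gw, ih _ (fun t ht => h t (by omega)), this]

theorem gw_eq (p : ℕ → Prop) [DecidablePred p] (w : ℕ → ℕ) (y : ℝ) (k : ℕ) :
    gw d p w y (k+1) = (if p k then (y - (con w k + ((d:ℝ) - 1)))⁻¹ else 1) * wwt p w k := by
  induction k generalizing y with
  | zero => simp [gw, wwt]
  | succ k ih =>
    have e : wwt p w (k+1) = wwt p w k * if p k then ((con w (k+1) : ℝ) - con w k)⁻¹ else 1 := by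
      rw [wwt, Finset.prod_range_succ, ← wwt]
    rw [gw, ih, e, mul_comm (wwt p w k), add_sub_add_right_eq_sub]

noncomputable def FS (d : ℕ) (p : ℕ → Prop) [DecidablePred p] (k : ℕ) (s : Fin d → ℤ) (y : ℝ) : ℝ :=
  ∑ w ∈ WS d k s, gw d p w y k

open Classical in
theorem FS_succ (p : ℕ → Prop) [DecidablePred p] (k : ℕ) (s : Fin d → ℤ) (y : ℝ) :
    FS d p (k+1) s y = ∑ i : Fin d, if StrictAnti (s - Pi.single i 1) then
      (if p k then (y - ((s i : ℝ) - 1))⁻¹ else 1) * FS d p k (s - Pi.single i 1) ((s i:ℝ) - 1) else 0 := by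
  rw [FS, WS, Finset.sum_biUnion]
  · refine Finset.sum_congr rfl fun i _ => ?_
    by_cases h1 : StrictAnti (s - Pi.single i 1)
    · rw [if_pos h1, if_pos h1]
      rw [Finset.sum_image]
      · rw [FS, Finset.mul_sum]
        refine Finset.sum_congr rfl fun w hw => ?_
        have hcon : (con (Function.update w k ↑i) k : ℝ) + ((d:ℝ) - 1) = (s i : ℝ) - 1 := by
          have h3 := ((mem_WS k _ h1 w).1 hw).2.2.2 i
          have : con (Function.update w k ↑i) k + ((d:ℤ) - 1) = s i - 1 := by
            rw [con, Function.update_self, cnt_update _ _ _ _ _ le_rfl, h3]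
            simp [st0]; ring
          exact_mod_cast this
        rw [gw, hcon]
        congr 1
        exact gw_congr _ _ _ _ _ fun t ht => by rw [Function.update_of_ne (by omega)]
      · intro w hw w' hw' he
        have a := ((mem_WS k _ h1 w).1 hw).2.1 k le_rfl
        have b := ((mem_WS k _ h1 w').1 hw').2.1 k le_rfl
        ext t
        by_cases ht : t = k
        · rw [ht, a, b]
        · have := congrFun he t
          simpa [Function.update_of_ne ht] using this
    · rw [if_neg h1, if_neg h1, Finset.sum_empty]
  · intro i _ j _ hij
    rw [Function.onFun, Finset.disjoint_left]
    intro w h1 h2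
    apply hij
    split_ifs at h1 with h3
    · split_ifs at h2 with h4
      · obtain ⟨a, _, ha⟩ := Finset.mem_image.1 h1
        obtain ⟨b, _, hb⟩ := Finset.mem_image.1 h2
        have := congrFun (ha.trans hb.symm) k
        exact Fin.ext (by simpa using this)
      · simp at h2
    · simp at h1

/-- Kronecker delta -/
noncomputable def kd (a b : ℤ) : ℝ := if a = b then 1 else 0

/-- iterated ribbon sums -/
noncomputable def ZZ (d r : ℕ) : ℕ → (Fin d → ℤ) → ℝ
  | 0, s => ∑ σ : Equiv.Perm (Fin d), (Equiv.Perm.sign σ : ℝ) * ∏ i, kd (s i) (st0 d (σ i))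
  | m+1, s => ∑ i, ZZ d r m (s - Pi.single i (r:ℤ))

theorem ZZ_alt (r m : ℕ) : Alt (ZZ d r m) := by
  induction m with
  | zero =>
    intro s i j hij
    simp only [ZZ]
    rw [← Finset.sum_neg_distrib, ← Equiv.sum_comp (Equiv.mulRight (Equiv.swap i j))]
    refine Finset.sum_congr rfl fun σ _ => ?_
    simp only [Equiv.coe_mulRight, Equiv.Perm.sign_mul, Equiv.Perm.sign_swap hij, Function.comp_apply,
      Equiv.Perm.mul_apply]
    rw [Equiv.prod_comp (Equiv.swap i j) (fun x => kd (s x) (st0 d (σ x)))]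
    simp
  | succ m ih =>
    intro s i j hij
    simp only [ZZ]
    rw [← Finset.sum_neg_distrib, ← Equiv.sum_comp (Equiv.swap i j)]
    refine Finset.sum_congr rfl fun a _ => ?_
    rw [← ih _ i j hij]
    congr 1
    ext x
    simp only [Pi.sub_apply, Function.comp_apply, Pi.single_apply]
    congr 2
    rw [eq_iff_iff, Equiv.apply_eq_iff_eq_symm_apply, Equiv.symm_swap]

theorem ZZ_zero (r : ℕ) (s : Fin d → ℤ) (hs : StrictAnti s) :
    ZZ d r 0 s = if s = st0 d then 1 else 0 := by
  classical
  simp only [ZZ]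
  rw [Finset.sum_eq_single 1]
  · simp only [kd, Equiv.Perm.sign_one, Units.val_one, Int.cast_one, one_mul, Equiv.Perm.one_apply]
    split_ifs with h
    · simp [h]
    · obtain ⟨i, hi⟩ := Function.ne_iff.1 h
      exact Finset.prod_eq_zero (Finset.mem_univ i) (if_neg hi)
  · intro σ _ hσ
    by_contra hne
    apply hσ
    have h1 : ∀ i, s i = st0 d (σ i) := by
      intro i
      by_contra hc
      apply hne
      rw [Finset.prod_eq_zero (Finset.mem_univ i) (by rw [kd, if_neg hc]), mul_zero]
    have hm : StrictMono σ := by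
      intro i j hij
      have := hs hij
      rw [h1, h1] at this
      simp only [st0] at this
      rw [Fin.lt_def]; omega
    have := Subsingleton.elim (hm.orderIsoOfSurjective σ σ.surjective) (OrderIso.refl _)
    ext i
    exact congrArg Fin.val (DFunLike.congr_fun this i)
  · simp

theorem not_anti_eq (s : Fin d → ℤ) (hs : StrictAnti s) (i : Fin d)
    (h : ¬ StrictAnti (s - Pi.single i 1)) :
    ∃ a b, a ≠ b ∧ (s - Pi.single i 1 : Fin d → ℤ) a = (s - Pi.single i 1 : Fin d → ℤ) b := by
  unfold StrictAnti at h
  push Not at h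
  obtain ⟨a, b, hab, hle⟩ := h
  refine ⟨a, b, hab.ne, le_antisymm hle ?_⟩
  have h1 := hs hab
  simp only [Pi.sub_apply, Pi.single_apply] at hle ⊢
  by_cases hb : b = i
  · rw [if_neg (by rintro rfl; exact hab.ne hb.symm), if_pos hb] at hle; omega
  · rw [if_neg hb] at hle ⊢; split_ifs at hle ⊢ <;> omega

theorem FS_eq (r : ℕ) (hr : 0 < r) (m j : ℕ) (hj : j < r) (s : Fin d → ℤ) (hs : StrictAnti s) (y : ℝ)
    (hy : ∀ i, y ≠ (s i : ℝ) - 1) :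
    FS d (fun i => (i+1) % r ≠ 0) (m * r + j) s y = Cfun (ZZ d r m) j s y := by
  classical
  have key : ∀ m j, j < r → (∀ (s : Fin d → ℤ) (hs : StrictAnti s) (y : ℝ) (hy : ∀ i, y ≠ (s i : ℝ) - 1),
      FS d (fun i => (i+1) % r ≠ 0) (m * r + j) s y = Cfun (ZZ d r m) j s y) →
      ∀ (s : Fin d → ℤ) (hs : StrictAnti s) (y : ℝ), 
      FS d (fun i => (i+1) % r ≠ 0) (m * r + j + 1) s y = ∑ i,
        (if j + 1 ≠ r then (y - ((s i : ℝ) - 1))⁻¹ else 1) * Cfun (ZZ d r m) j (s - Pi.single i 1) ((s i : ℝ) - 1) := by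
    intro m j hj ih s hs y
    rw [FS_succ]
    refine Finset.sum_congr rfl fun i _ => ?_
    have hmod : ((m * r + j + 1) % r ≠ 0) ↔ j + 1 ≠ r := by
      rw [add_assoc, Nat.mul_add_mod_self_right]
      constructor
      · rintro h rfl; simp at h
      · intro h; rw [Nat.mod_eq_of_lt (by omega)]; omega
    simp only [hmod]
    split_ifs with h1 h2
    · rw [ih _ h1]
      intro i' he
      have : s i - 1 = (s - Pi.single i 1 : Fin d → ℤ) i' - 1 := by exact_mod_cast he
      by_cases hi : i' = i
      · subst hi; simp at this; omega
      · rw [Pi.sub_apply, Pi.single_eq_of_ne hi] at this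
        exact hi (hs.injective (by omega))
    · rw [ih _ h1]
      intro i' he
      have : s i - 1 = (s - Pi.single i 1 : Fin d → ℤ) i' - 1 := by exact_mod_cast he
      by_cases hi : i' = i
      · subst hi; simp at this; omega
      · rw [Pi.sub_apply, Pi.single_eq_of_ne hi] at this
        exact hi (hs.injective (by omega))
    all_goals
      obtain ⟨a, b, hab, he⟩ := not_anti_eq s hs i h1
      have := (Cfun_alt (ZZ_alt (d := d) r m) j ((s i : ℝ) - 1)).eq_zero _ a b hab he
      rw [this, mul_zero]
  have step0 : ∀ m, (∀ (s : Fin d → ℤ) (hs : StrictAnti s) (y : ℝ) (hy : ∀ i, y ≠ (s i : ℝ) - 1),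
      FS d (fun i => (i+1) % r ≠ 0) (m * r) s y = Cfun (ZZ d r m) 0 s y) → ∀ j, j < r →
      (∀ (s : Fin d → ℤ) (hs : StrictAnti s) (y : ℝ) (hy : ∀ i, y ≠ (s i : ℝ) - 1),
      FS d (fun i => (i+1) % r ≠ 0) (m * r + j) s y = Cfun (ZZ d r m) j s y) := by
    intro m h0 j
    induction j with
    | zero => intro _; exact h0
    | succ j ih =>
      intro hj s hs y hy
      rw [← add_assoc, key m j (by omega) (ih (by omega)) s hs y, Cfun_succ _ _ _ hs.injective _ hy]
      simp only [if_pos (show j + 1 ≠ r by omega)]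
  have all0 : ∀ m, (∀ (s : Fin d → ℤ) (hs : StrictAnti s) (y : ℝ) (hy : ∀ i, y ≠ (s i : ℝ) - 1),
      FS d (fun i => (i+1) % r ≠ 0) (m * r) s y = Cfun (ZZ d r m) 0 s y) := by
    intro m
    induction m with
    | zero =>
      intro s hs y _
      rw [Cfun_zero, ZZ_zero r s hs, zero_mul, FS, WS]
      split_ifs <;> simp [gw]
    | succ m ih =>
      intro s hs y _
      have h1 := key m (r-1) (by omega) (step0 m ih (r-1) (by omega)) s hs y
      rw [show m * r + (r-1) + 1 = (m+1) * r by rw [add_mul]; omega] at h1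
      rw [h1, Cfun_zero, ZZ]
      simp only [show ¬ (r - 1 + 1 ≠ r) by omega, if_false, one_mul]
      rw [Cfun_end _ _ _ hs.injective]
      refine Finset.sum_congr rfl fun i _ => ?_
      congr 3
      push_cast [Nat.cast_sub (show 1 ≤ r from hr)]; ring
  exact step0 m (all0 m) j hj s hs y hy

/-- the final state -/
def stf (d m : ℕ) (i : Fin d) : ℤ := m + st0 d i

theorem stf_anti : StrictAnti (stf d m) := by
  intro i j h; simp only [stf, st0]; have : (i:ℕ) < j := h; omega

theorem mem_WS_fin (w : ℕ → ℕ) : w ∈ WS d (d * m) (stf d m) ↔ Valid d m w := by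
  rw [mem_WS _ _ stf_anti]
  constructor
  · rintro ⟨a1, a2, a3, a4⟩
    refine ⟨a1, a2, ?_, ?_⟩
    · intro i k hi
      have hc : ∀ j < d, cnt w j k = cnt w j (min k (d*m)) := by
        intro j hj
        rcases Nat.le_total k (d*m) with h | h
        · rw [min_eq_left h]
        · rw [min_eq_right h]
          induction k, h using Nat.le_induction with
          | base => rfl
          | succ k hk ih => rw [cnt_succ, ih, a2 k hk, if_neg (by omega)]; rfl
      rw [hc _ hi, hc _ (by omega)]
      exact a3 _ (min_le_right _ _) i (i+1) (by omega) hi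
    · intro i hi
      have := a4 ⟨i, hi⟩
      simp [stf] at this; omega
  · intro h
    refine ⟨h.lt, h.eq, fun k' _ i i' hi hi' => h.anti hi.le hi' _, ?_⟩
    intro i
    rw [h.fin i i.2]; simp [stf]

theorem wsum (r l n : ℕ) (hr : 0 < r) (h : r * l = n + 1) (hN : d * m = n + 1) :
    ∑ w : Y d m, wwt (fun i => (i+1) % r ≠ 0) w.1 n = ZZ d r l (stf d m) := by
  have h1 : ∑ w : Y d m, wwt (fun i => (i+1) % r ≠ 0) w.1 n =
      ∑ w ∈ WS d (d * m) (stf d m), wwt (fun i => (i+1) % r ≠ 0) w n := by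
    refine Finset.sum_bij (fun w _ => w.1) ?_ ?_ ?_ ?_
    · intro w _; exact (mem_WS_fin w.1).2 w.2
    · intro a _ b _ hab; exact Y.ext hab
    · intro w hw; exact ⟨⟨w, (mem_WS_fin w).1 hw⟩, Finset.mem_univ _, rfl⟩
    · intro _ _; rfl
  rw [h1]
  have hy : ∀ i, (m + d : ℝ) ≠ (stf d m i : ℝ) - 1 := by
    intro i he
    have : (m + d : ℤ) = stf d m i - 1 := by exact_mod_cast he
    simp only [stf, st0] at this; omega
  have h2 := FS_eq r hr l 0 hr (stf d m) stf_anti (m + d) hy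
  rw [Cfun_zero] at h2
  rw [← h2, FS, add_zero, mul_comm l r, h, hN]
  refine Finset.sum_congr rfl fun w _ => ?_
  rw [gw_eq, if_neg, one_mul]
  rw [← h]; simp
end Wd

-- Part MN3
namespace Wd
variable {d m : ℕ}

/-- `1/(a/r)!` if `a` is a nonnegative multiple of `r`, and `0` otherwise -/
noncomputable def ivr (r : ℕ) (a : ℤ) : ℝ :=
  if 0 ≤ a ∧ (r:ℤ) ∣ a then ((a.toNat / r).factorial : ℝ)⁻¹ else 0

theorem ivr_sub (r : ℕ) (hr : 0 < r) (a : ℤ) : ivr r (a - r) = (a : ℝ) / r * ivr r a := by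
  have hr' : (0:ℝ) < r := by exact_mod_cast hr
  unfold ivr
  by_cases h1 : (r:ℤ) ∣ a
  · obtain ⟨k, rfl⟩ := h1
    have e1 : (r:ℤ) ∣ r * k - r := ⟨k - 1, by ring⟩
    simp only [e1, dvd_mul_right, and_true]
    rcases lt_trichotomy k 0 with hk | hk | hk
    · rw [if_neg (by nlinarith), if_neg (by nlinarith), mul_zero]
    · subst hk; rw [if_neg (by simp; omega)]; simp
    · obtain ⟨j, rfl⟩ : ∃ j : ℕ, k = j + 1 := ⟨(k-1).toNat, by omega⟩
      have e2 : (r:ℤ) * (j+1) - r = ((r * j : ℕ) : ℤ) := by push_cast; ring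
      have e3 : (r:ℤ) * (j+1) = ((r * (j+1) : ℕ) : ℤ) := by push_cast; ring
      rw [e2, e3, if_pos (by positivity), if_pos (by positivity), Int.toNat_natCast, Int.toNat_natCast,
        Nat.mul_div_cancel_left _ hr, Nat.mul_div_cancel_left _ hr, Nat.factorial_succ]
      have : ((j.factorial : ℕ) : ℝ) ≠ 0 := by exact_mod_cast j.factorial_ne_zero
      push_cast
      field_simp
  · have : ¬ (r:ℤ) ∣ a - r := by
      intro h; apply h1; have := dvd_add h (dvd_refl (r:ℤ)); simpa using this
    rw [if_neg (fun h => this h.2), if_neg (fun h => h1 h.2), mul_zero]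

theorem ZZ_eq (r : ℕ) (hr : 0 < r) (k : ℕ) (s : Fin d → ℤ) (hs : ∑ i, s i - ∑ i, st0 d i = r * k) :
    ZZ d r k s = k.factorial * ∑ σ : Equiv.Perm (Fin d), (Equiv.Perm.sign σ : ℝ) *
      ∏ i, ivr r (s i - st0 d (σ i)) := by
  have hr' : (r:ℝ) ≠ 0 := by exact_mod_cast hr.ne'
  induction k generalizing s with
  | zero =>
    rw [ZZ, Nat.factorial_zero, Nat.cast_one, one_mul]
    refine Finset.sum_congr rfl fun σ _ => ?_
    congr 1
    have hsum : ∑ i, (s i - st0 d (σ i)) = 0 := by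
      rw [Finset.sum_sub_distrib, Equiv.sum_comp σ (st0 d), hs]; simp
    by_cases h : ∀ i, 0 ≤ s i - st0 d (σ i)
    · have h2 := (Finset.sum_eq_zero_iff_of_nonneg (fun i _ => h i)).1 hsum
      refine Finset.prod_congr rfl fun i _ => ?_
      have h3 := h2 i (Finset.mem_univ i)
      rw [h3, kd, if_pos (by omega)]; simp [ivr]
    · push Not at h
      obtain ⟨i, hi⟩ := h
      rw [Finset.prod_eq_zero (Finset.mem_univ i), Finset.prod_eq_zero (Finset.mem_univ i)]
      · rw [ivr, if_neg (by omega)]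
      · rw [kd, if_neg (by omega)]
  | succ k ih =>
    rw [ZZ]
    have h1 : ∀ i, ZZ d r k (s - Pi.single i (r:ℤ)) = k.factorial * ∑ σ : Equiv.Perm (Fin d), (Equiv.Perm.sign σ : ℝ) *
      (((s i - st0 d (σ i) : ℤ) : ℝ) / r * ∏ j, ivr r (s j - st0 d (σ j))) := by
      intro i
      rw [ih]
      · congr 1
        refine Finset.sum_congr rfl fun σ _ => ?_
        congr 1
        rw [← Finset.mul_prod_erase _ _ (Finset.mem_univ i), ← Finset.mul_prod_erase _ _ (Finset.mem_univ i),
          ← mul_assoc, ← ivr_sub r hr]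
        congr 1
        · congr 1; simp; ring
        · refine Finset.prod_congr rfl fun j hj => ?_
          rw [Pi.sub_apply, Pi.single_eq_of_ne (Finset.ne_of_mem_erase hj), sub_zero]
      · simp only [Pi.sub_apply, Finset.sum_sub_distrib, Finset.sum_pi_single', Finset.mem_univ, if_true]
        push_cast at hs; linarith
    simp only [h1]
    rw [← Finset.mul_sum, Finset.sum_comm, Nat.factorial_succ, Nat.cast_mul, mul_comm ((k+1 : ℕ) : ℝ), mul_assoc]
    congr 1
    rw [Finset.mul_sum]
    refine Finset.sum_congr rfl fun σ _ => ?_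
    rw [← Finset.mul_sum, ← Finset.sum_mul, ← Finset.sum_div, ← Int.cast_sum, Finset.sum_sub_distrib,
      Equiv.sum_comp σ (st0 d), hs]
    push_cast
    field_simp

theorem tr_final (r l : ℕ) (hr : 0 < r) (hN : 0 < d * m) (h : r * l = d * m) :
    LinearMap.trace ℝ _ (Pq d m 0 ^ l) =
      l.factorial * ∑ σ : Equiv.Perm (Fin d), (Equiv.Perm.sign σ : ℝ) *
      ∏ i, ivr r ((m:ℤ) + σ i - i) := by
  obtain ⟨n, hn⟩ : ∃ n, d * m = n + 1 := ⟨d * m - 1, by omega⟩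
  rw [tr_const hN, tr_sym r l n hr (h.trans hn) hn, tr_dlp _ n (by omega), wsum r l n hr (h.trans hn) hn,
    ZZ_eq r hr]
  · congr 1
    refine Finset.sum_congr rfl fun σ _ => ?_
    congr 1
    refine Finset.prod_congr rfl fun i _ => ?_
    congr 1
    simp only [stf, st0]; ring
  · simp only [stf, Finset.sum_add_distrib]
    simp; exact_mod_cast h.symm
end Wd

-- Part P1
/-! ### Words and tableaux -/
namespace Wd
variable {d m : ℕ} {w : ℕ → ℕ} {E : ℕ → ℕ → ℕ}

/-- the box of the letter at position `t` -/
def bx (w : ℕ → ℕ) (t : ℕ) : ℕ × ℕ := (w t, cnt w (w t) t)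

/-- `E` is the tableau of the word `w` -/
def Rel (d m : ℕ) (w : ℕ → ℕ) (E : ℕ → ℕ → ℕ) : Prop :=
  (∀ i j, d ≤ i ∨ m ≤ j → E i j = 0) ∧ ∀ t < d * m, E (bx w t).1 (bx w t).2 = t + 1

theorem bx_inj (w : ℕ → ℕ) {t t' : ℕ} (h : bx w t = bx w t') : t = t' := by
  simp only [bx, Prod.mk.injEq] at h
  obtain ⟨h1, h2⟩ := h
  rw [← h1] at h2
  rcases Nat.lt_trichotomy t t' with h3 | h3 | h3
  · have := cnt_mono w (w t) (show t + 1 ≤ t' from h3)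
    rw [cnt_succ, if_pos rfl] at this; omega
  · exact h3
  · have := cnt_mono w (w t) (show t' + 1 ≤ t from h3)
    rw [cnt_succ, if_pos h1.symm] at this; omega

theorem Valid.bx_lt (h : Valid d m w) {t : ℕ} (ht : t < d * m) : (bx w t).1 < d ∧ (bx w t).2 < m := by
  refine ⟨h.lt t ht, ?_⟩
  have h1 := cnt_mono w (w t) (show t + 1 ≤ d * m from ht)
  rw [cnt_succ, if_pos rfl, h.fin _ (h.lt t ht)] at h1
  simp only [bx]; omega

theorem Valid.bx_surj (h : Valid d m w) {i j : ℕ} (hi : i < d) (hj : j < m) :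
    ∃ t < d * m, bx w t = (i, j) := by
  have hex : ∃ k, j < cnt w i k := ⟨d * m, by rw [h.fin i hi]; exact hj⟩
  classical
  have hk := Nat.find_spec hex
  have hle : Nat.find hex ≤ d * m := Nat.find_min' hex (by rw [h.fin i hi]; exact hj)
  obtain ⟨t, ht⟩ : ∃ t, Nat.find hex = t + 1 := by
    refine Nat.exists_eq_succ_of_ne_zero ?_
    intro h0; rw [h0, cnt_zero] at hk; omega
  have hmin := Nat.find_min hex (show t < Nat.find hex by omega)
  rw [ht, cnt_succ] at hk
  have hw : w t = i := by
    by_contra hc; rw [if_neg hc] at hk; omega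
  rw [if_pos hw] at hk
  refine ⟨t, by omega, ?_⟩
  simp only [bx, hw]; congr 1; omega

theorem Valid.rel_unique (h : Valid d m w) {F : ℕ → ℕ → ℕ} (hE : Rel d m w E) (hF : Rel d m w F) : E = F := by
  ext i j
  by_cases hij : i < d ∧ j < m
  · obtain ⟨t, ht, hb⟩ := h.bx_surj hij.1 hij.2
    have h1 := hE.2 t ht
    have h2 := hF.2 t ht
    rw [hb] at h1 h2; simp only at h1 h2; rw [h1, h2]
  · rw [hE.1 i j (by omega), hF.1 i j (by omega)]

open Classical in
theorem Valid.rel_exists (h : Valid d m w) : ∃ E, Rel d m w E := by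
  refine ⟨fun i j => if hij : i < d ∧ j < m then (h.bx_surj hij.1 hij.2).choose + 1 else 0, ?_, ?_⟩
  · intro i j hij; simp only; rw [dif_neg (by omega)]
  · intro t ht
    have hb := h.bx_lt ht
    simp only; rw [dif_pos hb]
    have := (h.bx_surj hb.1 hb.2).choose_spec.2
    rw [bx_inj w this]

theorem Valid.rel_eq (h : Valid d m w) (hE : Rel d m w E) {i j : ℕ} (hi : i < d) (hj : j < m) {t : ℕ}
    (ht : E i j = t + 1) : bx w t = (i, j) ∧ t < d * m := by
  obtain ⟨t', ht', hb⟩ := h.bx_surj hi hj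
  have := hE.2 t' ht'
  rw [hb] at this; simp only at this
  obtain rfl : t = t' := by omega
  exact ⟨hb, ht'⟩

/-- neighbours of a box carry larger entries -/
theorem Valid.rel_nbr (h : Valid d m w) (hE : Rel d m w E) {t : ℕ} (ht : t < d * m) :
    ((bx w t).1 + 1 < d → t + 1 < E ((bx w t).1 + 1) (bx w t).2) ∧
    ((bx w t).2 + 1 < m → t + 1 < E (bx w t).1 ((bx w t).2 + 1)) := by
  have hb := h.bx_lt ht
  constructor
  · intro h1
    obtain ⟨t', ht', hb'⟩ := h.bx_surj h1 hb.2
    have e := hE.2 t' ht'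
    rw [hb'] at e; simp only at e; rw [e]
    simp only [bx, Prod.mk.injEq] at hb' h1
    obtain ⟨a1, a2⟩ := hb'
    have b1 := h.bal (w t) (t'+1) h1
    rw [a1] at a2
    rw [cnt_succ, if_pos a1, cnt_succ, if_neg (by omega)] at b1
    by_contra hc
    have b2 := cnt_mono w (w t) (show t' ≤ t by omega)
    omega
  · intro h1
    obtain ⟨t', ht', hb'⟩ := h.bx_surj hb.1 h1
    have e := hE.2 t' ht'
    rw [hb'] at e; simp only at e; rw [e]
    simp only [bx, Prod.mk.injEq] at hb'
    obtain ⟨a1, a2⟩ := hb'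
    rw [a1] at a2
    by_contra hc
    have b2 := cnt_mono w (w t) (show t' ≤ t by omega)
    omega

theorem Valid.isSYT (h : Valid d m w) (hE : Rel d m w E) : IsSYT d m E := by
  refine ⟨hE.1, ?_, ?_, ?_, ?_⟩
  · intro i j hi hj
    obtain ⟨t, ht, hb⟩ := h.bx_surj hi hj
    have e := hE.2 t ht
    rw [hb] at e; simp only at e; omega
  · intro i j hi hj
    obtain ⟨t, ht, hb⟩ := h.bx_surj hi (show j < m by omega)
    have e := hE.2 t ht
    have := (h.rel_nbr hE ht).2
    rw [hb] at e this; simp only at e this; rw [e]; exact this hj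
  · intro i j hi hj
    obtain ⟨t, ht, hb⟩ := h.bx_surj (show i < d by omega) hj
    have e := hE.2 t ht
    have := (h.rel_nbr hE ht).1
    rw [hb] at e this; simp only at e this; rw [e]; exact this hi
  · intro k hk hk2
    have hb := h.bx_lt (show k - 1 < d * m by omega)
    exact ⟨_, _, hb.1, hb.2, by rw [hE.2 _ (by omega)]; omega⟩

theorem syt_inj (hE : IsSYT d m E) {i j i' j' : ℕ} (hi : i < d) (hj : j < m) (hi' : i' < d) (hj' : j' < m)
    (h : E i j = E i' j') : i = i' ∧ j = j' := by
  obtain ⟨_, h2, _, _, h5⟩ := hE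
  let f : Fin d × Fin m → Fin (d * m) := fun p => ⟨E p.1 p.2 - 1, by have := h2 p.1 p.2 p.1.2 p.2.2; omega⟩
  have hs : Function.Surjective f := by
    intro k
    obtain ⟨a, b, ha, hb, he⟩ := h5 (k+1) (by omega) (by have := k.2; omega)
    exact ⟨(⟨a, ha⟩, ⟨b, hb⟩), Fin.ext (by simp [f, he])⟩
  have hinj : Function.Injective f :=
    ((Fintype.bijective_iff_surjective_and_card f).2 ⟨hs, by simp⟩).1
  have := hinj (a₁ := (⟨i, hi⟩, ⟨j, hj⟩)) (a₂ := (⟨i', hi'⟩, ⟨j', hj'⟩)) (Fin.ext (by simp [f, h]))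
  simpa using this

open Classical in
theorem syt_word (hE : IsSYT d m E) : ∃ w, Valid d m w ∧ Rel d m w E := by
  obtain ⟨h1, h2, h3, h4, h5⟩ := id hE
  have hex : ∀ t, ∃ i, (t < d * m → ∃ j, i < d ∧ j < m ∧ E i j = t + 1) ∧ (d * m ≤ t → i = d) := by
    intro t
    by_cases ht : t < d * m
    · obtain ⟨i, j, a, b, c⟩ := h5 (t+1) (by omega) (by omega)
      exact ⟨i, fun _ => ⟨j, a, b, c⟩, fun h => by omega⟩
    · exact ⟨d, fun h => absurd h ht, fun _ => rfl⟩
  choose w hw1 hw2 using hex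
  have row : ∀ i j j', i < d → j' < m → j < j' → E i j < E i j' := by
    intro i j j' hi hj' hjj
    induction j', (show j + 1 ≤ j' from hjj) using Nat.le_induction with
    | base => exact h3 i j hi hj'
    | succ j' hle ih => exact (ih (by omega) (by omega)).trans (h3 i j' hi hj')
  have hc : ∀ i < d, ∀ k, cnt w i k = ((Finset.range m).filter (fun j => E i j ≤ k)).card := by
    intro i hi k
    induction k with
    | zero =>
      rw [cnt_zero, eq_comm, Finset.card_eq_zero, Finset.filter_eq_empty_iff]
      intro j hj
      have := h2 i j hi (Finset.mem_range.1 hj); omega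
    | succ k ih =>
      rw [cnt_succ, ih]
      by_cases hk : w k = i
      · rw [if_pos hk]
        by_cases hkN : k < d * m
        · obtain ⟨j, a, b, c⟩ := hw1 k hkN
          rw [hk] at c
          rw [← Finset.card_insert_of_notMem (a := j) (by simp [c])]
          congr 1
          ext j'
          simp only [Finset.mem_insert, Finset.mem_filter, Finset.mem_range]
          constructor
          · rintro (rfl | ⟨a1, a2⟩)
            · exact ⟨b, by omega⟩
            · exact ⟨a1, by omega⟩
          · rintro ⟨a1, a2⟩
            rcases Nat.lt_or_ge k (E i j') with h | h
            · left; exact (syt_inj hE hi a1 hi b (by omega)).2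
            · right; exact ⟨a1, h⟩
        · have := hw2 k (by omega); omega
      · rw [if_neg hk, add_zero]
        congr 1
        ext j'
        simp only [Finset.mem_filter, Finset.mem_range, and_congr_right_iff]
        intro hj'
        constructor
        · intro h; omega
        · intro h
          by_contra hc
          have hb := h2 i j' hi hj'
          obtain ⟨j, a, b, c⟩ := hw1 k (by omega)
          exact hk (syt_inj hE a b hi hj' (by omega)).1
  refine ⟨w, ⟨?_, hw2, ?_, ?_⟩, h1, ?_⟩
  · intro t ht; obtain ⟨j, a, b, c⟩ := hw1 t ht; exact a
  · intro i k hi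
    rw [hc _ hi, hc _ (by omega)]
    refine Finset.card_le_card ?_
    intro j hj
    simp only [Finset.mem_filter, Finset.mem_range] at hj ⊢
    have := h4 i j hi hj.1
    exact ⟨hj.1, by omega⟩
  · intro i hi
    rw [hc i hi, Finset.filter_true_of_mem, Finset.card_range]
    intro j hj; exact (h2 i j hi (Finset.mem_range.1 hj)).2
  · intro t ht
    obtain ⟨j, a, b, c⟩ := hw1 t ht
    have : cnt w (w t) t = j := by
      rw [hc _ a]
      have : (Finset.range m).filter (fun j' => E (w t) j' ≤ t) = Finset.range j := by
        ext j'
        simp only [Finset.mem_filter, Finset.mem_range]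
        constructor
        · rintro ⟨a1, a2⟩
          by_contra hc
          rcases Nat.eq_or_lt_of_le (not_lt.1 hc) with h | h
          · subst h; omega
          · have := row _ _ _ a a1 h; omega
        · intro h
          have := row _ _ _ a b h
          exact ⟨by omega, by omega⟩
      rw [this, Finset.card_range]
    simp only [bx, this, c]
end Wd

-- Part P2
/-! ### Bender–Knuth moves and the operator at `q = 0` -/
namespace Wd
variable {d m : ℕ}

theorem Valid.con_pred {w : ℕ → ℕ} (h : Valid d m w) {i : ℕ} (hi : i + 1 < d * m)
    (ha : con w (i+1) = con w i - 1) : w (i+1) = w i + 1 ∧ cnt w (w (i+1)) (i+1) = cnt w (w i) i := by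
  rcases h.con_cases hi with h1 | h1 | h1
  · omega
  · have h2 := h.anti h1.1.le (h.lt _ hi) i
    have h3 : cnt w (w (i+1)) (i+1) = cnt w (w (i+1)) i := by
      rw [cnt_succ, if_neg (by omega), add_zero]
    simp only [con] at ha
    omega
  · omega

theorem Valid.con_succ' {w : ℕ → ℕ} (h : Valid d m w) {i : ℕ} (hi : i + 1 < d * m)
    (ha : con w (i+1) = con w i + 1) : w (i+1) = w i ∧ cnt w (w (i+1)) (i+1) = cnt w (w i) i + 1 := by
  rcases h.con_cases hi with h1 | h1 | h1
  · refine ⟨h1.1.symm, ?_⟩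
    rw [← h1.1, cnt_succ, if_pos rfl]
  · omega
  · omega

/-- adjacency of contents -/
def adjP (i : ℕ) (w : Y d m) : Prop := con w.1 (i+1) = con w.1 i + 1 ∨ con w.1 (i+1) = con w.1 i - 1

open Classical in
/-- Bender–Knuth move -/
noncomputable def bk (i : ℕ) (w : Y d m) : Y d m := if adjP i w then w else sw i w

theorem bk_adj {i : ℕ} {w : Y d m} (h : adjP i w) : bk i w = w := by rw [bk, if_pos h]
theorem bk_nadj {i : ℕ} (hi : i + 1 < d * m) {w : Y d m} (h : ¬ adjP i w) : (bk i w).1 = swp i w.1 := by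
  rw [bk, if_neg h]
  exact sw_of_valid (w.2.swp hi (fun hh => h (Or.inr hh)))

/-- iterated moves -/
noncomputable def bks (w : Y d m) : ℕ → Y d m
  | 0 => w
  | k+1 => bk k (bks w k)

theorem tq_zero {i : ℕ} (hi : i + 1 < d * m) (f : Y d m → ℝ) (w : Y d m) :
    (-1 : ℝ) ^ (w.1 i) * tq 0 i f w = (-1) ^ ((bk i w).1 (i+1)) * f (bk i w) := by
  rw [tq, op_apply]
  by_cases h : adjP i w
  · rw [bk_adj h]
    rcases h with h | h
    · have h1 := w.2.con_succ' hi h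
      rw [h1.1, h, show con w.1 i + 1 - con w.1 i = 1 by ring, uq_one, bq_one]; ring
    · have h1 := w.2.con_pred hi h
      rw [h1.1, h, show con w.1 i - 1 - con w.1 i = -1 by ring, uq_neg, bq_neg, uq_one, bq_one]; ring
  · have hv := bk_nadj hi h
    have hne := w.2.con_ne hi
    have hb : bk i w = sw i w := by rw [bk, if_neg h]
    unfold adjP at h
    have hu : uq 0 (con w.1 (i+1) - con w.1 i) = 0 := uq_at_zero _ (by omega)
    rw [hu, bq, hu, hv, swp_at', hb]
    simp

theorem dl_zero (f : Y d m → ℝ) (w : Y d m) (hN : 0 < d * m) (n : ℕ) (hn : n < d * m) :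
    dl (tq 0) n f w = (-1 : ℝ) ^ ((bks w n).1 n) * f (bks w n) := by
  induction n generalizing f with
  | zero => simp [dl, bks, w.2.zero hN]
  | succ n ih =>
    rw [dl, Module.End.mul_apply, ih _ (by omega), tq_zero hn]; rfl

/-- promotion on words -/
noncomputable def Pw (w : Y d m) : Y d m := bks w (d * m - 1)

theorem Pq_zero (hN : 0 < d * m) (f : Y d m → ℝ) (w : Y d m) :
    Pq d m 0 f w = (-1 : ℝ) ^ (d - 1) * f (Pw w) := by
  rw [Pq, dl_zero f w hN _ (by omega), (bks w (d * m - 1)).2.last (by omega)]; rfl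

theorem Pq_zero_pow (hN : 0 < d * m) (l : ℕ) (f : Y d m → ℝ) (w : Y d m) :
    (Pq d m 0 ^ l) f w = ((-1 : ℝ) ^ (d - 1)) ^ l * f (Pw^[l] w) := by
  induction l generalizing w with
  | zero => simp
  | succ l ih =>
    rw [pow_succ', Module.End.mul_apply, Pq_zero hN, ih, Function.iterate_succ_apply]; ring

theorem tr_zero (hN : 0 < d * m) (l : ℕ) :
    |LinearMap.trace ℝ _ (Pq d m 0 ^ l)| = (Set.ncard {w : Y d m | Pw^[l] w = w} : ℝ) := by
  classical
  rw [tr_eq]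
  simp only [Pq_zero_pow hN, Pi.single_apply]
  rw [← Finset.mul_sum, abs_mul, abs_pow, abs_pow, abs_neg, abs_one, one_pow, one_pow, one_mul,
    Finset.sum_boole, Set.ncard_eq_toFinset_card']
  rw [Nat.abs_cast]
  congr 2; ext w; simp
end Wd

-- Part P3
/-! ### Promotion of tableaux -/
namespace Wd
variable {d m : ℕ} {E : ℕ → ℕ → ℕ}

theorem step_cases (i₀ : ℕ) (p : ℕ × ℕ) :
    (slideStep d m i₀ E p = p ∧ (p.1 + 1 < d → i₀ < E (p.1+1) p.2) ∧ (p.2 + 1 < m → i₀ < E p.1 (p.2+1))) ∨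
    (slideStep d m i₀ E p = (p.1 + 1, p.2) ∧ p.1 + 1 < d ∧ E (p.1+1) p.2 ≤ i₀ ∧
      (p.2 + 1 < m → E (p.1+1) p.2 < E p.1 (p.2+1))) ∨
    (slideStep d m i₀ E p = (p.1, p.2+1) ∧ p.2 + 1 < m ∧ E p.1 (p.2+1) ≤ i₀ ∧
      (p.1 + 1 < d → E p.1 (p.2+1) ≤ E (p.1+1) p.2)) := by
  unfold slideStep
  split_ifs with h1 h2 h3 h4
  · right; left; refine ⟨rfl, ?_⟩; omega
  · right; right; refine ⟨rfl, ?_⟩; omega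
  · right; left; refine ⟨rfl, ?_⟩; omega
  · right; right; refine ⟨rfl, ?_⟩; omega
  · left; refine ⟨rfl, ?_⟩; omega

theorem step_mono (i₀ : ℕ) (p : ℕ × ℕ) (h : slideStep d m i₀ E p ≠ p) :
    slideStep d m (i₀+1) E p = slideStep d m i₀ E p := by
  have e1 : (p.1+1, p.2) ≠ p := fun h => by have := congrArg Prod.fst h; simp at this
  have e2 : (p.1, p.2+1) ≠ p := fun h => by have := congrArg Prod.snd h; simp at this
  rcases step_cases (d := d) (m := m) (E := E) i₀ p with h1 | h1 | h1
  · exact absurd h1.1 h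
  · rcases step_cases (d := d) (m := m) (E := E) (i₀+1) p with h2 | h2 | h2
    · omega
    · rw [h1.1, h2.1]
    · omega
  · rcases step_cases (d := d) (m := m) (E := E) (i₀+1) p with h2 | h2 | h2
    · omega
    · omega
    · rw [h1.1, h2.1]

/-- The path data. -/
structure PD (d m k : ℕ) (E : ℕ → ℕ → ℕ) (L : ℕ) : Prop where
  le : L ≤ k
  sum : ∀ s ≤ L, (slidePath d m (k+1) E s).1 + (slidePath d m (k+1) E s).2 = s
  const : ∀ s, L ≤ s → slidePath d m (k+1) E s = slidePath d m (k+1) E L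
  lt1 : ∀ s ≤ L, (slidePath d m (k+1) E s).1 < d
  lt2 : ∀ s ≤ L, (slidePath d m (k+1) E s).2 < m
  ent : ∀ s ≤ L, E (slidePath d m (k+1) E s).1 (slidePath d m (k+1) E s).2 ≤ k + 1

theorem const_of_step {i₀ L : ℕ} (h : slideStep d m i₀ E (slidePath d m i₀ E L) = slidePath d m i₀ E L) :
    ∀ s, L ≤ s → slidePath d m i₀ E s = slidePath d m i₀ E L := by
  intro s hs
  induction s, hs using Nat.le_induction with
  | base => rfl
  | succ s hs ih => rw [slidePath, ih, h]

theorem PD.path {k L : ℕ} (h : PD d m k E L) (s : ℕ) (hs : s ≤ L) :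
    slidePath d m (k+2) E s = slidePath d m (k+1) E s := by
  induction s with
  | zero => rfl
  | succ s ih =>
    rw [slidePath, slidePath, ih (by omega)]
    apply step_mono
    intro hh
    have h1 := h.sum s (by omega)
    have h2 := h.sum (s+1) hs
    rw [slidePath, hh] at h2
    omega

theorem PD.finish {k L : ℕ} (h : PD d m k E L) :
    slideStep d m (k+1) E (slidePath d m (k+1) E L) = slidePath d m (k+1) E L :=
  h.const (L+1) (by omega)

open Classical in
theorem PD.pp {k L : ℕ} (h : PD d m k E L) (i j : ℕ) (hi : i < d) (hj : j < m) :
    partialPromo d m (k+1) E i j =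
      if (i, j) = slidePath d m (k+1) E L then k+1 else
      if i + j < L ∧ slidePath d m (k+1) E (i+j) = (i, j) then
        E (slidePath d m (k+1) E (i + j + 1)).1 (slidePath d m (k+1) E (i + j + 1)).2 - 1
      else if E i j ≤ k + 1 then E i j - 1 else E i j := by
  have h0 := h.le
  unfold partialPromo
  rw [if_neg (by omega), h.const (k+1) (by omega)]
  by_cases h1 : (i, j) = slidePath d m (k+1) E L
  · rw [if_pos h1, if_pos h1]
  · rw [if_neg h1, if_neg h1]
    by_cases h2 : i + j < L
    · simp only [h2, true_and]
    · have h3 : slidePath d m (k+1) E (i+j) ≠ (i, j) := by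
        rw [h.const _ (by omega)]; exact fun hh => h1 hh.symm
      simp only [h2, false_and, if_false, if_neg h3]

theorem bx_swp_ne (k : ℕ) (w : ℕ → ℕ) (t : ℕ) (h1 : t ≠ k) (h2 : t ≠ k+1) : bx (swp k w) t = bx w t := by
  simp only [bx, swp_of_ne k w t h1 h2, cnt_swp k w _ t h2]

theorem bx_swp (k : ℕ) (w : ℕ → ℕ) (h : w k ≠ w (k+1)) : bx (swp k w) k = bx w (k+1) := by
  simp only [bx, swp_at]
  rw [cnt_swp k w _ k (by omega), cnt_succ, if_neg h, add_zero]

theorem bx_swp' (k : ℕ) (w : ℕ → ℕ) (h : w k ≠ w (k+1)) : bx (swp k w) (k+1) = bx w k := by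
  have := bx_swp k (swp k w) (by rw [swp_at, swp_at']; exact h.symm)
  rw [swp_swp] at this; exact this.symm

theorem adj_iff {k : ℕ} (hk : k + 1 < d * m) (w : Y d m) :
    adjP k w ↔ (bx w.1 (k+1) = ((bx w.1 k).1, (bx w.1 k).2 + 1) ∨
      bx w.1 (k+1) = ((bx w.1 k).1 + 1, (bx w.1 k).2)) := by
  constructor
  · rintro (h | h)
    · left
      have := w.2.con_succ' hk h
      simp only [bx, Prod.mk.injEq]; exact this
    · right
      have := w.2.con_pred hk h
      simp only [bx, Prod.mk.injEq]; exact this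
  · simp only [bx, Prod.mk.injEq, adjP, con]
    omega

theorem inv (w : Y d m) (hE : Rel d m w.1 E) (k : ℕ) (hk : k < d * m) :
    (∃ L, PD d m k E L) ∧ Rel d m (bks w k).1 (partialPromo d m (k+1) E) := by
  induction k with
  | zero =>
    have hb0 : bx w.1 0 = (0, 0) := by simp [bx, w.2.zero hk, cnt_zero]
    have hnb := w.2.rel_nbr hE hk
    have h0 := hE.2 0 hk
    have hlt := w.2.bx_lt hk
    rw [hb0] at hnb h0 hlt
    simp only [zero_add] at hnb h0 hlt
    have hst : slideStep d m 1 E (0, 0) = (0, 0) := by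
      rcases step_cases (d := d) (m := m) (E := E) 1 (0, 0) with h1 | h1 | h1
      · exact h1.1
      · simp only [zero_add] at h1; omega
      · simp only [zero_add] at h1; omega
    have hPD : PD d m 0 E 0 := by
      refine ⟨le_rfl, ?_, const_of_step hst, ?_, ?_, ?_⟩
      all_goals
        intro s hs
        obtain rfl : s = 0 := by omega
        simp [slidePath]
        try omega
    refine ⟨⟨0, hPD⟩, ?_⟩
    have : partialPromo d m 1 E = E := by
      ext i j
      by_cases hij : i < d ∧ j < m
      · rw [hPD.pp i j hij.1 hij.2]
        simp only [slidePath, Prod.mk.injEq]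
        split_ifs with h1 h2 h3
        · rw [h1.1, h1.2, h0]
        · omega
        · exfalso
          obtain ⟨t, ht, hb⟩ := w.2.bx_surj hij.1 hij.2
          have e := hE.2 t ht
          rw [hb] at e; simp only at e
          obtain rfl : t = 0 := by omega
          rw [hb0] at hb
          simp only [Prod.mk.injEq] at hb; omega
        · rfl
      · rw [hE.1 i j (by omega), partialPromo, if_pos (by omega)]
    rw [zero_add, this]; exact hE
  | succ k ih =>
    obtain ⟨⟨L, hPD⟩, hR⟩ := ih (by omega)
    set H := slidePath d m (k+1) E L with hH
    set v := bks w k with hv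
    have hvk : bks w (k+1) = bk k v := rfl
    have hH1 := hPD.lt1 L le_rfl
    have hH2 := hPD.lt2 L le_rfl
    have hHE := hPD.ent L le_rfl
    rw [← hH] at hH1 hH2 hHE
    -- the box of `k` in `v`
    have hFH : partialPromo d m (k+1) E H.1 H.2 = k+1 := by
      rw [hPD.pp _ _ hH1 hH2, if_pos rfl]
    have hbk : bx v.1 k = H := (v.2.rel_eq hR hH1 hH2 hFH).1
    -- the box with entry `k+2` in `E`
    set b := bx w.1 (k+1) with hb
    have hbE : E b.1 b.2 = k + 2 := hE.2 (k+1) hk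
    have hbl := w.2.bx_lt hk
    rw [← hb] at hbl
    have huniq : ∀ i j, i < d → j < m → E i j = k + 2 → (i, j) = b := by
      intro i j hi hj h
      exact (w.2.rel_eq hE hi hj h).1.symm
    have hoff : ∀ s ≤ L, slidePath d m (k+1) E s ≠ b := by
      intro s hs h
      have := hPD.ent s hs
      rw [h, hbE] at this; omega
    have hFb : partialPromo d m (k+1) E b.1 b.2 = k + 2 := by
      rw [hPD.pp _ _ hbl.1 hbl.2, if_neg (fun h => hoff L le_rfl h.symm),
        if_neg (fun h => hoff _ h.1.le h.2), if_neg (by omega), hbE]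
    have hbk1 : bx v.1 (k+1) = b := (v.2.rel_eq hR hbl.1 hbl.2 hFb).1
    have hfinish := hPD.finish
    rw [← hH] at hfinish
    have e1 : (H.1+1, H.2) ≠ H := fun h => by have := congrArg Prod.fst h; simp at this
    have e2 : (H.1, H.2+1) ≠ H := fun h => by have := congrArg Prod.snd h; simp at this
    have hterm : (H.1 + 1 < d → k+1 < E (H.1+1) H.2) ∧ (H.2 + 1 < m → k+1 < E H.1 (H.2+1)) := by
      rcases step_cases (d := d) (m := m) (E := E) (k+1) H with h1 | h1 | h1
      · exact h1.2
      · exact absurd (h1.1.symm.trans hfinish) e1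
      · exact absurd (h1.1.symm.trans hfinish) e2
    have hPL : slidePath d m (k+2) E L = H := hPD.path L le_rfl
    have hadj := adj_iff hk v
    rw [hbk, hbk1] at hadj
    have hLk := hPD.le
    by_cases ha : adjP k v
    · -- a move
      have hmv : slideStep d m (k+2) E H = b := by
        rcases hadj.1 ha with h | h
        · rcases step_cases (d := d) (m := m) (E := E) (k+2) H with h1 | h1 | h1
          · exfalso
            have hb2 := hbl.2
            rw [h] at hbE hb2; simp only at hbE hb2
            have := h1.2.2 hb2; omega
          · rw [h1.1]; exact huniq _ _ h1.2.1 hH2 (by have := hterm.1 h1.2.1; omega)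
          · rw [h1.1, h]
        · rcases step_cases (d := d) (m := m) (E := E) (k+2) H with h1 | h1 | h1
          · exfalso
            have hb2 := hbl.1
            rw [h] at hbE hb2; simp only at hbE hb2
            have := h1.2.1 hb2; omega
          · rw [h1.1, h]
          · rw [h1.1]; exact huniq _ _ hH1 h1.2.1 (by have := hterm.2 h1.2.1; omega)
      have hPL1 : slidePath d m (k+2) E (L+1) = b := by rw [slidePath, hPL, hmv]
      have hbsum : b.1 + b.2 = L + 1 := by
        have := hPD.sum L le_rfl
        rw [← hH] at this
        rcases hadj.1 ha with h | h <;> (rw [h]; simp only; omega)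
      have hPD' : PD d m (k+1) E (L+1) := by
        refine ⟨by omega, ?_, ?_, ?_, ?_, ?_⟩
        · intro s hs
          rcases Nat.lt_or_eq_of_le hs with h | h
          · rw [hPD.path s (by omega)]; exact hPD.sum s (by omega)
          · rw [h, hPL1]; exact hbsum
        · apply const_of_step
          show slideStep d m (k+2) E (slidePath d m (k+2) E (L+1)) = slidePath d m (k+2) E (L+1)
          rw [hPL1]
          have hnb := w.2.rel_nbr hE hk
          rw [← hb] at hnb
          rcases step_cases (d := d) (m := m) (E := E) (k+2) b with h1 | h1 | h1
          · exact h1.1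
          · have := hnb.1 h1.2.1; omega
          · have := hnb.2 h1.2.1; omega
        · intro s hs
          rcases Nat.lt_or_eq_of_le hs with h | h
          · rw [hPD.path s (by omega)]; exact hPD.lt1 s (by omega)
          · rw [h, hPL1]; exact hbl.1
        · intro s hs
          rcases Nat.lt_or_eq_of_le hs with h | h
          · rw [hPD.path s (by omega)]; exact hPD.lt2 s (by omega)
          · rw [h, hPL1]; exact hbl.2
        · intro s hs
          rcases Nat.lt_or_eq_of_le hs with h | h
          · rw [hPD.path s (by omega)]; have := hPD.ent s (by omega); omega
          · rw [h, hPL1]; omega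
      refine ⟨⟨L+1, hPD'⟩, ?_⟩
      have hF : partialPromo d m (k+1+1) E = partialPromo d m (k+1) E := by
        ext i j
        by_cases hij : i < d ∧ j < m
        · by_cases h1 : (i, j) = b
          · have h1' := h1
            rw [← h1] at hFb
            simp only at hFb
            rw [hFb, hPD'.pp i j hij.1 hij.2, if_pos (by rw [h1]; exact hPL1.symm)]
          by_cases h2 : (i, j) = H
          · have e := hPD.sum L le_rfl
            rw [← hH, ← h2] at e
            simp only at e
            rw [← h2] at hFH
            simp only at hFH
            rw [hFH, hPD'.pp i j hij.1 hij.2,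
              if_neg (by rw [show slidePath d m (k+1+1) E (L+1) = b from hPL1]; exact h1),
              if_pos ⟨by omega, by rw [e, h2]; exact hPL⟩, e,
              show slidePath d m (k+1+1) E (L+1) = b from hPL1, hbE]; rfl
          rw [hPD'.pp i j hij.1 hij.2, hPD.pp i j hij.1 hij.2,
            if_neg (by rw [show slidePath d m (k+1+1) E (L+1) = b from hPL1]; exact h1), if_neg h2]
          have h5 : E i j ≠ k + 2 := fun h => h1 (huniq i j hij.1 hij.2 h)
          rcases Nat.lt_trichotomy (i+j) L with h3 | h3 | h3
          · rw [show slidePath d m (k+1+1) E (i+j) = _ from hPD.path (i+j) (by omega),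
              show slidePath d m (k+1+1) E (i+j+1) = _ from hPD.path (i+j+1) (by omega)]
            simp only [h3, show i + j < L + 1 by omega, true_and]
            split_ifs <;> first | rfl | omega
          · have h4 : slidePath d m (k+1+1) E (i+j) ≠ (i, j) := by
              rw [h3]; exact fun h => h2 (h.symm.trans hPL)
            simp only [h4, show ¬ (i + j < L) by omega, and_false, false_and, if_false]
            split_ifs <;> first | rfl | omega
          · simp only [show ¬ (i + j < L) by omega, show ¬ (i + j < L + 1) by omega, false_and, if_false]
            split_ifs <;> first | rfl | omega
        · rw [partialPromo, partialPromo, if_pos (by omega), if_pos (by omega)]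
      rw [hF, hvk, bk_adj ha]; exact hR
    · have hmv : slideStep d m (k+2) E H = H := by
        rcases step_cases (d := d) (m := m) (E := E) (k+2) H with h1 | h1 | h1
        · exact h1.1
        · exact absurd (hadj.2 (Or.inr (huniq _ _ h1.2.1 hH2 (by have := hterm.1 h1.2.1; omega)).symm)) ha
        · exact absurd (hadj.2 (Or.inl (huniq _ _ hH1 h1.2.1 (by have := hterm.2 h1.2.1; omega)).symm)) ha
      have hPD' : PD d m (k+1) E L := by
        refine ⟨by omega, ?_, ?_, ?_, ?_, ?_⟩
        · intro s hs
          rw [hPD.path s (by omega)]; exact hPD.sum s (by omega)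
        · apply const_of_step
          show slideStep d m (k+2) E (slidePath d m (k+2) E L) = slidePath d m (k+2) E L
          rw [hPL, hmv]
        · intro s hs
          rw [hPD.path s (by omega)]; exact hPD.lt1 s (by omega)
        · intro s hs
          rw [hPD.path s (by omega)]; exact hPD.lt2 s (by omega)
        · intro s hs
          rw [hPD.path s (by omega)]; have := hPD.ent s (by omega); omega
      refine ⟨⟨L, hPD'⟩, ?_⟩
      have hPL' : slidePath d m (k+1+1) E L = H := hPL
      have hbH : b ≠ H := fun h => hoff L le_rfl h.symm
      have hF1 : partialPromo d m (k+1+1) E H.1 H.2 = k + 2 := by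
        rw [hPD'.pp _ _ hH1 hH2, if_pos (by rw [hPL'])]
      have hF2 : partialPromo d m (k+1+1) E b.1 b.2 = k + 1 := by
        rw [hPD'.pp _ _ hbl.1 hbl.2, if_neg (by rw [hPL']; exact hbH), if_neg, if_pos (by omega), hbE]
        · rfl
        · rintro ⟨h1, h2⟩
          rw [show slidePath d m (k+1+1) E _ = _ from hPD.path (b.1 + b.2) (by omega)] at h2
          exact hoff _ h1.le h2
      have hF3 : ∀ i j, i < d → j < m → (i, j) ≠ H → (i, j) ≠ b →
          partialPromo d m (k+1+1) E i j = partialPromo d m (k+1) E i j := by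
        intro i j hi hj h1 h2
        have h5 : E i j ≠ k + 2 := fun h => h2 (huniq i j hi hj h)
        rw [hPD'.pp i j hi hj, hPD.pp i j hi hj, hPL', if_neg h1, if_neg h1]
        by_cases h3 : i + j < L
        · rw [show slidePath d m (k+1+1) E (i+j) = _ from hPD.path (i+j) (by omega),
              show slidePath d m (k+1+1) E (i+j+1) = _ from hPD.path (i+j+1) (by omega)]
          split_ifs <;> first | rfl | omega
        · simp only [h3, false_and, if_false]
          split_ifs <;> first | rfl | omega
      rw [hvk, bk_nadj hk ha]
      have hne : v.1 k ≠ v.1 (k+1) := by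
        intro h
        rcases v.2.con_cases hk with h1 | h1 | h1
        · exact ha (Or.inl h1.2)
        · omega
        · omega
      refine ⟨fun i j hij => by rw [partialPromo, if_pos hij], ?_⟩
      intro t ht
      by_cases t1 : t = k
      · subst t1; rw [bx_swp _ _ hne, hbk1]; exact hF2
      by_cases t2 : t = k + 1
      · subst t2; rw [bx_swp' _ _ hne, hbk]; exact hF1
      rw [bx_swp_ne _ _ _ t1 t2]
      have hl := v.2.bx_lt ht
      rw [hF3 _ _ hl.1 hl.2]
      · exact hR.2 t ht
      · intro h; exact t1 (bx_inj v.1 (h.trans hbk.symm))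
      · intro h; exact t2 (bx_inj v.1 (h.trans hbk1.symm))

theorem promo_rel (w : Y d m) (hE : Rel d m w.1 E) (hN : 0 < d * m) :
    Rel d m (Pw w).1 (promo d m E) := by
  have := (inv w hE (d * m - 1) (by omega)).2
  rw [Nat.sub_add_cancel hN] at this
  exact this

theorem promo_iter_rel (hN : 0 < d * m) (l : ℕ) (w : Y d m) (hE : Rel d m w.1 E) :
    Rel d m (Pw^[l] w).1 ((promo d m)^[l] E) := by
  induction l generalizing w E with
  | zero => exact hE
  | succ l ih => exact ih (Pw w) (promo_rel w hE hN)

theorem word_unique {w v : Y d m} (h : Rel d m w.1 E) (h' : Rel d m v.1 E) : w = v := by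
  have hb : ∀ t < d * m, bx w.1 t = bx v.1 t := by
    intro t ht
    have h1 := v.2.bx_lt ht
    have := (w.2.rel_eq h h1.1 h1.2 (h'.2 t ht)).1
    exact this
  apply Y.ext; ext t
  by_cases ht : t < d * m
  · exact congrArg Prod.fst (hb t ht)
  · rw [w.2.eq t (by omega), v.2.eq t (by omega)]

theorem promo_count (hN : 0 < d * m) (l : ℕ) :
    Set.ncard {E : ℕ → ℕ → ℕ | IsSYT d m E ∧ (promo d m)^[l] E = E} =
      Set.ncard {w : Y d m | Pw^[l] w = w} := by
  symm
  refine Set.ncard_congr (fun w _ => (w.2.rel_exists).choose) ?_ ?_ ?_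
  · intro w hw
    have h := (w.2.rel_exists).choose_spec
    refine ⟨w.2.isSYT h, ?_⟩
    have h1 := promo_iter_rel hN l w h
    rw [show Pw^[l] w = w from hw] at h1
    exact w.2.rel_unique h1 h
  · intro w v hw hv h
    have h1 := (w.2.rel_exists).choose_spec
    have h2 := (v.2.rel_exists).choose_spec
    rw [← h] at h2
    exact word_unique h1 h2
  · intro E hE
    obtain ⟨w, hw, hR⟩ := syt_word hE.1
    refine ⟨⟨w, hw⟩, ?_, hw.rel_unique (hw.rel_exists).choose_spec hR⟩
    have h1 := promo_iter_rel hN l ⟨w, hw⟩ hR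
    rw [hE.2] at h1
    exact word_unique h1 hR

theorem tab_count (hN : 0 < d * m) (l : ℕ) :
    (Set.ncard {E : ℕ → ℕ → ℕ | IsSYT d m E ∧ (promo d m)^[l] E = E} : ℝ) =
      |LinearMap.trace ℝ _ (Pq d m 0 ^ l)| := by
  rw [tr_zero hN, promo_count hN]
end Wd

-- Part B1
/-! ### The determinant -/
namespace Wd

theorem bad_perm (d w r : ℕ) (hr : 0 < r) (h1 : ¬ r ∣ d) (h2 : ¬ r ∣ w) (σ : Equiv.Perm (Fin d)) :
    ∃ i : Fin d, ¬ ((w + (i : ℕ)) % r = (σ i : ℕ) % r) := by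
  by_contra hc
  push Not at hc
  have hz := Complex.isPrimitiveRoot_exp r hr.ne'
  set ζ := Complex.exp (2 * Real.pi * Complex.I / r)
  have hmod : ∀ a : ℕ, ζ ^ a = ζ ^ (a % r) := by
    intro a
    conv_lhs => rw [← Nat.mod_add_div a r, pow_add, pow_mul, hz.pow_eq_one, one_pow, mul_one]
  have e1 : ∑ i : Fin d, ζ ^ (i : ℕ) = ∑ i : Fin d, ζ ^ (w + (i : ℕ)) := by
    rw [← Equiv.sum_comp σ (fun i : Fin d => ζ ^ (i : ℕ))]
    refine Finset.sum_congr rfl fun i _ => ?_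
    rw [hmod (w + i), hc i, ← hmod]
  simp only [pow_add] at e1
  rw [← Finset.mul_sum, Fin.sum_univ_eq_sum_range (fun i => ζ ^ i)] at e1
  have e2 := geom_sum_mul ζ d
  have e3 : (1 - ζ ^ w) * (ζ ^ d - 1) = 0 := by
    rw [← e2]; linear_combination (ζ - 1) * e1
  rcases mul_eq_zero.1 e3 with h | h
  · exact h2 (hz.dvd_of_pow_eq_one w (by linear_combination -h))
  · exact h1 (hz.dvd_of_pow_eq_one d (by linear_combination h))

theorem bad_sum (d w r : ℕ) (hr : 0 < r) (h1 : ¬ r ∣ d) (h2 : ¬ r ∣ w) :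
    ∑ σ : Equiv.Perm (Fin d), (Equiv.Perm.sign σ : ℝ) * ∏ i, ivr r ((w:ℤ) + σ i - i) = 0 := by
  refine Finset.sum_eq_zero fun σ _ => ?_
  obtain ⟨i, hi⟩ := bad_perm d w r hr h1 h2 σ⁻¹
  rw [Finset.prod_eq_zero (Finset.mem_univ (σ⁻¹ i)), mul_zero]
  rw [ivr, if_neg]
  rintro ⟨_, h4⟩
  apply hi
  have h6 : σ (σ⁻¹ i) = i := by simp
  rw [h6] at h4
  have h5 := Int.emod_eq_emod_iff_emod_sub_eq_zero.2 (Int.emod_eq_zero_of_dvd h4)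
  exact_mod_cast h5

/-- the reindexing permutation -/
theorem good_perm (d w r : ℕ) (hr : 0 < r) (h : r ∣ d ∨ r ∣ w) :
    ∃ (φ : Equiv.Perm (Fin d)) (v : ℕ → ℕ), ∀ k : Fin d, w + (φ k : ℕ) = k + r * v (k % r) := by
  set v : ℕ → ℕ := fun t => (w + r - 1 - t) / r with hv
  have key : ∀ k, w ≤ k + r * v (k % r) ∧ k % r + r * v (k % r) ≤ w + r - 1 := by
    intro k
    have h1 := Nat.mod_lt k hr
    have h2 := Nat.div_add_mod (w + r - 1 - k % r) r
    have h3 := Nat.mod_lt (w + r - 1 - k % r) hr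
    have h4 := Nat.mod_le k r
    have h5 : r * v (k % r) = r * ((w + r - 1 - k % r) / r) := rfl
    omega
  have hlt : ∀ k : Fin d, (k : ℕ) + r * v (k % r) - w < d := by
    intro k
    have hk := k.2
    have h0 := key k
    have h4 := Nat.div_add_mod (k : ℕ) r
    have h1 := Nat.mod_lt (k : ℕ) hr
    rcases h with ⟨c, hc⟩ | ⟨c, hc⟩
    · have h5 : (k : ℕ) / r < c := by
        rw [Nat.div_lt_iff_lt_mul hr]; linarith [hk, hc, mul_comm r c]
      have h6 : r * ((k:ℕ) / r + 1) ≤ r * c := Nat.mul_le_mul_left _ h5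
      rw [mul_add] at h6
      omega
    · have : v ((k : ℕ) % r) = c := by
        simp only [hv]
        rw [hc, show r * c + r - 1 - (k : ℕ) % r = (r - 1 - (k : ℕ) % r) + r * c by omega,
          Nat.add_mul_div_left _ _ hr, Nat.div_eq_of_lt (by omega)]; omega
      rw [this, hc]; omega
  have hinj : Function.Injective (fun k : Fin d => (⟨(k : ℕ) + r * v (k % r) - w, hlt k⟩ : Fin d)) := by
    intro k k' hkk
    simp only [Fin.mk.injEq] at hkk
    have h1 := key k
    have h2 := key k'
    have h3 : (k : ℕ) + r * v (k % r) = k' + r * v (k' % r) := by omega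
    have h4 : (k : ℕ) % r = k' % r := by
      have := congrArg (· % r) h3
      simpa using this
    rw [h4] at h3
    exact Fin.ext (by omega)
  refine ⟨Equiv.ofBijective _ (Finite.injective_iff_bijective.1 hinj), v, ?_⟩
  intro k
  have := key k
  simp only [Equiv.ofBijective_apply]
  omega

/-- Vandermonde convolution in a residue class -/
theorem conv (d r : ℕ) (hr : 0 < r) (k j : Fin d) (v : ℕ) (hkj : (k : ℕ) % r = j % r) :
    ((v + (k : ℕ) / r).choose ((j : ℕ) / r) : ℝ) =
    ∑ l : Fin d, (if (k : ℕ) % r = l % r then (((k : ℕ) / r).choose ((l : ℕ) / r) : ℝ) else 0) *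
      (if (l : ℕ) % r = j % r ∧ (l : ℕ) / r ≤ (j : ℕ) / r then (v.choose ((j : ℕ) / r - (l : ℕ) / r) : ℝ) else 0) := by
  have hs : ∀ l : Fin d, (if (k : ℕ) % r = l % r then (((k : ℕ) / r).choose ((l : ℕ) / r) : ℝ) else 0) *
      (if (l : ℕ) % r = j % r ∧ (l : ℕ) / r ≤ (j : ℕ) / r then (v.choose ((j : ℕ) / r - (l : ℕ) / r) : ℝ) else 0)
      = if (l : ℕ) % r = j % r ∧ (l : ℕ) / r ≤ (j : ℕ) / r then
        ((((k : ℕ) / r).choose ((l : ℕ) / r) * v.choose ((j : ℕ) / r - (l : ℕ) / r) : ℕ) : ℝ) else 0 := by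
    intro l
    by_cases h1 : (l : ℕ) % r = j % r ∧ (l : ℕ) / r ≤ (j : ℕ) / r
    · rw [if_pos h1, if_pos h1, if_pos (by omega)]; push_cast; rfl
    · rw [if_neg h1, if_neg h1, mul_zero]
  simp only [hs]
  rw [← Finset.sum_filter, add_comm, Nat.add_choose_eq, Nat.cast_sum]
  symm
  refine Finset.sum_bij' (fun l _ => ((l : ℕ) / r, (j : ℕ) / r - (l : ℕ) / r))
    (fun p hp => ⟨(j : ℕ) % r + r * p.1, ?_⟩) ?_ ?_ ?_ ?_ ?_
  · have := Finset.HasAntidiagonal.mem_antidiagonal.1 hp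
    have h1 := Nat.mod_add_div (j : ℕ) r
    have h2 : r * p.1 ≤ r * ((j : ℕ) / r) := Nat.mul_le_mul_left _ (by omega)
    have := j.2; omega
  · intro l hl
    simp only [Finset.mem_filter, Finset.mem_univ, true_and] at hl
    simp only [Finset.HasAntidiagonal.mem_antidiagonal]; omega
  · intro p hp
    have := Finset.HasAntidiagonal.mem_antidiagonal.1 hp
    simp only [Finset.mem_filter, Finset.mem_univ, true_and]
    rw [Nat.add_mul_div_left _ _ hr, Nat.div_eq_of_lt (Nat.mod_lt _ hr)]
    refine ⟨by simp, by omega⟩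
  · intro l hl
    simp only [Finset.mem_filter, Finset.mem_univ, true_and] at hl
    apply Fin.ext
    simp only [← hl.1]
    exact Nat.mod_add_div _ _
  · intro p hp
    have := Finset.HasAntidiagonal.mem_antidiagonal.1 hp
    simp only
    rw [Nat.add_mul_div_left _ _ hr, Nat.div_eq_of_lt (Nat.mod_lt _ hr)]
    ext <;> simp; omega
  · intro l hl; rfl

theorem det_good (d w r : ℕ) (hr : 0 < r) (φ : Equiv.Perm (Fin d)) (v : ℕ → ℕ)
    (hφ : ∀ k : Fin d, w + (φ k : ℕ) = k + r * v (k % r)) :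
    |∑ σ : Equiv.Perm (Fin d), (Equiv.Perm.sign σ : ℝ) * ∏ i, ivr r ((w:ℤ) + σ i - i)| =
      ∏ k : Fin d, (((k : ℕ) / r).factorial : ℝ) / ((v (k % r) + (k : ℕ) / r).factorial : ℝ) := by
  set A : Matrix (Fin d) (Fin d) ℝ := Matrix.of fun i j => ivr r ((w:ℤ) + i - j) with hA
  have h1 : ∑ σ : Equiv.Perm (Fin d), (Equiv.Perm.sign σ : ℝ) * ∏ i, ivr r ((w:ℤ) + σ i - i) = A.det := by
    rw [Matrix.det_apply']
    rfl
  set L : Matrix (Fin d) (Fin d) ℝ := Matrix.of fun k l =>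
    if (k : ℕ) % r = l % r then (((k : ℕ) / r).choose ((l : ℕ) / r) : ℝ) else 0 with hL
  set U : Matrix (Fin d) (Fin d) ℝ := Matrix.of fun l j =>
    if (l : ℕ) % r = j % r ∧ (l : ℕ) / r ≤ (j : ℕ) / r then ((v (l % r)).choose ((j : ℕ) / r - (l : ℕ) / r) : ℝ) else 0 with hU
  have hlt : ∀ a b : Fin d, a < b → (a : ℕ) % r = b % r → (a : ℕ) / r < (b : ℕ) / r := by
    intro a b hab h
    have h1 := Nat.mod_add_div (a : ℕ) r
    have h2 := Nat.mod_add_div (b : ℕ) r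
    by_contra hc
    have := Nat.mul_le_mul_left r (not_lt.1 hc)
    have : (a : ℕ) < b := hab
    omega
  have hLd : L.det = 1 := by
    rw [Matrix.det_of_isLowerTriangular L]
    · simp [hL]
    · intro i j hij
      have hij' : i < j := hij
      simp only [hL, Matrix.of_apply]
      split_ifs with h
      · rw [Nat.choose_eq_zero_of_lt (hlt _ _ hij' h)]; simp
      · rfl
  have hUd : U.det = 1 := by
    rw [Matrix.det_of_isUpperTriangular]
    · simp [hU]
    · intro i j hij
      have hij' : j < i := hij
      simp only [hU, Matrix.of_apply]
      rw [if_neg]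
      rintro ⟨h, h'⟩
      have := hlt _ _ hij' h.symm; omega
  have hM : A.submatrix φ id = Matrix.diagonal (fun k : Fin d => (((v (k % r) + (k : ℕ) / r).factorial : ℝ))⁻¹) * (L * U) *
      Matrix.diagonal (fun j : Fin d => (((j : ℕ) / r).factorial : ℝ)) := by
    ext k j
    rw [Matrix.mul_diagonal, Matrix.diagonal_mul, Matrix.mul_apply, Matrix.submatrix_apply, hA, Matrix.of_apply]
    have e0 : (w:ℤ) + (φ k : ℕ) - ((id j : Fin d) : ℕ) = (k : ℕ) + r * v (k % r) - (j : ℕ) := by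
      rw [← Nat.cast_add, hφ k]; push_cast; rfl
    rw [e0]
    have hk := Nat.mod_add_div (k : ℕ) r
    have hj := Nat.mod_add_div (j : ℕ) r
    by_cases hkj : (k : ℕ) % r = j % r
    · have e1 : ∑ l, L k l * U l j = ((v (k % r) + (k : ℕ) / r).choose ((j : ℕ) / r) : ℝ) := by
        rw [conv d r hr k j (v (k % r)) hkj]
        refine Finset.sum_congr rfl fun l _ => ?_
        simp only [hL, hU, Matrix.of_apply]
        by_cases h : (k : ℕ) % r = l % r
        · rw [h]
        · rw [if_neg h, zero_mul, zero_mul]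
      rw [e1]
      set a := (k : ℕ) / r
      set b := (j : ℕ) / r
      set V := v (k % r)
      have e2 : ((k : ℕ) : ℤ) + r * V - (j : ℕ) = r * ((V : ℤ) + a - b) := by
        rw [← hk, ← hj, hkj]; push_cast; ring
      rw [e2]
      by_cases hb : b ≤ V + a
      · rw [show (V : ℤ) + a - b = ((V + a - b : ℕ) : ℤ) by omega, ← Nat.cast_mul, ivr,
          if_pos ⟨by positivity, by push_cast; exact dvd_mul_right _ _⟩, Int.toNat_natCast,
          Nat.mul_div_cancel_left _ hr]
        have e3 := Nat.choose_mul_factorial_mul_factorial hb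
        have e4 : ((V + a).choose b : ℝ) * b.factorial * (V + a - b).factorial = (V + a).factorial := by
          exact_mod_cast e3
        have p1 : ((V + a - b).factorial : ℝ) ≠ 0 := by positivity
        have p2 : ((V + a).factorial : ℝ) ≠ 0 := by positivity
        field_simp
        linear_combination -e4
      · rw [Nat.choose_eq_zero_of_lt (by omega), ivr, if_neg]
        · simp
        · rintro ⟨h, _⟩
          have : (r : ℤ) * ((V : ℤ) + a - b) < 0 := mul_neg_of_pos_of_neg (by omega) (by omega)
          omega
    · rw [Finset.sum_eq_zero, ivr, if_neg]
      · simp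
      · rintro ⟨_, h⟩
        apply hkj
        have h5 : ((k : ℕ) : ℤ) + r * v (k % r) ≡ (j : ℕ) [ZMOD r] := (Int.modEq_iff_dvd.2 h).symm
        have h6 : ((k : ℕ) + r * v (k % r) : ℕ) ≡ (j : ℕ) [MOD r] := by
          rw [← Int.natCast_modEq_iff]; push_cast; exact h5
        have h7 : ((k : ℕ) + r * v (k % r)) % r = j % r := h6
        simpa using h7
      · intro l _
        simp only [hL, hU, Matrix.of_apply]
        by_cases h : (k : ℕ) % r = l % r
        · rw [if_neg (fun hh : _ ∧ _ => hkj (h.trans hh.1)), mul_zero]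
        · rw [if_neg h, zero_mul]
  have hdet : |A.det| = |(A.submatrix φ id).det| := by
    rw [Matrix.det_permute, abs_mul]
    rcases Int.units_eq_one_or (Equiv.Perm.sign φ) with h | h <;> simp [h]
  rw [h1, hdet, hM, Matrix.det_mul, Matrix.det_mul, Matrix.det_mul, hLd, hUd, Matrix.det_diagonal, Matrix.det_diagonal]
  rw [mul_one, mul_one, ← Finset.prod_mul_distrib, abs_of_nonneg (by positivity)]
  refine Finset.prod_congr rfl fun k _ => ?_
  field_simp
end Wd

-- Part B2
namespace Wd
/-- index set of the free coordinates -/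
abbrev Io (d w r : ℕ) : Type := {p : Fin d × Fin w // (w + (p.1 : ℕ)) % r = (p.2 : ℕ) % r}

theorem Io_prod {M : Type*} [CommMonoid M] (d w r : ℕ) (hr : 0 < r) (F : ℕ → M) :
    ∏ p : Io d w r, F ((w + (p.1.1 : ℕ) - p.1.2) / r) =
      ∏ i : Fin d, ∏ q ∈ Finset.Ioc ((i : ℕ) / r) ((w + (i : ℕ)) / r), F q := by
  rw [Finset.prod_sigma']
  have hq : ∀ (i : Fin d) (q : ℕ), q ∈ Finset.Ioc ((i : ℕ) / r) ((w + (i : ℕ)) / r) →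
      r * q ≤ w + i ∧ (i : ℕ) < r * q := by
    intro i q h
    rw [Finset.mem_Ioc] at h
    refine ⟨?_, ?_⟩
    · have := (Nat.le_div_iff_mul_le hr).1 h.2
      rwa [mul_comm]
    · have := (Nat.div_lt_iff_lt_mul hr).1 h.1
      rwa [mul_comm]
  have hp : ∀ p : Io d w r, ∃ q, w + (p.1.1 : ℕ) = p.1.2 + r * q ∧ (w + (p.1.1 : ℕ) - p.1.2) / r = q := by
    intro p
    have h1 := p.2
    have h2 := Nat.mod_add_div (w + (p.1.1 : ℕ)) r
    have h3 := Nat.mod_add_div (p.1.2 : ℕ) r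
    have h4 := p.1.2.2
    have h5 : (p.1.2 : ℕ) / r ≤ (w + (p.1.1 : ℕ)) / r := Nat.div_le_div_right (by omega)
    have h6 : w + (p.1.1 : ℕ) = p.1.2 + r * ((w + (p.1.1 : ℕ)) / r - (p.1.2 : ℕ) / r) := by
      rw [Nat.mul_sub]
      have := Nat.mul_le_mul_left r h5
      omega
    refine ⟨_, h6, ?_⟩
    rw [Nat.div_eq_iff_eq_mul_right hr]
    · omega
    · exact ⟨(w + (p.1.1 : ℕ)) / r - (p.1.2 : ℕ) / r, by omega⟩
  refine Finset.prod_bij' (fun p _ => ⟨p.1.1, (w + (p.1.1 : ℕ) - p.1.2) / r⟩)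
    (fun s hs => ⟨(s.1, ⟨w + s.1 - r * s.2, ?_⟩), ?_⟩) ?_ ?_ ?_ ?_ ?_
  · have := hq s.1 s.2 (by simpa using hs); omega
  · have := hq s.1 s.2 (by simpa using hs)
    have h2 : (w + (s.1 : ℕ)) = (w + s.1 - r * s.2) + r * s.2 := by omega
    conv_lhs => rw [h2]
    simp
  · intro p _
    obtain ⟨q, h1, h2⟩ := hp p
    simp only [Finset.mem_sigma, Finset.mem_univ, true_and, h2, Finset.mem_Ioc]
    have := p.1.2.2
    constructor
    · rw [Nat.div_lt_iff_lt_mul hr, mul_comm]; omega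
    · rw [Nat.le_div_iff_mul_le hr, mul_comm]; omega
  · intro s hs; simp
  · intro p _
    obtain ⟨q, h1, h2⟩ := hp p
    apply Subtype.ext
    ext
    · rfl
    · simp only [h2]; omega
  · intro s hs
    have := hq s.1 s.2 (by simpa using hs)
    ext
    · rfl
    · simp only [heq_eq_eq]
      rw [show w + (s.1 : ℕ) - (w + s.1 - r * s.2) = r * s.2 by omega, Nat.mul_div_cancel_left _ hr]
  · intro p _; rfl

theorem prod_Ioc (a b : ℕ) (hab : a ≤ b) : ∏ q ∈ Finset.Ioc a b, (q : ℝ) = (b.factorial : ℝ) / a.factorial := by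
  induction b, hab using Nat.le_induction with
  | base => simp; rw [div_self]; positivity
  | succ b hb ih =>
    rw [← Finset.insert_Ioc_right_eq_Ioc_add_one (by omega), Finset.prod_insert (by simp), ih, Nat.factorial_succ]
    push_cast; ring

theorem perm_div {d w r : ℕ} (hr : 0 < r) {φ : Equiv.Perm (Fin d)} {v : ℕ → ℕ}
    (hφ : ∀ k : Fin d, w + (φ k : ℕ) = k + r * v (k % r)) (k : Fin d) :
    (w + (φ k : ℕ)) / r = v (k % r) + (k : ℕ) / r := by
  rw [hφ, Nat.add_mul_div_left _ _ hr, add_comm]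

theorem Io_card {d w r l : ℕ} (hr : 0 < r) (h : r ∣ d ∨ r ∣ w) (hl : r * l = d * w) :
    Fintype.card (Io d w r) = l := by
  obtain ⟨φ, v, hφ⟩ := good_perm d w r hr h
  have h1 := Io_prod (M := Multiplicative ℕ) d w r hr (fun _ => Multiplicative.ofAdd 1)
  have h2 : Fintype.card (Io d w r) = ∑ i : Fin d, ((w + (i : ℕ)) / r - (i : ℕ) / r) := by
    have := congrArg Multiplicative.toAdd h1
    simpa using this
  have h3 : Fintype.card (Io d w r) + ∑ i : Fin d, (i : ℕ) / r = ∑ i : Fin d, (w + (i : ℕ)) / r := by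
    rw [h2, ← Finset.sum_add_distrib]
    refine Finset.sum_congr rfl fun i _ => Nat.sub_add_cancel (Nat.div_le_div_right (by omega))
  rw [← Equiv.sum_comp φ (fun i : Fin d => (w + (i : ℕ)) / r)] at h3
  simp only [perm_div hr hφ, Finset.sum_add_distrib] at h3
  have h4 : Fintype.card (Io d w r) = ∑ k : Fin d, v ((k : ℕ) % r) := by omega
  have h5 : ∑ k : Fin d, (w + (φ k : ℕ)) = ∑ k : Fin d, ((k : ℕ) + r * v (k % r)) :=
    Finset.sum_congr rfl fun k _ => hφ k
  rw [Finset.sum_add_distrib, Finset.sum_add_distrib, ← Finset.mul_sum, ← h4,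
    Equiv.sum_comp φ (fun i : Fin d => (i : ℕ))] at h5
  simp only [Finset.sum_const, Finset.card_univ, Fintype.card_fin, smul_eq_mul] at h5
  exact Nat.eq_of_mul_eq_mul_left hr (by omega)

theorem det_main {d w r : ℕ} (hr : 0 < r) (h : r ∣ d ∨ r ∣ w) :
    |∑ σ : Equiv.Perm (Fin d), (Equiv.Perm.sign σ : ℝ) * ∏ i, ivr r ((w:ℤ) + σ i - i)| *
      ∏ p : Io d w r, (((w + (p.1.1 : ℕ) - p.1.2) / r : ℕ) : ℝ) = 1 := by
  obtain ⟨φ, v, hφ⟩ := good_perm d w r hr h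
  rw [det_good d w r hr φ v hφ, Io_prod d w r hr (fun q => (q : ℝ))]
  have e : ∀ i : Fin d, ∏ q ∈ Finset.Ioc ((i : ℕ) / r) ((w + (i : ℕ)) / r), (q : ℝ) =
      (((w + (i : ℕ)) / r).factorial : ℝ) / ((i : ℕ) / r).factorial := fun i =>
    prod_Ioc _ _ (Nat.div_le_div_right (by omega))
  simp only [e]
  rw [Finset.prod_div_distrib, Finset.prod_div_distrib,
    ← Equiv.prod_comp φ (fun i : Fin d => (((w + (i : ℕ)) / r).factorial : ℝ))]
  simp only [perm_div hr hφ]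
  have p1 : (∏ i : Fin d, (((i : ℕ) / r).factorial : ℝ)) ≠ 0 := Finset.prod_ne_zero_iff.2 fun i _ => by positivity
  have p2 : (∏ i : Fin d, ((v ((i : ℕ) % r) + (i : ℕ) / r).factorial : ℝ)) ≠ 0 := Finset.prod_ne_zero_iff.2 fun i _ => by positivity
  field_simp
end Wd

-- Part A1
namespace Bz

variable {σ : Type*} [Fintype σ] [DecidableEq σ]

/-- Number of exponent vectors of weighted degree at most t, as a finset. -/
def NF (u : σ → ℕ) (t : ℕ) : Finset (σ → ℕ) :=
  (Fintype.piFinset fun _ : σ => Finset.range (t+1)).filter (fun s => ∑ i, u i * s i ≤ t)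

theorem mem_NF {u : σ → ℕ} (hu : ∀ i, 0 < u i) {t : ℕ} {s : σ → ℕ} :
    s ∈ NF u t ↔ ∑ i, u i * s i ≤ t := by
  unfold NF
  simp only [Finset.mem_filter, Fintype.mem_piFinset, Finset.mem_range, and_iff_right_iff_imp]
  intro h i
  have h1 : u i * s i ≤ ∑ i, u i * s i :=
    Finset.single_le_sum (f := fun i => u i * s i) (fun _ _ => Nat.zero_le _) (Finset.mem_univ i)
  have h2 : s i ≤ u i * s i := Nat.le_mul_of_pos_left _ (hu i)
  omega

theorem NF_lower {u : σ → ℕ} (hu : ∀ i, 0 < u i) (t : ℕ) :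
    (NF (fun _ : σ => 1) t).card ≤ (∏ i, u i) * (NF u t).card := by
  have e : (∏ i, u i) * (NF u t).card =
      ((Fintype.piFinset fun i : σ => Finset.range (u i)) ×ˢ NF u t).card := by
    rw [Finset.card_product, Fintype.card_piFinset]; simp
  rw [e]
  apply Finset.card_le_card_of_injOn (fun s => (fun i => s i % u i, fun i => s i / u i))
  · intro s hs
    have hs' := (mem_NF (u := fun _ => 1) (by simp)).1 hs
    simp only [Finset.coe_product, Set.mem_prod, Finset.mem_coe, Fintype.mem_piFinset, Finset.mem_range]
    refine ⟨fun i => Nat.mod_lt _ (hu i), (mem_NF hu).2 ?_⟩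
    refine le_trans (Finset.sum_le_sum fun i _ => Nat.mul_div_le (s i) (u i)) ?_
    simpa using hs'
  · intro s _ s' _ h
    simp only [Prod.mk.injEq] at h
    funext i
    have h1 := congrFun h.1 i
    have h2 := congrFun h.2 i
    rw [← Nat.mod_add_div (s i) (u i), ← Nat.mod_add_div (s' i) (u i), h1, h2]

theorem NF_upper {u : σ → ℕ} (hu : ∀ i, 0 < u i) (t : ℕ) :
    (∏ i, u i) * (NF u t).card ≤ (NF (fun _ : σ => 1) (t + ∑ i, u i)).card := by
  have e : (∏ i, u i) * (NF u t).card =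
      ((Fintype.piFinset fun i : σ => Finset.range (u i)) ×ˢ NF u t).card := by
    rw [Finset.card_product, Fintype.card_piFinset]; simp
  rw [e]
  apply Finset.card_le_card_of_injOn (fun p => fun i => p.1 i + u i * p.2 i)
  · rintro ⟨a, s⟩ hs
    simp only [Finset.coe_product, Set.mem_prod, Finset.mem_coe, Fintype.mem_piFinset, Finset.mem_range] at hs
    refine (mem_NF (u := fun _ => 1) (by simp)).2 ?_
    have h1 := (mem_NF hu).1 hs.2
    simp only [one_mul, Finset.sum_add_distrib]
    have h2 : ∑ i, a i ≤ ∑ i, u i := Finset.sum_le_sum fun i _ => (hs.1 i).le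
    omega
  · rintro ⟨a, s⟩ hs ⟨a', s'⟩ hs' h
    simp only [Finset.coe_product, Set.mem_prod, Finset.mem_coe, Fintype.mem_piFinset, Finset.mem_range] at hs hs'
    simp only at h
    have h1 : ∀ i, a i = a' i := fun i => by
      have := congrArg (· % u i) (congrFun h i)
      simpa [Nat.mod_eq_of_lt (hs.1 i), Nat.mod_eq_of_lt (hs'.1 i)] using this
    have h2 : ∀ i, s i = s' i := fun i => by
      have := congrFun h i
      simp only [h1 i] at this
      have := Nat.add_left_cancel this
      exact Nat.eq_of_mul_eq_mul_left (hu i) this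
    simp only [Prod.mk.injEq]
    exact ⟨funext h1, funext h2⟩

theorem NF_poly (t : ℕ) : (NF (fun _ : σ => 1) t).card ≤ (t+1)^(Fintype.card σ) := by
  refine (Finset.card_filter_le _ _).trans ?_
  rw [Fintype.card_piFinset]; simp

theorem NF_pos (t : ℕ) : 0 < (NF (fun _ : σ => 1) t).card := by
  apply Finset.card_pos.2
  exact ⟨fun _ => 0, (mem_NF (by simp)).2 (by simp)⟩

theorem NF_congr {τ : Type*} [Fintype τ] [DecidableEq τ] (h : Fintype.card τ = Fintype.card σ) (t : ℕ) :
    (NF (fun _ : τ => 1) t).card = (NF (fun _ : σ => 1) t).card := by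
  have e := Fintype.equivOfCardEq h
  apply Finset.card_equiv (Equiv.arrowCongr e (Equiv.refl ℕ))
  intro s
  rw [mem_NF (by simp), mem_NF (by simp)]
  simp only [one_mul, Equiv.arrowCongr_apply, Equiv.coe_refl, Function.comp]
  rw [← Equiv.sum_comp e.symm]; simp

theorem growth (U : ℕ → ℕ) (ell : ℕ) (hU : ∀ t, U t ≤ (t+1)^ell) (hpos : ∀ t, 0 < U t)
    (P Q c : ℕ) (h : ∀ t, P * U t ≤ Q * U (t + c)) : P ≤ Q := by
  by_contra hlt
  push Not at hlt
  have hit : ∀ n, P^n * U 0 ≤ Q^n * U (n*c) := by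
    intro n
    induction n with
    | zero => simp
    | succ n ih =>
      calc P^(n+1) * U 0 = P * (P^n * U 0) := by ring
        _ ≤ P * (Q^n * U (n*c)) := Nat.mul_le_mul_left _ ih
        _ = Q^n * (P * U (n*c)) := by ring
        _ ≤ Q^n * (Q * U (n*c + c)) := Nat.mul_le_mul_left _ (h _)
        _ = Q^(n+1) * U ((n+1)*c) := by rw [add_mul, one_mul]; ring
  have hQ : 0 < Q := by
    rcases Nat.eq_zero_or_pos Q with h0 | h0
    · have := h 0
      subst h0
      have := hpos 0
      simp at *
      omega
    · exact h0
  have hb : ∀ n : ℕ, ((P:ℝ)/Q)^n ≤ ((n*c+1 : ℕ) : ℝ)^ell := by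
    intro n
    have h1 : P^n ≤ Q^n * (n*c+1)^ell := by
      calc P^n ≤ P^n * U 0 := Nat.le_mul_of_pos_right _ (hpos 0)
        _ ≤ _ := hit n
        _ ≤ _ := Nat.mul_le_mul_left _ (hU _)
    have h2 : (P:ℝ)^n ≤ (Q:ℝ)^n * ((n*c+1 : ℕ) : ℝ)^ell := by exact_mod_cast h1
    rw [div_pow, div_le_iff₀ (by positivity)]
    linarith
  have hr : 1 < (P:ℝ)/Q := by
    rw [one_lt_div (by positivity)]; exact_mod_cast hlt
  have ht := tendsto_pow_const_div_const_pow_of_one_lt ell hr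
  have hK : ∀ n : ℕ, 1 ≤ n → (1:ℝ)/((c+1:ℕ):ℝ)^ell ≤ (n:ℝ)^ell / ((P:ℝ)/Q)^n := by
    intro n hn
    rw [div_le_div_iff₀ (by positivity) (by positivity), one_mul]
    refine (hb n).trans ?_
    rw [← mul_pow]
    gcongr
    norm_cast
    nlinarith
  have := ge_of_tendsto ht (Filter.eventually_atTop.2 ⟨1, hK⟩)
  have h3 : (0:ℝ) < 1/((c+1:ℕ):ℝ)^ell := by positivity
  linarith

end Bz

-- Part A2
namespace Bz

variable {σ τ : Type} [Fintype σ] [DecidableEq σ] [Fintype τ] [DecidableEq τ]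

/-- Polynomials of weighted degree at most t. -/
noncomputable def WW (u : σ → ℕ) (t : ℕ) : Submodule ℂ (MvPolynomial σ ℂ) :=
  MvPolynomial.restrictSupport ℂ {s | Finsupp.weight u s ≤ t}

theorem mem_WW {u : σ → ℕ} {t : ℕ} {f : MvPolynomial σ ℂ} :
    f ∈ WW u t ↔ ∀ s ∈ f.support, Finsupp.weight u s ≤ t := by
  unfold WW
  rw [MvPolynomial.mem_restrictSupport_iff]; rfl

theorem WW_mono {u : σ → ℕ} {t t' : ℕ} (h : t ≤ t') : WW u t ≤ WW u t' :=
  MvPolynomial.restrictSupport_mono _ (fun _ hs => le_trans hs h)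

theorem WW_mul {u : σ → ℕ} {t t' : ℕ} {f g : MvPolynomial σ ℂ} (hf : f ∈ WW u t) (hg : g ∈ WW u t') :
    f * g ∈ WW u (t + t') := by
  have h := Submodule.mul_mem_mul hf hg
  unfold WW at h
  rw [← MvPolynomial.restrictSupport_add] at h
  refine MvPolynomial.restrictSupport_mono _ ?_ h
  rintro _ ⟨a, ha, b, hb, rfl⟩
  simp only [Set.mem_setOf_eq, map_add] at *
  omega

theorem WW_one {u : σ → ℕ} {t : ℕ} : (1 : MvPolynomial σ ℂ) ∈ WW u t := by
  rw [mem_WW]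
  intro s hs
  have : s = 0 := by
    by_contra h
    rw [MvPolynomial.mem_support_iff, MvPolynomial.coeff_one, if_neg (Ne.symm h)] at hs
    exact hs rfl
  subst this; simp

theorem WW_pow {u : σ → ℕ} {t : ℕ} {f : MvPolynomial σ ℂ} (hf : f ∈ WW u t) (k : ℕ) :
    f ^ k ∈ WW u (k * t) := by
  induction k with
  | zero => simpa using WW_one
  | succ k ih => rw [pow_succ, add_mul, one_mul]; exact WW_mul ih hf

theorem WW_prod {ι : Type*} {u : σ → ℕ} (s : Finset ι) {t : ι → ℕ} {f : ι → MvPolynomial σ ℂ}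
    (hf : ∀ i, f i ∈ WW u (t i)) : ∏ i ∈ s, f i ∈ WW u (∑ i ∈ s, t i) := by
  classical
  induction s using Finset.induction_on with
  | empty => simpa using WW_one
  | insert a s ha ih =>
    rw [Finset.prod_insert ha, Finset.sum_insert ha]
    exact WW_mul (hf a) ih

theorem exists_WW (u : σ → ℕ) (f : MvPolynomial σ ℂ) : ∃ c, f ∈ WW u c :=
  ⟨f.support.sup (Finsupp.weight u), mem_WW.2 fun s hs => Finset.le_sup (f := Finsupp.weight u) hs⟩

theorem WH_WW {u : σ → ℕ} {t : ℕ} {f : MvPolynomial σ ℂ}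
    (h : MvPolynomial.IsWeightedHomogeneous u f t) : f ∈ WW u t := by
  rw [mem_WW]
  intro s hs
  exact (h (MvPolynomial.mem_support_iff.1 hs)).le

theorem X_WW {u : σ → ℕ} (i : σ) : (MvPolynomial.X i : MvPolynomial σ ℂ) ∈ WW u (u i) :=
  WH_WW (MvPolynomial.isWeightedHomogeneous_X ℂ u i)

theorem WW_aeval {u : σ → ℕ} {e : τ → ℕ} {g : τ → MvPolynomial σ ℂ} (hg : ∀ j, g j ∈ WW u (e j))
    {t : ℕ} {a : MvPolynomial τ ℂ} (ha : a ∈ WW e t) : MvPolynomial.aeval g a ∈ WW u t := by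
  rw [MvPolynomial.aeval_def, MvPolynomial.eval₂_eq']
  refine Submodule.sum_mem _ fun s hs => ?_
  rw [← Algebra.smul_def]
  refine Submodule.smul_mem _ _ ?_
  refine WW_mono ?_ (WW_prod Finset.univ (fun i => WW_pow (hg i) (s i)))
  have := mem_WW.1 ha s hs
  rwa [Finsupp.weight_eq_sum] at this

theorem WW_finite {u : σ → ℕ} (hu : ∀ i, 0 < u i) (t : ℕ) :
    Module.Finite ℂ (WW u t) ∧ Module.finrank ℂ (WW u t) = (NF u t).card := by
  have e : {s : σ →₀ ℕ | Finsupp.weight u s ≤ t} ≃ NF u t :=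
    Equiv.subtypeEquiv Finsupp.equivFunOnFinite (fun s => by
      rw [mem_NF hu]
      simp only [Set.mem_setOf_eq, Finsupp.weight_eq_sum, smul_eq_mul, Finsupp.equivFunOnFinite_apply]
      simp only [mul_comm])
  haveI : Fintype {s : σ →₀ ℕ | Finsupp.weight u s ≤ t} := Fintype.ofEquiv _ e.symm
  have b := MvPolynomial.basisRestrictSupport ℂ {s : σ →₀ ℕ | Finsupp.weight u s ≤ t}
  refine ⟨Module.Finite.of_basis b, ?_⟩
  have := Module.finrank_eq_card_basis b
  unfold WW
  rw [this, Fintype.card_congr e, Fintype.card_coe]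

theorem comp_mul {u : σ → ℕ} {e m : ℕ} (g : MvPolynomial σ ℂ) (hg : MvPolynomial.IsWeightedHomogeneous u g e)
    (c : MvPolynomial σ ℂ) : MvPolynomial.weightedHomogeneousComponent u m (c * g) =
      if e ≤ m then MvPolynomial.weightedHomogeneousComponent u (m - e) c * g else 0 := by
  induction c using MvPolynomial.induction_on' with
  | monomial s r =>
    have h1 := MvPolynomial.isWeightedHomogeneous_monomial u s r rfl
    have h2 := h1.mul hg
    rw [MvPolynomial.weightedHomogeneousComponent_of_mem (h2),
      MvPolynomial.weightedHomogeneousComponent_of_mem (h1)]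
    split_ifs <;> first | rfl | omega | simp
  | add p q hp hq =>
    rw [add_mul, map_add, hp, hq, map_add]
    split_ifs <;> ring

theorem null_hom {u : σ → ℕ} {e : τ → ℕ} {g : τ → MvPolynomial σ ℂ}
    (hg : ∀ j, MvPolynomial.IsWeightedHomogeneous u (g j) (e j))
    (hz : ∀ y : σ → ℂ, (∀ j, MvPolynomial.eval y (g j) = 0) → y = 0) :
    ∃ k : ℕ, ∀ i, ∃ q : τ → MvPolynomial σ ℂ,
      (MvPolynomial.X i ^ k : MvPolynomial σ ℂ) = ∑ j, q j * g j ∧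
      ∀ j, q j = 0 ∨ (e j ≤ k * u i ∧ q j ∈ WW u (k * u i - e j)) := by
  have h1 : ∀ i, (MvPolynomial.X i : MvPolynomial σ ℂ) ∈ (Ideal.span (Set.range g)).radical := by
    intro i
    rw [← MvPolynomial.vanishingIdeal_zeroLocus_eq_radical (K := ℂ), MvPolynomial.mem_vanishingIdeal_iff]
    intro y hy
    rw [MvPolynomial.mem_zeroLocus_iff] at hy
    have : y = 0 := hz y fun j => by
      have := hy (g j) (Ideal.subset_span ⟨j, rfl⟩)
      simpa [MvPolynomial.aeval_eq_eval] using this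
    simp [this]
  choose kk hk using h1
  refine ⟨∑ i, kk i, fun i => ?_⟩
  set k := ∑ i, kk i with hkdef
  have hle : kk i ≤ k := Finset.single_le_sum (f := kk) (fun _ _ => Nat.zero_le _) (Finset.mem_univ i)
  have h2 : (MvPolynomial.X i ^ k : MvPolynomial σ ℂ) ∈ Ideal.span (Set.range g) :=
    Ideal.pow_mem_of_pow_mem _ (hk i) hle
  rw [Ideal.mem_span_range_iff_exists_fun] at h2
  obtain ⟨c, hc⟩ := h2
  refine ⟨fun j => if e j ≤ k * u i then MvPolynomial.weightedHomogeneousComponent u (k * u i - e j) (c j) else 0, ?_, ?_⟩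
  · have h3 : MvPolynomial.IsWeightedHomogeneous u (MvPolynomial.X i ^ k : MvPolynomial σ ℂ) (k * u i) := by
      have := (MvPolynomial.isWeightedHomogeneous_X ℂ u i).pow k
      simpa using this
    have h4 := congrArg (MvPolynomial.weightedHomogeneousComponent u (k * u i)) hc
    rw [h3.weightedHomogeneousComponent_same, map_sum] at h4
    rw [← h4]
    refine Finset.sum_congr rfl fun j _ => ?_
    rw [comp_mul _ (hg j)]
    by_cases hj : e j ≤ k * u i <;> simp [hj]
  · intro j
    by_cases h : e j ≤ k * u i
    · right
      refine ⟨h, ?_⟩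
      simp only [if_pos h]
      exact WH_WW (MvPolynomial.weightedHomogeneousComponent_isWeightedHomogeneous _ _)
    · left; simp [h]

/-- The span of low monomials with coefficients in the filtered subalgebra. -/
noncomputable def VV (e : τ → ℕ) (g : τ → MvPolynomial σ ℂ) (k t : ℕ) : Submodule ℂ (MvPolynomial σ ℂ) where
  carrier := {f | ∃ a : (σ → Fin k) → MvPolynomial τ ℂ, (∀ α, a α ∈ WW e t) ∧
    f = ∑ α, MvPolynomial.aeval g (a α) * ∏ i, MvPolynomial.X i ^ (α i : ℕ)}
  add_mem' := by
    rintro f f' ⟨a, ha, rfl⟩ ⟨a', ha', rfl⟩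
    refine ⟨a + a', fun α => Submodule.add_mem _ (ha α) (ha' α), ?_⟩
    simp [add_mul, Finset.sum_add_distrib]
  zero_mem' := ⟨0, fun α => Submodule.zero_mem _, by simp⟩
  smul_mem' := by
    rintro c f ⟨a, ha, rfl⟩
    refine ⟨c • a, fun α => Submodule.smul_mem _ _ (ha α), ?_⟩
    simp [Finset.smul_sum]

theorem VV_mul {e : τ → ℕ} {g : τ → MvPolynomial σ ℂ} {k t t' : ℕ} {f : MvPolynomial σ ℂ}
    (hf : f ∈ VV e g k t) {b : MvPolynomial τ ℂ} (hb : b ∈ WW e t') :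
    f * MvPolynomial.aeval g b ∈ VV e g k (t + t') := by
  obtain ⟨a, ha, rfl⟩ := hf
  refine ⟨fun α => a α * b, fun α => WW_mul (ha α) hb, ?_⟩
  rw [Finset.sum_mul]
  refine Finset.sum_congr rfl fun α _ => ?_
  rw [map_mul]; ring

theorem VV_mono {e : τ → ℕ} {g : τ → MvPolynomial σ ℂ} {k t t' : ℕ} (h : t ≤ t') :
    VV e g k t ≤ VV e g k t' := by
  rintro f ⟨a, ha, rfl⟩
  exact ⟨a, fun α => WW_mono h (ha α), rfl⟩

theorem VV_all {u : σ → ℕ} {e : τ → ℕ} {g : τ → MvPolynomial σ ℂ} (he : ∀ j, 0 < e j)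
    (hg : ∀ j, MvPolynomial.IsWeightedHomogeneous u (g j) (e j))
    (hz : ∀ y : σ → ℂ, (∀ j, MvPolynomial.eval y (g j) = 0) → y = 0) :
    ∃ k : ℕ, ∀ t, WW u t ≤ VV e g k t := by
  obtain ⟨k, hk⟩ := null_hom hg hz
  refine ⟨k, fun t => ?_⟩
  induction t using Nat.strong_induction_on with
  | _ t ih =>
  rw [WW, MvPolynomial.restrictSupport_eq_span, Submodule.span_le]
  rintro _ ⟨s, hs, rfl⟩
  simp only [Set.mem_setOf_eq] at hs
  by_cases hsk : ∀ i, s i < k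
  · refine ⟨fun α => if α = (fun i => ⟨s i, hsk i⟩) then 1 else 0, fun α => ?_, ?_⟩
    · simp only
      split_ifs
      · exact WW_one
      · exact Submodule.zero_mem _
    · rw [Finset.sum_eq_single (fun i => ⟨s i, hsk i⟩)]
      · simp [MvPolynomial.monomial_eq, Finsupp.prod_fintype]
      · intro α _ h; simp [h]
      · simp
  · push Not at hsk
    obtain ⟨i, hi⟩ := hsk
    obtain ⟨q, hq1, hq2⟩ := hk i
    have h1 : (MvPolynomial.monomial s (1:ℂ)) =
        MvPolynomial.monomial (s - Finsupp.single i k) 1 * MvPolynomial.X i ^ k := by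
      rw [MvPolynomial.X_pow_eq_monomial, MvPolynomial.monomial_mul, one_mul,
        tsub_add_cancel_of_le (by simpa using hi)]
    have hw : Finsupp.weight u (s - Finsupp.single i k) + k * u i = Finsupp.weight u s := by
      have : s - Finsupp.single i k + Finsupp.single i k = s := tsub_add_cancel_of_le (by simpa using hi)
      conv_rhs => rw [← this]
      rw [map_add, Finsupp.weight_single, smul_eq_mul]
    show MvPolynomial.monomial s (1:ℂ) ∈ _
    rw [h1, hq1, Finset.mul_sum]
    refine Submodule.sum_mem _ fun j _ => ?_
    rcases hq2 j with h0 | ⟨h2, h3⟩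
    · simp [h0]
    · have h4 : MvPolynomial.monomial (s - Finsupp.single i k) 1 * q j ∈ WW u (t - e j) := by
        refine WW_mono ?_ (WW_mul (WH_WW (MvPolynomial.isWeightedHomogeneous_monomial u _ (1:ℂ) rfl)) h3)
        omega
      have hej := he j
      have h5 := VV_mul (ih (t - e j) (by omega) h4) (X_WW (u := e) j)
      rw [MvPolynomial.aeval_X, Nat.sub_add_cancel (by omega)] at h5
      rw [← mul_assoc]; exact h5

end Bz

-- Part A3
namespace Bz

theorem clear_den (A : Type*) [CommRing A] [IsDomain A] (p : Polynomial (FractionRing A)) :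
    ∃ a : A, a ≠ 0 ∧ ∃ q : Polynomial A, q.map (algebraMap A (FractionRing A)) =
      Polynomial.C (algebraMap A (FractionRing A) a) * p := by
  obtain ⟨b, hb, h⟩ := IsLocalization.integerNormalization_spec (nonZeroDivisors A) p
  refine ⟨b, nonZeroDivisors.ne_zero hb, _, h.trans ?_⟩
  rw [Algebra.smul_def]; rfl

theorem primitive (A B : Type*) [CommRing A] [IsDomain A] [IsIntegrallyClosed A] [CharZero A]
    [CommRing B] [IsDomain B] [Algebra A B] [Module.Finite A B] [FaithfulSMul A B] :
    ∃ b : B, (∃ a : A, a ≠ 0 ∧ ∀ f : B, ∃ q : Polynomial A, algebraMap A B a * f = Polynomial.aeval b q) ∧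
      (∃ a : A, a ≠ 0 ∧ ∃ U V : Polynomial A, minpoly A b * U + derivative (minpoly A b) * V = Polynomial.C a) := by
  let K := FractionRing A
  let L := FractionRing B
  letI : Algebra K L := FractionRing.liftAlgebra A L
  haveI : IsScalarTower A K L := FractionRing.isScalarTower_liftAlgebra A L
  have : Algebra.IsAlgebraic A B := inferInstance
  haveI : IsLocalization (Algebra.algebraMapSubmonoid B (nonZeroDivisors A)) L := inferInstance
  haveI : FiniteDimensional K L := .of_isLocalization A B (nonZeroDivisors A)
  haveI : CharZero K := charZero_of_injective_algebraMap (IsFractionRing.injective A K)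
  have hAK := IsFractionRing.injective A K
  have hBL := IsFractionRing.injective B L
  obtain ⟨β, hβ⟩ := Field.exists_primitive_element K L
  obtain ⟨⟨b, ⟨_, ⟨a, ha, rfl⟩⟩⟩, hab⟩ := IsLocalization.surj (Algebra.algebraMapSubmonoid B (nonZeroDivisors A)) β
  have ha0 : a ≠ 0 := nonZeroDivisors.ne_zero ha
  simp only at hab
  have hbint : IsIntegral A b := Algebra.IsIntegral.isIntegral b
  have hscal : ∀ x : A, algebraMap B L (algebraMap A B x) = algebraMap K L (algebraMap A K x) := by
    intro x
    rw [← IsScalarTower.algebraMap_apply A B L, ← IsScalarTower.algebraMap_apply A K L]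
  have htop : ∀ x : L, ∃ p : Polynomial K, Polynomial.aeval (algebraMap B L b) p = x := by
    intro x
    have h1 : x ∈ (IntermediateField.adjoin K {β}).toSubalgebra := by
      rw [hβ]; trivial
    rw [IntermediateField.adjoin_simple_toSubalgebra_of_isAlgebraic (Algebra.IsAlgebraic.isAlgebraic β),
      Algebra.adjoin_singleton_eq_range_aeval] at h1
    obtain ⟨p, rfl⟩ := h1
    have hne : algebraMap A K a ≠ 0 := fun h => ha0 (hAK (by simpa using h))
    refine ⟨p.comp (Polynomial.C (algebraMap A K a)⁻¹ * Polynomial.X), ?_⟩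
    rw [Polynomial.aeval_comp]
    simp only [map_mul, Polynomial.aeval_C, Polynomial.aeval_X]
    have : algebraMap K L (algebraMap A K a)⁻¹ * algebraMap B L b = β := by
      rw [← hab, hscal, map_inv₀, mul_comm β, ← mul_assoc, inv_mul_cancel₀, one_mul]
      simpa using hne
    rw [this]; rfl
  have hev : ∀ q : Polynomial A, algebraMap B L (Polynomial.aeval b q) =
      Polynomial.aeval (algebraMap B L b) (q.map (algebraMap A K)) := by
    intro q
    rw [Polynomial.aeval_map_algebraMap, Polynomial.aeval_algebraMap_apply]
  have hone : ∀ f : B, ∃ a : A, a ≠ 0 ∧ ∃ q : Polynomial A, algebraMap A B a * f = Polynomial.aeval b q := by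
    intro f
    obtain ⟨p, hp⟩ := htop (algebraMap B L f)
    obtain ⟨c, hc, q, hq⟩ := clear_den A p
    refine ⟨c, hc, q, hBL ?_⟩
    rw [hev, hq, map_mul, map_mul, hp, Polynomial.aeval_C, hscal]
  refine ⟨b, ?_, ?_⟩
  · obtain ⟨n, s, hs⟩ := Module.Finite.exists_fin (R := A) (M := B)
    choose c hc q hq using fun i => hone (s i)
    refine ⟨∏ i, c i, Finset.prod_ne_zero_iff.2 fun i _ => hc i, fun f => ?_⟩
    have hf : f ∈ Submodule.span A (Set.range s) := by rw [hs]; trivial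
    induction hf using Submodule.span_induction with
    | mem x hx =>
      obtain ⟨i, rfl⟩ := hx
      refine ⟨Polynomial.C (∏ j ∈ Finset.univ.erase i, c j) * q i, ?_⟩
      rw [map_mul, ← hq i, Polynomial.aeval_C, ← Finset.mul_prod_erase _ _ (Finset.mem_univ i), map_mul]
      ring
    | zero => exact ⟨0, by simp⟩
    | add x y _ _ hx hy =>
      obtain ⟨p, hp⟩ := hx
      obtain ⟨p', hp'⟩ := hy
      exact ⟨p + p', by rw [mul_add, hp, hp', map_add]⟩
    | smul r x _ hx =>
      obtain ⟨p, hp⟩ := hx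
      refine ⟨r • p, ?_⟩
      rw [map_smul, ← hp, Algebra.smul_def, Algebra.smul_def]; ring
  · have hm := minpoly.isIntegrallyClosed_eq_field_fractions K L hbint
    have hsep : (minpoly K (algebraMap B L b)).Separable :=
      Algebra.IsSeparable.isSeparable K (algebraMap B L b)
    rw [hm] at hsep
    obtain ⟨u, v, huv⟩ := hsep
    obtain ⟨a1, ha1, U, hU⟩ := clear_den A u
    obtain ⟨a2, ha2, V, hV⟩ := clear_den A v
    refine ⟨a1 * a2, mul_ne_zero ha1 ha2, Polynomial.C a2 * U, Polynomial.C a1 * V, ?_⟩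
    have hU' : U.map (algebraMap A K) = Polynomial.C (algebraMap A K a1) * u := hU
    have hV' : V.map (algebraMap A K) = Polynomial.C (algebraMap A K a2) * v := hV
    apply Polynomial.map_injective _ hAK
    rw [Polynomial.derivative_map] at huv
    simp only [Polynomial.map_add, Polynomial.map_mul, Polynomial.map_C, hU', hV', map_mul]
    linear_combination (Polynomial.C (algebraMap A K a1) * Polynomial.C (algebraMap A K a2)) * huv

end Bz

-- Part A4
namespace Bz

variable {σ τ : Type} [Fintype σ] [DecidableEq σ] [Fintype τ] [DecidableEq τ]

theorem fibre_count [Algebra (MvPolynomial τ ℂ) (MvPolynomial σ ℂ)]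
    [Module.Finite (MvPolynomial τ ℂ) (MvPolynomial σ ℂ)] [FaithfulSMul (MvPolynomial τ ℂ) (MvPolynomial σ ℂ)]
    (g : τ → MvPolynomial σ ℂ)
    (hg : ∀ a, algebraMap (MvPolynomial τ ℂ) (MvPolynomial σ ℂ) a = MvPolynomial.aeval g a)
    (b : MvPolynomial σ ℂ)
    (a2 : MvPolynomial τ ℂ) (ha2 : ∀ f : MvPolynomial σ ℂ, ∃ q : Polynomial (MvPolynomial τ ℂ),
      algebraMap (MvPolynomial τ ℂ) (MvPolynomial σ ℂ) a2 * f = Polynomial.aeval b q)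
    (a1 : MvPolynomial τ ℂ) (U V : Polynomial (MvPolynomial τ ℂ))
    (huv : minpoly (MvPolynomial τ ℂ) b * U + derivative (minpoly (MvPolynomial τ ℂ) b) * V = Polynomial.C a1)
    (p : τ → ℂ) (h1 : MvPolynomial.eval p a1 ≠ 0) (h2 : MvPolynomial.eval p a2 ≠ 0) :
    Set.ncard {y : σ → ℂ | ∀ j, MvPolynomial.eval y (g j) = p j} =
      (minpoly (MvPolynomial τ ℂ) b).natDegree := by
  have hbint : IsIntegral (MvPolynomial τ ℂ) b := Algebra.IsIntegral.isIntegral b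
  set m := minpoly (MvPolynomial τ ℂ) b with hm
  have hmon : m.Monic := minpoly.monic hbint
  set mp := m.map (MvPolynomial.eval p) with hmp
  have hmpmon : mp.Monic := hmon.map _
  have hdeg : mp.natDegree = m.natDegree := hmon.natDegree_map _
  have hsep : mp.Separable := by
    have := congrArg (Polynomial.map (MvPolynomial.eval p)) huv
    simp only [Polynomial.map_add, Polynomial.map_mul, Polynomial.map_C, ← Polynomial.derivative_map] at this
    refine ⟨Polynomial.C (MvPolynomial.eval p a1)⁻¹ * U.map (MvPolynomial.eval p),
      Polynomial.C (MvPolynomial.eval p a1)⁻¹ * V.map (MvPolynomial.eval p), ?_⟩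
    have h3 : Polynomial.C (MvPolynomial.eval p a1)⁻¹ * Polynomial.C (MvPolynomial.eval p a1) = 1 := by
      rw [← Polynomial.C_mul, inv_mul_cancel₀ h1, Polynomial.C_1]
    rw [← h3, ← this]; ring
  have hcard : mp.roots.toFinset.card = m.natDegree := by
    rw [Multiset.toFinset_card_of_nodup (Polynomial.nodup_roots hsep), ← hdeg]
    exact (IsAlgClosed.splits mp).natDegree_eq_card_roots.symm
  have heva : ∀ y : σ → ℂ, (∀ j, MvPolynomial.eval y (g j) = p j) → ∀ a : (MvPolynomial τ ℂ),
      MvPolynomial.eval y (algebraMap (MvPolynomial τ ℂ) (MvPolynomial σ ℂ) a) = MvPolynomial.eval p a := by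
    intro y hy a
    rw [hg]
    have : (MvPolynomial.aeval y).comp (MvPolynomial.aeval g) = (MvPolynomial.aeval p : (MvPolynomial τ ℂ) →ₐ[ℂ] ℂ) := by
      apply MvPolynomial.algHom_ext
      intro j
      simpa [MvPolynomial.aeval_eq_eval] using hy j
    have := DFunLike.congr_fun this a
    simpa [MvPolynomial.aeval_eq_eval] using this
  have hkey : ∀ y : σ → ℂ, (∀ j, MvPolynomial.eval y (g j) = p j) → ∀ q : Polynomial (MvPolynomial τ ℂ),
      MvPolynomial.eval y (Polynomial.aeval b q) = (q.map (MvPolynomial.eval p)).eval (MvPolynomial.eval y b) := by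
    intro y hy q
    rw [Polynomial.aeval_def, Polynomial.hom_eval₂, Polynomial.eval_map]
    congr 1
    ext a
    all_goals simp [heva y hy]
  have himg : (fun y : σ → ℂ => MvPolynomial.eval y b) '' {y : σ → ℂ | ∀ j, MvPolynomial.eval y (g j) = p j} =
      (mp.roots.toFinset : Set ℂ) := by
    ext z
    simp only [Set.mem_image, Finset.mem_coe, Multiset.mem_toFinset, Polynomial.mem_roots hmpmon.ne_zero,
      Polynomial.IsRoot.def]
    constructor
    · rintro ⟨y, hy, rfl⟩
      rw [hmp, ← hkey y hy, hm, minpoly.aeval, map_zero]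
    · intro hz
      let ev : Polynomial (MvPolynomial τ ℂ) →+* ℂ := Polynomial.eval₂RingHom (MvPolynomial.eval p) z
      have hevs : Function.Surjective ev := fun w => ⟨Polynomial.C (MvPolynomial.C w), by simp [ev]⟩
      letI : Algebra (Polynomial (MvPolynomial τ ℂ)) (MvPolynomial σ ℂ) := (Polynomial.aeval b : Polynomial (MvPolynomial τ ℂ) →ₐ[(MvPolynomial τ ℂ)] (MvPolynomial σ ℂ)).toRingHom.toAlgebra
      have hal : ∀ q : Polynomial (MvPolynomial τ ℂ), algebraMap (Polynomial (MvPolynomial τ ℂ)) (MvPolynomial σ ℂ) q = Polynomial.aeval b q := fun q => rfl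
      haveI : IsScalarTower (MvPolynomial τ ℂ) (Polynomial (MvPolynomial τ ℂ)) (MvPolynomial σ ℂ) := IsScalarTower.of_algebraMap_eq fun a => by
        rw [hal]; simp
      haveI : Algebra.IsIntegral (Polynomial (MvPolynomial τ ℂ)) (MvPolynomial σ ℂ) := Algebra.IsIntegral.tower_top (MvPolynomial τ ℂ)
      haveI hmax : (RingHom.ker ev).IsMaximal := RingHom.ker_isMaximal_of_surjective ev hevs
      obtain ⟨Q, -, hQp, hQ⟩ := Ideal.exists_ideal_over_prime_of_isIntegral (S := (MvPolynomial σ ℂ)) (RingHom.ker ev) ⊥ (by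
        intro q hq
        rw [Ideal.mem_comap, Ideal.mem_bot, hal] at hq
        obtain ⟨q', rfl⟩ := minpoly.isIntegrallyClosed_dvd hbint hq
        rw [RingHom.mem_ker, map_mul]
        have : ev m = 0 := by
          rw [← hz, hmp, Polynomial.eval_map]; rfl
        rw [this, zero_mul])
      have hQm : Q.IsMaximal := Ideal.isMaximal_of_isIntegral_of_isMaximal_comap Q (by rw [hQ]; exact hmax)
      obtain ⟨y, hy⟩ := MvPolynomial.isMaximal_iff_eq_vanishingIdeal_singleton.1 hQm
      have hmem : ∀ q : Polynomial (MvPolynomial τ ℂ), ev q = 0 → MvPolynomial.eval y (Polynomial.aeval b q) = 0 := by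
        intro q hq
        have h5 : q ∈ Q.comap (algebraMap (Polynomial (MvPolynomial τ ℂ)) (MvPolynomial σ ℂ)) := by rw [hQ]; exact hq
        rw [Ideal.mem_comap, hal, hy, MvPolynomial.mem_vanishingIdeal_singleton_iff] at h5
        simpa [MvPolynomial.aeval_eq_eval] using h5
      refine ⟨y, fun j => ?_, ?_⟩
      · have := hmem (Polynomial.C (MvPolynomial.X j - MvPolynomial.C (p j))) (by simp [ev])
        rw [Polynomial.aeval_C, hg] at this
        simpa [sub_eq_zero] using this
      · have := hmem (Polynomial.X - Polynomial.C (MvPolynomial.C z)) (by simp [ev])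
        rw [map_sub, Polynomial.aeval_C, hg] at this
        simpa [sub_eq_zero] using this
  rw [← hcard, ← Set.ncard_coe_finset, ← himg]
  symm
  apply Set.ncard_image_of_injOn
  intro y hy y' hy' hyy
  funext i
  obtain ⟨q, hq⟩ := ha2 (MvPolynomial.X i)
  have e1 := congrArg (MvPolynomial.eval y) hq
  have e2 := congrArg (MvPolynomial.eval y') hq
  rw [hkey y hy, map_mul, heva y hy, MvPolynomial.eval_X] at e1
  rw [hkey y' hy', map_mul, heva y' hy', MvPolynomial.eval_X] at e2
  simp only at hyy
  rw [hyy, ← e2] at e1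
  exact mul_left_cancel₀ h2 e1

end Bz

-- Part A5
namespace Bz

variable {σ τ : Type} [Fintype σ] [DecidableEq σ] [Fintype τ] [DecidableEq τ]

theorem inj_of_integral (hcard : Fintype.card τ = Fintype.card σ) (g : τ → MvPolynomial σ ℂ)
    (hIntg : ∀ f : MvPolynomial σ ℂ, ∃ q : Polynomial (MvPolynomial τ ℂ), q.Monic ∧
      q.eval₂ (MvPolynomial.aeval g : MvPolynomial τ ℂ →ₐ[ℂ] MvPolynomial σ ℂ).toRingHom f = 0) :
    Function.Injective (MvPolynomial.aeval g : MvPolynomial τ ℂ →ₐ[ℂ] MvPolynomial σ ℂ) := by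
  have hr : ∀ a : MvPolynomial τ ℂ, MvPolynomial.aeval g a ∈ Algebra.adjoin ℂ (Set.range g) := by
    intro a
    rw [Algebra.adjoin_range_eq_range_aeval]
    exact ⟨a, rfl⟩
  have : Algebra.IsAlgebraic (Algebra.adjoin ℂ (Set.range g)) (MvPolynomial σ ℂ) := by
    haveI : Algebra.IsIntegral (Algebra.adjoin ℂ (Set.range g)) (MvPolynomial σ ℂ) := by
      constructor
      intro f
      obtain ⟨q, hq, hq0⟩ := hIntg f
      refine ⟨q.map ((MvPolynomial.aeval g : MvPolynomial τ ℂ →ₐ[ℂ] MvPolynomial σ ℂ).codRestrict _ hr).toRingHom,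
        hq.map _, ?_⟩
      rw [Polynomial.eval₂_map, ← hq0]
      rfl
    infer_instance
  have h := Algebra.IsAlgebraic.isTranscendenceBasis_of_le_trdeg_of_finite ℂ g (by
    rw [MvPolynomial.trdeg_of_isDomain]
    simp [hcard])
  exact h.1

/-- The map (a_k) ↦ Σ g^*(a_k) b^k. -/
noncomputable def LL (g : τ → MvPolynomial σ ℂ) (b : MvPolynomial σ ℂ) (D : ℕ) :
    (Fin D → MvPolynomial τ ℂ) →ₗ[ℂ] MvPolynomial σ ℂ :=
  ∑ k : Fin D, (LinearMap.mulRight ℂ (b ^ (k:ℕ))) ∘ₗ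
    (MvPolynomial.aeval g : MvPolynomial τ ℂ →ₐ[ℂ] MvPolynomial σ ℂ).toLinearMap ∘ₗ LinearMap.proj k

theorem LL_apply (g : τ → MvPolynomial σ ℂ) (b : MvPolynomial σ ℂ) (D : ℕ) (a : Fin D → MvPolynomial τ ℂ) :
    LL g b D a = ∑ k, MvPolynomial.aeval g (a k) * b ^ (k:ℕ) := by
  simp [LL]

theorem deg_upper {u : σ → ℕ} {e : τ → ℕ} (hu : ∀ i, 0 < u i) (he : ∀ j, 0 < e j)
    {g : τ → MvPolynomial σ ℂ} (hg : ∀ j, g j ∈ WW u (e j)) (b : MvPolynomial σ ℂ) (D : ℕ)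
    (hinj : Function.Injective (LL g b D)) :
    ∃ c, ∀ t, D * (NF e t).card ≤ (NF u (t + c)).card := by
  obtain ⟨c0, hc0⟩ := exists_WW u b
  refine ⟨D * c0, fun t => ?_⟩
  rw [← (WW_finite hu _).2, ← (WW_finite he _).2]
  haveI := (WW_finite hu (t + D * c0)).1
  haveI := (WW_finite he t).1
  let M : (Fin D → WW e t) →ₗ[ℂ] MvPolynomial σ ℂ := LL g b D ∘ₗ (WW e t).subtype.compLeft (Fin D)
  have hM : ∀ x, M x ∈ WW u (t + D * c0) := by
    intro x
    show LL g b D (fun k => (x k : MvPolynomial τ ℂ)) ∈ _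
    rw [LL_apply]
    refine Submodule.sum_mem _ fun k _ => ?_
    refine WW_mono ?_ (WW_mul (WW_aeval hg (x k).2) (WW_pow hc0 k))
    gcongr
    exact k.2.le
  have h := LinearMap.finrank_le_finrank_of_injective (f := M.codRestrict _ hM) (by
    intro x y hxy
    have h1 : LL g b D (fun k => (x k : MvPolynomial τ ℂ)) = LL g b D (fun k => (y k : MvPolynomial τ ℂ)) :=
      congrArg Subtype.val hxy
    have h2 := hinj h1
    funext k
    exact Subtype.ext (congrFun h2 k))
  rw [Module.finrank_pi_fintype] at h
  simpa using h

theorem deg_lower {u : σ → ℕ} {e : τ → ℕ} (hu : ∀ i, 0 < u i) (he : ∀ j, 0 < e j)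
    {g : τ → MvPolynomial σ ℂ} (k : ℕ) (hk : ∀ t, WW u t ≤ VV e g k t) (b : MvPolynomial σ ℂ) (D : ℕ)
    (a2 : MvPolynomial τ ℂ) (ha2 : MvPolynomial.aeval g a2 ≠ 0)
    (hb : ∀ f : MvPolynomial σ ℂ, ∃ c, MvPolynomial.aeval g a2 * f = LL g b D c) :
    ∃ c, ∀ t, (NF u t).card ≤ D * (NF e (t + c)).card := by
  choose cc hcc using fun α : σ → Fin k => hb (∏ i, MvPolynomial.X i ^ (α i : ℕ))
  choose dd hdd using fun (α : σ → Fin k) (i : Fin D) => exists_WW e (cc α i)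
  refine ⟨∑ α, ∑ i, dd α i, fun t => ?_⟩
  set c := ∑ α, ∑ i, dd α i with hc
  have hdc : ∀ α i, dd α i ≤ c := fun α i =>
    (Finset.single_le_sum (f := fun i => dd α i) (fun _ _ => Nat.zero_le _) (Finset.mem_univ i)).trans
      (Finset.single_le_sum (f := fun α => ∑ i, dd α i) (fun _ _ => Nat.zero_le _) (Finset.mem_univ α))
  rw [← (WW_finite hu _).2, ← (WW_finite he _).2]
  haveI := (WW_finite hu t).1
  haveI := (WW_finite he (t + c)).1
  let M : (Fin D → WW e (t + c)) →ₗ[ℂ] MvPolynomial σ ℂ := LL g b D ∘ₗ (WW e (t + c)).subtype.compLeft (Fin D)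
  have hr := LinearMap.finrank_range_le M
  rw [Module.finrank_pi_fintype] at hr
  simp only [Finset.sum_const, Finset.card_univ, Fintype.card_fin, smul_eq_mul] at hr
  refine le_trans ?_ hr
  let S : WW u t →ₗ[ℂ] MvPolynomial σ ℂ := LinearMap.mulLeft ℂ (MvPolynomial.aeval g a2) ∘ₗ (WW u t).subtype
  have hS : ∀ x, S x ∈ LinearMap.range M := by
    rintro ⟨f, hf⟩
    obtain ⟨a, ha, hfa⟩ := hk t hf
    refine ⟨fun i => ⟨∑ α, a α * cc α i, Submodule.sum_mem _ fun α _ =>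
      WW_mono (Nat.add_le_add_left (hdc α i) t) (WW_mul (ha α) (hdd α i))⟩, ?_⟩
    show LL g b D (fun i => ∑ α, a α * cc α i) = MvPolynomial.aeval g a2 * f
    rw [hfa, LL_apply, Finset.mul_sum]
    simp only [map_sum, Finset.sum_mul]
    rw [Finset.sum_comm]
    refine Finset.sum_congr rfl fun α _ => ?_
    rw [mul_left_comm, hcc α, LL_apply, Finset.mul_sum]
    refine Finset.sum_congr rfl fun i _ => ?_
    rw [map_mul, mul_assoc]
  apply LinearMap.finrank_le_finrank_of_injective (f := S.codRestrict _ hS)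
  intro x y hxy
  have h1 : MvPolynomial.aeval g a2 * (x : MvPolynomial σ ℂ) = MvPolynomial.aeval g a2 * y :=
    congrArg Subtype.val hxy
  exact Subtype.ext (mul_left_cancel₀ ha2 h1)

/-- Weighted Bezout theorem. -/
theorem bezout (hcard : Fintype.card τ = Fintype.card σ) (u : σ → ℕ) (e : τ → ℕ)
    (hu : ∀ i, 0 < u i) (he : ∀ j, 0 < e j) (g : τ → MvPolynomial σ ℂ)
    (hg : ∀ j, MvPolynomial.IsWeightedHomogeneous u (g j) (e j))
    (hz : ∀ y : σ → ℂ, (∀ j, MvPolynomial.eval y (g j) = 0) → y = 0) :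
    ∃ Q : MvPolynomial τ ℂ, Q ≠ 0 ∧ ∀ p : τ → ℂ, MvPolynomial.eval p Q ≠ 0 →
      Set.ncard {y : σ → ℂ | ∀ j, MvPolynomial.eval y (g j) = p j} * ∏ i, u i = ∏ j, e j := by
  obtain ⟨k, hk⟩ := VV_all he hg hz
  letI : Algebra (MvPolynomial τ ℂ) (MvPolynomial σ ℂ) :=
    (MvPolynomial.aeval g : MvPolynomial τ ℂ →ₐ[ℂ] MvPolynomial σ ℂ).toRingHom.toAlgebra
  have hal : ∀ a, algebraMap (MvPolynomial τ ℂ) (MvPolynomial σ ℂ) a = MvPolynomial.aeval g a := fun a => rfl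
  haveI : Module.Finite (MvPolynomial τ ℂ) (MvPolynomial σ ℂ) := by
    refine Module.Finite.of_surjective (M := (σ → Fin k) → MvPolynomial τ ℂ)
      (∑ α : σ → Fin k, (LinearMap.toSpanSingleton (MvPolynomial τ ℂ) (MvPolynomial σ ℂ)
        (∏ i, MvPolynomial.X i ^ (α i : ℕ))) ∘ₗ LinearMap.proj α) ?_
    intro f
    obtain ⟨t, ht⟩ := exists_WW u f
    obtain ⟨a, -, ha⟩ := hk t ht
    refine ⟨a, ?_⟩
    rw [ha]
    simp only [LinearMap.sum_apply, LinearMap.comp_apply, LinearMap.proj_apply, LinearMap.toSpanSingleton_apply,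
      Algebra.smul_def, hal]
  have hinj : Function.Injective (MvPolynomial.aeval g : MvPolynomial τ ℂ →ₐ[ℂ] MvPolynomial σ ℂ) :=
    inj_of_integral hcard g fun f => by
      obtain ⟨q, hq, hq0⟩ := (Algebra.IsIntegral.isIntegral (R := MvPolynomial τ ℂ) f)
      exact ⟨q, hq, hq0⟩
  haveI : FaithfulSMul (MvPolynomial τ ℂ) (MvPolynomial σ ℂ) :=
    (faithfulSMul_iff_algebraMap_injective _ _).2 hinj
  obtain ⟨b, ⟨a2, ha2, hb2⟩, ⟨a1, ha1, U, V, huv⟩⟩ := primitive (MvPolynomial τ ℂ) (MvPolynomial σ ℂ)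
  refine ⟨a1 * a2, mul_ne_zero ha1 ha2, fun p hp => ?_⟩
  rw [map_mul] at hp
  rw [fibre_count g hal b a2 hb2 a1 U V huv p (left_ne_zero_of_mul hp) (right_ne_zero_of_mul hp)]
  have hbint : IsIntegral (MvPolynomial τ ℂ) b := Algebra.IsIntegral.isIntegral b
  set m := minpoly (MvPolynomial τ ℂ) b with hm
  have hmon : m.Monic := minpoly.monic hbint
  set D := m.natDegree with hD
  have hLL : ∀ c, LL g b D c = Polynomial.aeval b (∑ k : Fin D, Polynomial.C (c k) * Polynomial.X ^ (k:ℕ)) := by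
    intro c
    rw [LL_apply]
    simp only [map_sum, map_mul, Polynomial.aeval_C, map_pow, Polynomial.aeval_X, hal]
  have hLLinj : Function.Injective (LL g b D) := by
    rw [← LinearMap.ker_eq_bot, LinearMap.ker_eq_bot']
    intro c hc
    rw [hLL] at hc
    have hdvd := minpoly.isIntegrallyClosed_dvd hbint hc
    have hlt : (∑ k : Fin D, Polynomial.C (c k) * Polynomial.X ^ (k:ℕ)).degree < m.degree := by
      rw [Polynomial.degree_eq_natDegree hmon.ne_zero]
      exact Polynomial.degree_sum_fin_lt _
    have h0 := Polynomial.eq_zero_of_dvd_of_degree_lt hdvd hlt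
    funext k
    have := congrArg (fun q => Polynomial.coeff q (k:ℕ)) h0
    simpa [Polynomial.finsetSum_coeff, Polynomial.coeff_X_pow, ← Fin.ext_iff] using this
  obtain ⟨c1, hc1⟩ := deg_upper hu he (fun j => WH_WW (hg j)) b D hLLinj
  obtain ⟨c2, hc2⟩ := deg_lower hu he k hk b D a2 (fun h => ha2 (hinj (by simpa using h))) (by
    intro f
    obtain ⟨q, hq⟩ := hb2 f
    refine ⟨fun k => (q %ₘ m).coeff k, ?_⟩
    rw [hLL, ← hal, hq]
    have h1 : Polynomial.aeval b q = Polynomial.aeval b (q %ₘ m) := by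
      conv_lhs => rw [← Polynomial.modByMonic_add_div q m]
      rw [map_add, map_mul, hm, minpoly.aeval, zero_mul, add_zero]
    rw [h1]
    congr 1
    have hD0 : m ≠ 1 := by
      rw [hm]; exact minpoly.ne_one _ _
    have h2 := Polynomial.as_sum_range_C_mul_X_pow' (n := D) (q %ₘ m)
      (Polynomial.natDegree_modByMonic_lt q hmon hD0)
    rw [Finset.sum_range] at h2
    exact h2)
  set Uf := fun t => (NF (fun _ : σ => 1) t).card with hUf
  have hUe : ∀ t, (NF (fun _ : τ => 1) t).card = Uf t := fun t => NF_congr hcard t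
  apply le_antisymm
  · refine growth Uf _ NF_poly NF_pos _ _ (c1 + ∑ i, u i) fun t => ?_
    have i1 := NF_lower he t
    rw [hUe] at i1
    have i2 := NF_upper hu (t + c1)
    calc D * (∏ i, u i) * Uf t ≤ D * (∏ i, u i) * ((∏ j, e j) * (NF e t).card) := Nat.mul_le_mul_left _ i1
      _ = (∏ i, u i) * (∏ j, e j) * (D * (NF e t).card) := by ring
      _ ≤ (∏ i, u i) * (∏ j, e j) * (NF u (t + c1)).card := Nat.mul_le_mul_left _ (hc1 t)
      _ = (∏ j, e j) * ((∏ i, u i) * (NF u (t + c1)).card) := by ring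
      _ ≤ (∏ j, e j) * Uf (t + (c1 + ∑ i, u i)) := by
        rw [← add_assoc]; exact Nat.mul_le_mul_left _ i2
  · refine growth Uf _ NF_poly NF_pos _ _ (c2 + ∑ j, e j) fun t => ?_
    have i1 := NF_lower hu t
    have i2 := NF_upper he (t + c2)
    rw [hUe] at i2
    calc (∏ j, e j) * Uf t ≤ (∏ j, e j) * ((∏ i, u i) * (NF u t).card) := Nat.mul_le_mul_left _ i1
      _ = (∏ i, u i) * (∏ j, e j) * (NF u t).card := by ring
      _ ≤ (∏ i, u i) * (∏ j, e j) * (D * (NF e (t + c2)).card) := Nat.mul_le_mul_left _ (hc2 t)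
      _ = D * (∏ i, u i) * ((∏ j, e j) * (NF e (t + c2)).card) := by ring
      _ ≤ D * (∏ i, u i) * Uf (t + (c2 + ∑ j, e j)) := by
        rw [← add_assoc]; exact Nat.mul_le_mul_left _ i2

end Bz

-- Part G1
namespace Geo

/-- Vandermonde-type determinant of falling factorials. -/
noncomputable def Vd {d : ℕ} (a : Fin d → ℕ) : ℂ :=
  Matrix.det (Matrix.of fun i j : Fin d => ((a i).descFactorial j : ℂ))

theorem Vd_eq {d : ℕ} (a : Fin d → ℕ) : Vd a = (Matrix.vandermonde fun i => (a i : ℂ)).det := by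
  rw [Matrix.det_eval_matrixOfPolynomials_eq_det_vandermonde (fun i => (a i : ℂ))
    (fun j => descPochhammer ℂ (j:ℕ)) (fun j => descPochhammer_natDegree ℂ (j:ℕ))
    (fun j => monic_descPochhammer ℂ (j:ℕ))]
  unfold Vd
  congr 1
  ext i j
  simp [descPochhammer_eval_eq_descFactorial]

theorem Vd_ne_zero {d : ℕ} (a : Fin d → ℕ) : Vd a ≠ 0 ↔ Function.Injective a := by
  rw [Vd_eq, Matrix.det_vandermonde_ne_zero_iff]
  constructor
  · intro h i j hij
    exact h (by simp [hij])
  · intro h i j hij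
    exact h (by simpa using hij)

theorem xd_coeff (f : Polynomial ℂ) (n j : ℕ) (hf : f ∈ Polynomial.degreeLT ℂ n) :
    X ^ j * (fun p : Polynomial ℂ => derivative p)^[j] f =
      ∑ b : Fin n, (C (f.coeff b) * X ^ (b:ℕ)) * C (((b:ℕ).descFactorial j : ℕ) : ℂ) := by
  have h1 : f = ∑ b : Fin n, C (f.coeff b) * X ^ (b:ℕ) := by
    ext k
    rw [Polynomial.finsetSum_coeff]
    simp only [Polynomial.coeff_C_mul, Polynomial.coeff_X_pow]
    by_cases hk : k < n
    · rw [Finset.sum_eq_single ⟨k, hk⟩]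
      · simp
      · intro b _ hb
        rw [if_neg, mul_zero]
        intro h; exact hb (Fin.ext h.symm)
      · simp
    · rw [Finset.sum_eq_zero]
      · rw [Polynomial.mem_degreeLT] at hf
        exact Polynomial.coeff_eq_zero_of_degree_lt (hf.trans_le (by exact_mod_cast (not_lt.1 hk)))
      · intro b _
        rw [if_neg, mul_zero]
        intro h; exact hk (h ▸ b.2)
  have h2 : (fun p : Polynomial ℂ => derivative p)^[j] f = derivative^[j] f := rfl
  rw [h2]
  conv_lhs => rw [h1]
  rw [Polynomial.iterate_derivative_sum, Finset.mul_sum]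
  refine Finset.sum_congr rfl fun b _ => ?_
  rw [Polynomial.iterate_derivative_C_mul, Polynomial.iterate_derivative_X_pow_eq_natCast_mul]
  by_cases hb : j ≤ (b:ℕ)
  · have : (X : Polynomial ℂ) ^ (b:ℕ) = X ^ j * X ^ ((b:ℕ) - j) := by
      rw [← pow_add, Nat.add_sub_cancel' hb]
    rw [this, Polynomial.C_eq_natCast]
    ring
  · rw [Nat.descFactorial_of_lt (by omega)]
    simp

theorem E_eq (d : ℕ) (f : Fin d → Polynomial ℂ) :
    X ^ (∑ j : Fin d, (j:ℕ)) * wronskDet d f =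
      Matrix.det (Matrix.of fun i j : Fin d => X ^ (j:ℕ) * (fun p : Polynomial ℂ => derivative p)^[(j:ℕ)] (f i)) := by
  rw [wronskDet, ← Finset.prod_pow_eq_pow_sum, ← Matrix.det_mul_row]
  rfl

theorem E_sum (d n : ℕ) (f : Fin d → Polynomial ℂ) (hf : ∀ i, f i ∈ Polynomial.degreeLT ℂ n) :
    X ^ (∑ j : Fin d, (j:ℕ)) * wronskDet d f =
      ∑ a : Fin d → Fin n, C (Vd (fun i => (a i : ℕ)) * ∏ i, (f i).coeff (a i)) * X ^ (∑ i, (a i : ℕ)) := by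
  rw [E_eq]
  have h1 : (Matrix.of fun i j : Fin d => X ^ (j:ℕ) * (fun p : Polynomial ℂ => derivative p)^[(j:ℕ)] (f i)) =
      fun i => ∑ b : Fin n, fun j : Fin d => (C ((f i).coeff b) * X ^ (b:ℕ)) * C (((b:ℕ).descFactorial j : ℕ) : ℂ) := by
    funext i j
    rw [Matrix.of_apply, xd_coeff _ n _ (hf i), Finset.sum_apply]
  rw [h1]
  have h2 := (Matrix.detRowAlternating (R := Polynomial ℂ) (n := Fin d)).toMultilinearMap.map_sum
    (g := fun (i : Fin d) (b : Fin n) => fun j : Fin d => (C ((f i).coeff b) * X ^ (b:ℕ)) * C (((b:ℕ).descFactorial j : ℕ) : ℂ))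
  refine (h2 : Matrix.det _ = _).trans ?_
  refine Finset.sum_congr rfl fun a _ => ?_
  show Matrix.det (Matrix.of fun i j : Fin d => (C ((f i).coeff (a i)) * X ^ (a i:ℕ)) *
    (Matrix.of (fun i j : Fin d => C (((a i:ℕ).descFactorial j : ℕ) : ℂ))) i j) = _
  rw [Matrix.det_mul_column]
  have h3 : (Matrix.of (fun i j : Fin d => C (((a i:ℕ).descFactorial j : ℕ) : ℂ))) =
      (C : ℂ →+* Polynomial ℂ).mapMatrix (Matrix.of fun i j : Fin d => (((a i : ℕ)).descFactorial j : ℂ)) := by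
    ext1 i j; rfl
  rw [h3, ← RingHom.map_det, Finset.prod_mul_distrib, Finset.prod_pow_eq_pow_sum, map_mul, map_prod]
  show _ * C (Vd (fun i => (a i : ℕ))) = _
  ring

theorem wr_coeff (d n K : ℕ) (f : Fin d → Polynomial ℂ) (hf : ∀ i, f i ∈ Polynomial.degreeLT ℂ n) :
    (wronskDet d f).coeff K = ∑ a : Fin d → Fin n, if K + ∑ j : Fin d, (j:ℕ) = ∑ i, (a i : ℕ) then
      Vd (fun i => (a i : ℕ)) * ∏ i, (f i).coeff (a i) else 0 := by
  have h := congrArg (fun p => Polynomial.coeff p (K + ∑ j : Fin d, (j:ℕ))) (E_sum d n f hf)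
  simp only [Polynomial.coeff_X_pow_mul, Polynomial.finsetSum_coeff, Polynomial.coeff_C_mul,
    Polynomial.coeff_X_pow, mul_ite, mul_one, mul_zero] at h
  exact h

theorem wr_change (d : ℕ) (f f' : Fin d → Polynomial ℂ) (P : Matrix (Fin d) (Fin d) ℂ)
    (h : ∀ i, f' i = ∑ j, P i j • f j) : wronskDet d f' = P.det • wronskDet d f := by
  rw [wronskDet, wronskDet, Polynomial.smul_eq_C_mul]
  have h3 : C P.det = ((C : ℂ →+* Polynomial ℂ).mapMatrix P).det := by
    rw [← RingHom.map_det]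
  rw [h3, ← Matrix.det_mul]
  congr 1
  ext1 i k
  rw [Matrix.mul_apply, Matrix.of_apply, h i]
  show derivative^[(k:ℕ)] _ = _
  rw [Polynomial.iterate_derivative_sum]
  refine Finset.sum_congr rfl fun j _ => ?_
  rw [Polynomial.smul_eq_C_mul, Polynomial.iterate_derivative_C_mul]
  rfl

/-- Among injective `d`-tuples in `[0, w+d)` those with maximal sum have all entries `≥ w`. -/
theorem inj_sum_max {d w : ℕ} (a : Fin d → ℕ) (ha : Function.Injective a) (hlt : ∀ i, a i < w + d)
    (hs : w * d + ∑ j : Fin d, (j:ℕ) ≤ ∑ i, a i) : ∀ i, w ≤ a i := by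
  classical
  set S := Finset.univ.image a with hS
  set T := Finset.Ico w (w + d) with hT
  have hcS : S.card = d := by rw [hS, Finset.card_image_of_injective _ ha]; simp
  have hcT : T.card = d := by simp [hT]
  have hsS : ∑ x ∈ S, x = ∑ i, a i := by rw [hS, Finset.sum_image (fun _ _ _ _ h => ha h)]
  have hsT : ∑ x ∈ T, x = w * d + ∑ j : Fin d, (j:ℕ) := by
    rw [hT, Finset.sum_Ico_eq_sum_range, Finset.sum_add_distrib, Fin.sum_univ_eq_sum_range (fun j => j)]
    simp [mul_comm]
  have h1 : ∑ x ∈ S, x = ∑ x ∈ S ∩ T, x + ∑ x ∈ S \ T, x := (Finset.sum_inter_add_sum_sdiff S T _).symm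
  have h2 : ∑ x ∈ T, x = ∑ x ∈ T ∩ S, x + ∑ x ∈ T \ S, x := (Finset.sum_inter_add_sum_sdiff T S _).symm
  have hc : (S \ T).card = (T \ S).card := by
    have := Finset.card_sdiff_add_card_inter S T
    have := Finset.card_sdiff_add_card_inter T S
    rw [Finset.inter_comm] at this
    omega
  have h3 : ∑ x ∈ S \ T, (x + 1) ≤ (S \ T).card * w := by
    refine (Finset.sum_le_card_nsmul _ _ w ?_)
    intro x hx
    rw [Finset.mem_sdiff] at hx
    obtain ⟨i, -, rfl⟩ := Finset.mem_image.1 hx.1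
    have := hlt i
    have h4 := hx.2
    rw [hT, Finset.mem_Ico] at h4
    omega
  have h4 : (T \ S).card * w ≤ ∑ x ∈ T \ S, x := by
    refine (Finset.card_nsmul_le_sum _ _ w ?_)
    intro x hx
    rw [Finset.mem_sdiff] at hx
    exact (Finset.mem_Ico.1 hx.1).1
  rw [Finset.sum_add_distrib, Finset.sum_const, smul_eq_mul, mul_one] at h3
  rw [Finset.inter_comm] at h2
  rw [hc] at h3
  rw [← hsT, ← hsS] at hs
  have h5 : (S \ T).card = 0 := by omega
  intro i
  by_contra hi
  rw [Finset.card_eq_zero] at h5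
  have : a i ∈ S \ T := by
    rw [Finset.mem_sdiff]
    refine ⟨Finset.mem_image_of_mem _ (Finset.mem_univ i), ?_⟩
    rw [hT, Finset.mem_Ico]; omega
  rw [h5] at this
  simp at this

end Geo

-- Part G2
namespace Geo

theorem wr_span (d : ℕ) (f f' : Fin d → Polynomial ℂ)
    (h : ∀ i, f i ∈ Submodule.span ℂ (Set.range f')) : ∃ c : ℂ, wronskDet d f = c • wronskDet d f' := by
  have h1 : ∀ i, ∃ c : Fin d → ℂ, ∑ j, c j • f' j = f i := fun i =>
    (Submodule.mem_span_range_iff_exists_fun ℂ).1 (h i)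
  choose P hP using h1
  exact ⟨Matrix.det (Matrix.of P), wr_change d f' f (Matrix.of P) fun i => (hP i).symm⟩

theorem exch {d : ℕ} (f : Fin d → Polynomial ℂ) (c : Fin d → ℂ) (i0 : Fin d) (hc : c i0 ≠ 0) (i : Fin d) :
    f i ∈ Submodule.span ℂ (Set.range (Function.update f i0 (∑ j, c j • f j))) := by
  classical
  set f' := Function.update f i0 (∑ j, c j • f j) with hf'
  have hj : ∀ j, j ≠ i0 → f j ∈ Submodule.span ℂ (Set.range f') := by
    intro j hj
    refine Submodule.subset_span ⟨j, ?_⟩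
    simp [hf', hj]
  by_cases hi : i = i0
  · subst hi
    have h1 : (∑ j, c j • f j) ∈ Submodule.span ℂ (Set.range f') :=
      Submodule.subset_span ⟨i, by simp [hf']⟩
    rw [← Finset.add_sum_erase _ _ (Finset.mem_univ i)] at h1
    have h2 : (∑ j ∈ Finset.univ.erase i, c j • f j) ∈ Submodule.span ℂ (Set.range f') :=
      Submodule.sum_mem _ fun j hj' => Submodule.smul_mem _ _ (hj j (Finset.ne_of_mem_erase hj'))
    have h3 := (Submodule.add_mem_iff_left _ h2).1 h1
    exact (Submodule.smul_mem_iff _ hc).1 h3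
  · exact hj i hi

theorem top_zero {d w : ℕ} (f : Fin d → Polynomial ℂ) (hf : ∀ i, f i ∈ Polynomial.degreeLT ℂ (w + d))
    (hN : (wronskDet d f).coeff (w * d) ≠ 0) (p : Polynomial ℂ)
    (hp : p ∈ Submodule.span ℂ (Set.range f)) (h0 : ∀ j : Fin d, p.coeff (w + j) = 0) : p = 0 := by
  classical
  obtain ⟨c, rfl⟩ := (Submodule.mem_span_range_iff_exists_fun ℂ).1 hp
  by_contra hne
  have : ∃ i0, c i0 ≠ 0 := by
    by_contra! hcon
    exact hne (by simp [hcon])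
  obtain ⟨i0, hi0⟩ := this
  obtain ⟨k, hk⟩ := wr_span d f _ (exch f c i0 hi0)
  rw [hk] at hN
  apply hN
  have hf' : ∀ i, Function.update f i0 (∑ j, c j • f j) i ∈ Polynomial.degreeLT ℂ (w + d) := by
    intro i
    by_cases hi : i = i0
    · subst hi
      rw [Function.update_self]
      exact Submodule.sum_mem _ fun j _ => Submodule.smul_mem _ _ (hf j)
    · rw [Function.update_of_ne hi]; exact hf i
  rw [Polynomial.coeff_smul, wr_coeff d (w + d) _ _ hf', Finset.sum_eq_zero, smul_zero]
  intro a _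
  split_ifs with hs
  · by_cases ha : Function.Injective (fun i => (a i : ℕ))
    · have := inj_sum_max (fun i => (a i : ℕ)) ha (fun i => (a i).2) hs.le i0
      rw [Finset.prod_eq_zero (Finset.mem_univ i0), mul_zero]
      rw [Function.update_self]
      have h2 := h0 ⟨(a i0 : ℕ) - w, by have := (a i0).2; omega⟩
      simp only at h2 this
      rwa [Nat.add_sub_cancel' this] at h2
    · rw [← Vd_ne_zero, not_not] at ha
      rw [ha, zero_mul]
  · rfl

/-- Reduced echelon basis. -/
theorem ech {d w : ℕ} (f : Fin d → Polynomial ℂ) (hf : ∀ i, f i ∈ Polynomial.degreeLT ℂ (w + d))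
    (hN : (wronskDet d f).coeff (w * d) ≠ 0) (hli : LinearIndependent ℂ f) :
    ∃ e : Fin d → Polynomial ℂ, (∀ i, e i ∈ Submodule.span ℂ (Set.range f)) ∧
      (∀ i j : Fin d, (e i).coeff (w + j) = if i = j then 1 else 0) := by
  classical
  let φ : Submodule.span ℂ (Set.range f) →ₗ[ℂ] (Fin d → ℂ) :=
    (LinearMap.pi fun j : Fin d => Polynomial.lcoeff ℂ (w + j)).comp (Submodule.subtype _)
  have hφ : ∀ x j, φ x j = (x : Polynomial ℂ).coeff (w + j) := fun x j => rfl
  have hinj : Function.Injective φ := by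
    rw [← LinearMap.ker_eq_bot, LinearMap.ker_eq_bot']
    intro m hm
    apply Subtype.ext
    refine top_zero f hf hN _ m.2 fun j => ?_
    rw [← hφ, hm]; rfl
  have hfin : Module.finrank ℂ (Submodule.span ℂ (Set.range f)) = Module.finrank ℂ (Fin d → ℂ) := by
    rw [finrank_span_eq_card hli]; simp
  haveI : FiniteDimensional ℂ (Submodule.span ℂ (Set.range f)) :=
    FiniteDimensional.span_of_finite ℂ (Set.finite_range f)
  have hsurj := (LinearMap.injective_iff_surjective_of_finrank_eq_finrank hfin).1 hinj
  choose e he using fun i : Fin d => hsurj (fun j => if i = j then 1 else 0)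
  refine ⟨fun i => e i, fun i => (e i).2, fun i j => ?_⟩
  rw [← hφ, he]

theorem span_top {d w : ℕ} (x : Submodule ℂ (Polynomial ℂ))
    (hx : ∀ p ∈ x, (∀ j : Fin d, p.coeff (w + j) = 0) → p = 0) (e : Fin d → Polynomial ℂ)
    (he : ∀ i, e i ∈ x) (hd : ∀ i j : Fin d, (e i).coeff (w + j) = if i = j then 1 else 0) :
    Submodule.span ℂ (Set.range e) = x := by
  classical
  apply le_antisymm
  · rw [Submodule.span_le]; rintro _ ⟨i, rfl⟩; exact he i
  · intro p hp
    have h1 : p - ∑ i : Fin d, p.coeff (w + (i:ℕ)) • e i = 0 := by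
      refine hx _ (Submodule.sub_mem _ hp (Submodule.sum_mem _ fun i _ => Submodule.smul_mem _ _ (he i))) ?_
      intro j
      rw [Polynomial.coeff_sub, Polynomial.finsetSum_coeff]
      simp [hd]
    rw [sub_eq_zero.1 h1]
    exact Submodule.sum_mem _ fun i _ => Submodule.smul_mem _ _ (Submodule.subset_span ⟨i, rfl⟩)

theorem li_top {d w : ℕ} (e : Fin d → Polynomial ℂ)
    (hd : ∀ i j : Fin d, (e i).coeff (w + j) = if i = j then 1 else 0) : LinearIndependent ℂ e := by
  rw [Fintype.linearIndependent_iff]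
  intro g hg i
  have := congrArg (fun p => Polynomial.coeff p (w + i)) hg
  simpa [Polynomial.finsetSum_coeff, hd] using this

theorem top_zero' {d w : ℕ} (e : Fin d → Polynomial ℂ)
    (hd : ∀ i j : Fin d, (e i).coeff (w + j) = if i = j then 1 else 0) (p : Polynomial ℂ)
    (hp : p ∈ Submodule.span ℂ (Set.range e)) (h0 : ∀ j : Fin d, p.coeff (w + j) = 0) : p = 0 := by
  obtain ⟨c, rfl⟩ := (Submodule.mem_span_range_iff_exists_fun ℂ).1 hp
  have : ∀ i, c i = 0 := by
    intro i
    have := h0 i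
    simpa [Polynomial.finsetSum_coeff, hd] using this
  simp [this]

theorem rot_coeff (c : ℂ) (p : Polynomial ℂ) (k : ℕ) : (rotMap c p).coeff k = c ^ k * p.coeff k := by
  have : rotMap c p = p.comp (C c * X) := rfl
  rw [this, Polynomial.comp_C_mul_X_coeff, mul_comm]

theorem ech_pattern {d w r : ℕ} (x : Submodule ℂ (Polynomial ℂ))
    (hx : ∀ p ∈ x, (∀ j : Fin d, p.coeff (w + j) = 0) → p = 0) (ζ : ℂ) (hζ : IsPrimitiveRoot ζ r) (hr : 0 < r)
    (hrot : ∀ p ∈ x, rotMap ζ p ∈ x) (e : Fin d → Polynomial ℂ)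
    (he : ∀ i, e i ∈ x) (hd : ∀ i j : Fin d, (e i).coeff (w + j) = if i = j then 1 else 0)
    (i : Fin d) (b : ℕ) (hb : (e i).coeff b ≠ 0) : (w + (i:ℕ)) % r = b % r := by
  have h1 : rotMap ζ (e i) - ζ ^ (w + (i:ℕ)) • e i = 0 := by
    refine hx _ (Submodule.sub_mem _ (hrot _ (he i)) (Submodule.smul_mem _ _ (he i))) ?_
    intro j
    rw [Polynomial.coeff_sub, rot_coeff, Polynomial.coeff_smul, hd]
    by_cases hij : i = j
    · subst hij; simp
    · simp [hij]
  have h2 := congrArg (fun p => Polynomial.coeff p b) h1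
  simp only [Polynomial.coeff_sub, rot_coeff, Polynomial.coeff_smul, smul_eq_mul, Polynomial.coeff_zero] at h2
  rw [← sub_mul] at h2
  have h3 := sub_eq_zero.1 ((mul_eq_zero.1 h2).resolve_right hb)
  have h4 := hζ.eq_orderOf
  refine hζ.pow_inj (Nat.mod_lt _ hr) (Nat.mod_lt _ hr) ?_
  rw [h4, pow_mod_orderOf, pow_mod_orderOf, h3]

theorem crfixed_prim {r : ℕ} (hr : 0 < r) (x : Submodule ℂ (Polynomial ℂ)) (h : CrFixed r x) :
    ∃ ζ : ℂ, IsPrimitiveRoot ζ r ∧ ∀ p ∈ x, rotMap ζ p ∈ x := by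
  refine ⟨(Complex.exp (2 * Real.pi * Complex.I / r))⁻¹, (Complex.isPrimitiveRoot_exp r hr.ne').inv, ?_⟩
  intro p hp
  have h1 := h ⟨1 % r, Nat.mod_lt _ hr⟩
  have h2 : Complex.exp (-(2 * (Real.pi : ℂ) * Complex.I * (((1 % r : ℕ)) : ℂ)) / (r : ℂ)) =
      (Complex.exp (2 * Real.pi * Complex.I / r))⁻¹ := by
    rcases Nat.lt_or_ge 1 r with h1 | h1
    · rw [Nat.mod_eq_of_lt h1, ← Complex.exp_neg]
      congr 1; push_cast; ring
    · have : r = 1 := by omega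
      subst this
      simp [Complex.exp_two_pi_mul_I]
  simp only at h1
  rw [h2] at h1
  have : rotMap (Complex.exp (2 * Real.pi * Complex.I / r))⁻¹ p ∈
    Submodule.map (rotMap (Complex.exp (2 * Real.pi * Complex.I / r))⁻¹) x := Submodule.mem_map_of_mem hp
  rwa [h1] at this

end Geo

-- Part G3
namespace Geo
open Wd

theorem wr_row_zero {d : ℕ} (f : Fin d → Polynomial ℂ) (i : Fin d) (h : f i = 0) : wronskDet d f = 0 := by
  unfold wronskDet
  refine Matrix.det_eq_zero_of_row_eq_zero i fun j => ?_
  rw [Matrix.of_apply, h]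
  show derivative^[(j:ℕ)] (0 : Polynomial ℂ) = 0
  exact Polynomial.iterate_derivative_zero

/-- A basis with pairwise distinct orders of vanishing at `0`. -/
theorem ord_basis {d n : ℕ} (x : Submodule ℂ (Polynomial ℂ)) (hx : x ≤ Polynomial.degreeLT ℂ n)
    (hW : ∀ f : Fin d → Polynomial ℂ, Submodule.span ℂ (Set.range f) = x → wronskDet d f ≠ 0) :
    ∀ (k : ℕ) (f : Fin d → Polynomial ℂ), Submodule.span ℂ (Set.range f) = x →
      d * n ≤ k + ∑ i, (f i).natTrailingDegree →
      ∃ f' : Fin d → Polynomial ℂ, Submodule.span ℂ (Set.range f') = x ∧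
        Function.Injective fun i => (f' i).natTrailingDegree := by
  classical
  intro k
  induction k with
  | zero =>
    intro f hf hk
    have hmem : ∀ i, f i ∈ x := fun i => hf ▸ Submodule.subset_span ⟨i, rfl⟩
    have h0 : ∀ i, f i ≠ 0 := fun i h => hW f hf (wr_row_zero f i h)
    have hlt : ∀ i, (f i).natTrailingDegree < n := fun i => by
      have h1 := hx (hmem i)
      rw [Polynomial.mem_degreeLT, Polynomial.degree_eq_natDegree (h0 i)] at h1
      exact lt_of_le_of_lt (Polynomial.natTrailingDegree_le_natDegree _) (by exact_mod_cast h1)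
    refine ⟨f, hf, ?_⟩
    rcases Nat.eq_zero_or_pos d with rfl | hd
    · intro i; exact i.elim0
    · exfalso
      have : ∑ i, (f i).natTrailingDegree < ∑ i : Fin d, n :=
        Finset.sum_lt_sum_of_nonempty ⟨⟨0, hd⟩, Finset.mem_univ _⟩ fun i _ => hlt i
      simp at this
      omega
  | succ k ih =>
    intro f hf hk
    have hmem : ∀ i, f i ∈ x := fun i => hf ▸ Submodule.subset_span ⟨i, rfl⟩
    have h0 : ∀ i, f i ≠ 0 := fun i h => hW f hf (wr_row_zero f i h)
    by_cases hinj : Function.Injective fun i => (f i).natTrailingDegree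
    · exact ⟨f, hf, hinj⟩
    · rw [Function.Injective] at hinj
      push Not at hinj
      obtain ⟨i, j, hij, hne⟩ := hinj
      set t : ℂ := (f i).trailingCoeff / (f j).trailingCoeff with ht
      have htj : (f j).trailingCoeff ≠ 0 := by
        rw [Ne, Polynomial.trailingCoeff_eq_zero]; exact h0 j
      set c : Fin d → ℂ := Pi.single i 1 - Pi.single j t with hc
      have hq : ∑ l, c l • f l = f i - t • f j := by
        simp [hc, sub_smul, Finset.sum_sub_distrib, Pi.single_apply, ite_smul]
      have hci : c i ≠ 0 := by simp [hc, Pi.single_apply, hne]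
      set f' := Function.update f i (∑ l, c l • f l) with hf'
      have hspan : Submodule.span ℂ (Set.range f') = x := by
        apply le_antisymm
        · rw [Submodule.span_le]
          rintro _ ⟨l, rfl⟩
          by_cases hl : l = i
          · subst hl
            rw [hf', Function.update_self]
            exact Submodule.sum_mem _ fun j _ => Submodule.smul_mem _ _ (hmem j)
          · rw [hf', Function.update_of_ne hl]; exact hmem l
        · rw [← hf, Submodule.span_le]
          rintro _ ⟨l, rfl⟩
          exact exch f c i hci l
      apply ih f' hspan
      have hq0 : f' i ≠ 0 := fun h => hW f' hspan (wr_row_zero f' i h)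
      have hlt : (f i).natTrailingDegree < (f' i).natTrailingDegree := by
        have hfi : f' i = f i - t • f j := by rw [hf', Function.update_self, hq]
        rw [Nat.lt_iff_add_one_le]
        apply Polynomial.le_natTrailingDegree hq0
        intro m hm
        rw [hfi, Polynomial.coeff_sub, Polynomial.coeff_smul]
        rcases Nat.lt_or_ge m (f i).natTrailingDegree with h1 | h1
        · rw [Polynomial.coeff_eq_zero_of_lt_natTrailingDegree h1,
            Polynomial.coeff_eq_zero_of_lt_natTrailingDegree (hij ▸ h1)]
          simp
        · have hm2 : m = (f i).natTrailingDegree := by omega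
          have e1 : (f i).coeff m = (f i).trailingCoeff := by rw [hm2]; rfl
          have e2 : (f j).coeff m = (f j).trailingCoeff := by rw [hm2, hij]; rfl
          rw [e1, e2, ht, smul_eq_mul, div_mul_cancel₀ _ htj, sub_self]
      have : ∑ l, (f l).natTrailingDegree < ∑ l, (f' l).natTrailingDegree := by
        refine Finset.sum_lt_sum (fun l _ => ?_) ⟨i, Finset.mem_univ i, hlt⟩
        by_cases hl : l = i
        · subst hl; exact hlt.le
        · rw [hf', Function.update_of_ne hl]
      omega

theorem all_div {d w : ℕ} (f : Fin d → Polynomial ℂ) (hf : ∀ i, f i ∈ Polynomial.degreeLT ℂ (w + d))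
    (c : ℂ) (hc : c ≠ 0) (hW : wronskDet d f = c • X ^ (w * d)) (i : Fin d) (b : ℕ) (hb : b < w) :
    (f i).coeff b = 0 := by
  classical
  have hW0 : wronskDet d f ≠ 0 := by
    rw [hW]; exact smul_ne_zero hc (pow_ne_zero _ X_ne_zero)
  have hx : Submodule.span ℂ (Set.range f) ≤ Polynomial.degreeLT ℂ (w + d) := by
    rw [Submodule.span_le]; rintro _ ⟨i, rfl⟩; exact hf i
  have hW' : ∀ f' : Fin d → Polynomial ℂ, Submodule.span ℂ (Set.range f') = Submodule.span ℂ (Set.range f) →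
      wronskDet d f' ≠ 0 := by
    intro f' hf' h0
    obtain ⟨k, hk⟩ := wr_span d f f' fun i => hf' ▸ Submodule.subset_span ⟨i, rfl⟩
    rw [h0, smul_zero] at hk
    exact hW0 hk
  obtain ⟨f', hf', hinj⟩ := ord_basis _ hx hW' (d * (w + d)) f rfl (by omega)
  have hmem' : ∀ i, f' i ∈ Polynomial.degreeLT ℂ (w + d) := fun i =>
    hx (hf' ▸ Submodule.subset_span ⟨i, rfl⟩)
  have h0' : ∀ i, f' i ≠ 0 := fun i h => hW' f' hf' (wr_row_zero f' i h)
  have hlt : ∀ i, (f' i).natTrailingDegree < w + d := fun i => by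
    have h1 := hmem' i
    rw [Polynomial.mem_degreeLT, Polynomial.degree_eq_natDegree (h0' i)] at h1
    exact lt_of_le_of_lt (Polynomial.natTrailingDegree_le_natDegree _) (by exact_mod_cast h1)
  obtain ⟨k, hk⟩ := wr_span d f' f fun i => hf' ▸ Submodule.subset_span ⟨i, rfl⟩
  have hE := E_sum d (w + d) f' hmem'
  have hE2 := congrArg (fun p => Polynomial.coeff p (∑ i, (f' i).natTrailingDegree)) hE
  simp only [Polynomial.finsetSum_coeff, Polynomial.coeff_C_mul, Polynomial.coeff_X_pow] at hE2
  rw [Finset.sum_eq_single (fun i => (⟨(f' i).natTrailingDegree, hlt i⟩ : Fin (w + d)))] at hE2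
  · simp only [if_true, mul_one] at hE2
    have hne : Vd (fun i => (f' i).natTrailingDegree) * ∏ i, (f' i).coeff (f' i).natTrailingDegree ≠ 0 := by
      refine mul_ne_zero ((Vd_ne_zero _).2 hinj) (Finset.prod_ne_zero_iff.2 fun i _ => ?_)
      exact Polynomial.trailingCoeff_nonzero_iff_nonzero.2 (h0' i)
    rw [← hE2, hk, hW] at hne
    have hs : ∑ i, (f' i).natTrailingDegree = w * d + ∑ j : Fin d, (j:ℕ) := by
      by_contra hcon
      apply hne
      rw [mul_smul_comm, mul_smul_comm, ← pow_add, Polynomial.coeff_smul, Polynomial.coeff_smul, Polynomial.coeff_X_pow, if_neg (by omega)]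
      simp
    have hge := inj_sum_max _ hinj hlt hs.ge
    have hi : f i ∈ Submodule.span ℂ (Set.range f') := hf' ▸ Submodule.subset_span ⟨i, rfl⟩
    obtain ⟨c, hc⟩ := (Submodule.mem_span_range_iff_exists_fun ℂ).1 hi
    rw [← hc, Polynomial.finsetSum_coeff]
    refine Finset.sum_eq_zero fun j _ => ?_
    rw [Polynomial.coeff_smul, Polynomial.coeff_eq_zero_of_lt_natTrailingDegree (lt_of_lt_of_le hb (hge j)), smul_zero]
  · intro a _ ha
    by_cases hs : ∑ i, (f' i).natTrailingDegree = ∑ i, (a i : ℕ)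
    · have : ∃ i, (a i : ℕ) < (f' i).natTrailingDegree := by
        by_contra! hcon
        have h1 := (Finset.sum_eq_sum_iff_of_le fun i _ => hcon i).1 hs
        apply ha
        funext i
        exact Fin.ext (h1 i (Finset.mem_univ i)).symm
      obtain ⟨i, hi⟩ := this
      rw [Finset.prod_eq_zero (Finset.mem_univ i) (Polynomial.coeff_eq_zero_of_lt_natTrailingDegree hi)]
      simp
    · rw [if_neg hs, mul_zero]
  · intro h; exact absurd (Finset.mem_univ _) h

/-- In the bad case there is no basis with the given pattern and nonvanishing constant term. -/
theorem bad_wr {d w r : ℕ} (hr : 0 < r) (h1 : ¬ r ∣ d) (h2 : ¬ r ∣ w) (e : Fin d → Polynomial ℂ)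
    (he : ∀ (i : Fin d) (b : ℕ), (e i).coeff b ≠ 0 → (w + (i:ℕ)) % r = b % r) :
    (wronskDet d e).coeff 0 = 0 := by
  by_contra hne
  have e1 : (wronskDet d e).coeff 0 = Polynomial.constantCoeff (wronskDet d e) := rfl
  rw [e1, wronskDet, RingHom.map_det, Matrix.det_apply] at hne
  obtain ⟨σ, -, hσ⟩ := Finset.exists_ne_zero_of_sum_ne_zero hne
  have h3 : ∏ i, (Polynomial.constantCoeff.mapMatrix (Matrix.of fun i j : Fin d =>
    (fun p : Polynomial ℂ => Polynomial.derivative p)^[(j : ℕ)] (e i))) (σ i) i ≠ 0 := fun h => hσ (by rw [h, smul_zero])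
  rw [Finset.prod_ne_zero_iff] at h3
  obtain ⟨i, hi⟩ := bad_perm d w r hr h1 h2 σ⁻¹
  have h4 := h3 (σ⁻¹ i) (Finset.mem_univ _)
  apply hi
  apply he
  intro h5
  apply h4
  show (derivative^[((σ⁻¹ i : Fin d) : ℕ)] (e (σ (σ⁻¹ i)))).coeff 0 = 0
  rw [Polynomial.coeff_iterate_derivative]
  have h6 : σ (σ⁻¹ i) = i := σ.apply_symm_apply i
  rw [h6, zero_add, h5, smul_zero]

end Geo

-- Part G4
namespace Geo
open Wd

section
variable {d w r : ℕ}

/-- Coefficients of the normal form basis. -/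
noncomputable def cg {R : Type} [CommRing R] (y : Io d w r → R) (i : Fin d) (b : ℕ) : R :=
  open Classical in
  if h : ∃ _ : b < w, (w + (i:ℕ)) % r = b % r then y ⟨(i, ⟨b, h.1⟩), h.2⟩
  else if b = w + i then 1 else 0

theorem cg_io {R : Type} [CommRing R] (y : Io d w r → R) (p : Io d w r) : cg y p.1.1 p.1.2 = y p := by
  unfold cg
  rw [dif_pos ⟨p.1.2.2, p.2⟩]

theorem cg_top {R : Type} [CommRing R] (y : Io d w r → R) (i j : Fin d) :
    cg y i (w + j) = if i = j then 1 else 0 := by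
  unfold cg
  rw [dif_neg (by rintro ⟨h, -⟩; omega)]
  simp [Fin.ext_iff, eq_comm]

theorem cg_ne {R : Type} [CommRing R] (y : Io d w r → R) (i : Fin d) (b : ℕ) (h : cg y i b ≠ 0) :
    (w + (i:ℕ)) % r = b % r ∧ (b < w ∨ b = w + i) := by
  unfold cg at h
  split_ifs at h with h1 h2
  · exact ⟨h1.2, Or.inl h1.1⟩
  · exact ⟨by rw [h2], Or.inr h2⟩
  · exact absurd rfl h

theorem cg_map {R S : Type} [CommRing R] [CommRing S] (φ : R →+* S) (y : Io d w r → R) (i : Fin d) (b : ℕ) :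
    φ (cg y i b) = cg (fun p => φ (y p)) i b := by
  unfold cg
  split_ifs <;> simp

/-- Normal form basis. -/
noncomputable def fy (y : Io d w r → ℂ) (i : Fin d) : Polynomial ℂ :=
  ∑ b : Fin (w + d), C (cg y i b) * X ^ (b:ℕ)

theorem fy_coeff (y : Io d w r → ℂ) (i : Fin d) (b : ℕ) : (fy y i).coeff b = cg y i b := by
  unfold fy
  rw [Polynomial.finsetSum_coeff]
  simp only [Polynomial.coeff_C_mul, Polynomial.coeff_X_pow]
  by_cases hb : b < w + d
  · rw [Finset.sum_eq_single ⟨b, hb⟩]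
    · simp
    · intro c _ hc
      rw [if_neg, mul_zero]
      intro h; exact hc (Fin.ext h.symm)
    · simp
  · rw [Finset.sum_eq_zero]
    · by_contra h
      have := (cg_ne y i b (fun h' => h h'.symm)).2
      omega
    · intro c _
      rw [if_neg, mul_zero]
      intro h; exact hb (h ▸ c.2)

theorem fy_mem (y : Io d w r → ℂ) (i : Fin d) : fy y i ∈ Polynomial.degreeLT ℂ (w + d) := by
  rw [Polynomial.mem_degreeLT, Polynomial.degree_lt_iff_coeff_zero]
  intro m hm
  rw [fy_coeff]
  by_contra h
  have := (cg_ne y i m h).2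
  omega

theorem fy_top (y : Io d w r → ℂ) (i j : Fin d) : (fy y i).coeff (w + j) = if i = j then 1 else 0 := by
  rw [fy_coeff, cg_top]

theorem eq_fy (e : Fin d → Polynomial ℂ) (he : ∀ i, e i ∈ Polynomial.degreeLT ℂ (w + d))
    (htop : ∀ i j : Fin d, (e i).coeff (w + j) = if i = j then 1 else 0)
    (hp : ∀ (i : Fin d) (b : ℕ), (e i).coeff b ≠ 0 → (w + (i:ℕ)) % r = b % r) :
    ∃ y : Io d w r → ℂ, e = fy y := by
  refine ⟨fun p => (e p.1.1).coeff p.1.2, ?_⟩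
  funext i
  ext b
  rw [fy_coeff]
  by_cases hb : b < w
  · by_cases h : (w + (i:ℕ)) % r = b % r
    · exact (cg_io (fun p : Io d w r => (e p.1.1).coeff p.1.2) ⟨(i, ⟨b, hb⟩), h⟩).symm
    · have h1 : (e i).coeff b = 0 := by
        by_contra h'; exact h (hp i b h')
      rw [h1]
      by_contra h'
      exact h (cg_ne _ i b (fun h'' => h' h''.symm)).1
  · by_cases hb2 : b < w + d
    · have h3 := htop i ⟨b - w, by omega⟩
      have h4 := cg_top (fun p : Io d w r => (e p.1.1).coeff p.1.2) i ⟨b - w, by omega⟩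
      simp only [Nat.add_sub_cancel' (not_lt.1 hb)] at h3 h4
      rw [h3, h4]
    · have h1 := he i
      rw [Polynomial.mem_degreeLT, Polynomial.degree_lt_iff_coeff_zero] at h1
      rw [h1 b (not_lt.1 hb2)]
      by_contra h'
      have := (cg_ne _ i b (fun h'' => h' h''.symm)).2
      omega

theorem fy_inj (y y' : Io d w r → ℂ)
    (h : Submodule.span ℂ (Set.range (fy y)) = Submodule.span ℂ (Set.range (fy y'))) : y = y' := by
  have h1 : ∀ i, fy y i = fy y' i := by
    intro i
    rw [← sub_eq_zero]
    refine top_zero' (w := w) (fy y) (fy_top y) _ (Submodule.sub_mem _ (Submodule.subset_span ⟨i, rfl⟩)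
      (h ▸ Submodule.subset_span ⟨i, rfl⟩)) ?_
    intro j
    rw [Polynomial.coeff_sub, fy_top, fy_top, sub_self]
  funext p
  rw [← cg_io y p, ← cg_io y' p, ← fy_coeff, ← fy_coeff, h1]

/-- Leading Wronskian constant. -/
noncomputable def V0 (d w : ℕ) : ℂ := Vd fun i : Fin d => w + (i:ℕ)

theorem V0_ne (d w : ℕ) : V0 d w ≠ 0 := by
  rw [V0, Vd_ne_zero]
  intro i j h
  exact Fin.ext (by simpa using h)

theorem sum_top : ∑ i : Fin d, (w + (i:ℕ)) = w * d + ∑ j : Fin d, (j:ℕ) := by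
  rw [Finset.sum_add_distrib]; simp [mul_comm]

theorem fy_crfixed (hr : 0 < r) (y : Io d w r → ℂ) : CrFixed r (Submodule.span ℂ (Set.range (fy y))) := by
  intro j
  set c := Complex.exp (-(2 * (Real.pi : ℂ) * Complex.I * ((j : ℕ) : ℂ)) / (r : ℂ)) with hc
  have hc0 : c ≠ 0 := Complex.exp_ne_zero _
  have hcr : c ^ r = 1 := by
    rw [hc, ← Complex.exp_nat_mul, Complex.exp_eq_one_iff]
    refine ⟨-(j:ℕ), ?_⟩
    have : (r : ℂ) ≠ 0 := by exact_mod_cast hr.ne'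
    field_simp
    push_cast
    ring
  have hmod : ∀ a b : ℕ, a % r = b % r → c ^ a = c ^ b := by
    intro a b hab
    rw [← Nat.mod_add_div a r, ← Nat.mod_add_div b r, pow_add, pow_add, pow_mul, pow_mul, hcr, hab]
    simp
  have hrot : ∀ i, rotMap c (fy y i) = c ^ (w + (i:ℕ)) • fy y i := by
    intro i
    ext b
    rw [rot_coeff, Polynomial.coeff_smul, smul_eq_mul]
    by_cases hb : (fy y i).coeff b = 0
    · rw [hb, mul_zero, mul_zero]
    · rw [fy_coeff] at hb
      rw [hmod _ _ (cg_ne y i b hb).1]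
  rw [Submodule.map_span]
  apply le_antisymm
  · rw [Submodule.span_le]
    rintro _ ⟨_, ⟨i, rfl⟩, rfl⟩
    rw [hrot]
    exact Submodule.smul_mem _ _ (Submodule.subset_span ⟨i, rfl⟩)
  · rw [Submodule.span_le]
    rintro _ ⟨i, rfl⟩
    have : c ^ (w + (i:ℕ)) • fy y i ∈ Submodule.span ℂ (rotMap c '' Set.range (fy y)) := by
      rw [← hrot]; exact Submodule.subset_span ⟨_, ⟨i, rfl⟩, rfl⟩
    exact (Submodule.smul_mem_iff _ (pow_ne_zero _ hc0)).1 this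

/-- The Wronskian coefficients as polynomials in the coordinates. -/
noncomputable def GK (d w r K : ℕ) : MvPolynomial (Io d w r) ℂ :=
  ∑ a : Fin d → Fin (w + d), if K + ∑ j : Fin d, (j:ℕ) = ∑ i, (a i : ℕ) then
      MvPolynomial.C (Vd (fun i => (a i : ℕ))) *
        ∏ i, cg (fun p : Io d w r => (MvPolynomial.X p : MvPolynomial (Io d w r) ℂ)) i (a i) else 0

theorem GK_eval (K : ℕ) (y : Io d w r → ℂ) :
    MvPolynomial.eval y (GK d w r K) = (wronskDet d (fy y)).coeff K := by
  rw [wr_coeff d (w + d) K _ (fy_mem y), GK, map_sum]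
  refine Finset.sum_congr rfl fun a _ => ?_
  rw [apply_ite (MvPolynomial.eval y), map_zero, map_mul, map_prod, MvPolynomial.eval_C]
  simp only [cg_map, MvPolynomial.eval_X, fy_coeff]

/-- weights -/
def wt (d w r : ℕ) (p : Io d w r) : ℕ := w + (p.1.1:ℕ) - p.1.2

theorem cg_wh (i : Fin d) (b : ℕ) :
    MvPolynomial.IsWeightedHomogeneous (wt d w r)
      (cg (fun p : Io d w r => (MvPolynomial.X p : MvPolynomial (Io d w r) ℂ)) i b) (w + i - b) := by
  unfold cg
  split_ifs with h1 h2
  · exact MvPolynomial.isWeightedHomogeneous_X ℂ (wt d w r) _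
  · rw [h2, Nat.sub_self]
    exact MvPolynomial.isWeightedHomogeneous_one ℂ (wt d w r)
  · exact MvPolynomial.isWeightedHomogeneous_zero ℂ (wt d w r) _

theorem GK_wh (K : ℕ) : MvPolynomial.IsWeightedHomogeneous (wt d w r) (GK d w r K) (w * d - K) := by
  unfold GK
  refine MvPolynomial.IsWeightedHomogeneous.sum _ _ _ fun a _ => ?_
  split_ifs with hs
  · by_cases hle : ∀ i, (a i : ℕ) ≤ w + i
    · have h1 := MvPolynomial.IsWeightedHomogeneous.prod Finset.univ
        (fun i : Fin d => cg (fun p : Io d w r => (MvPolynomial.X p : MvPolynomial (Io d w r) ℂ)) i (a i))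
        (fun i => w + (i:ℕ) - (a i : ℕ)) (fun i _ => cg_wh i _)
      have h2 := (MvPolynomial.isWeightedHomogeneous_C (wt d w r) (Vd (fun i => (a i : ℕ)))).mul h1
      have h3 : 0 + ∑ i : Fin d, (w + (i:ℕ) - (a i : ℕ)) = w * d - K := by
        have h4 : ∑ i : Fin d, (w + (i:ℕ) - (a i : ℕ)) + ∑ i, (a i : ℕ) = ∑ i : Fin d, (w + (i:ℕ)) := by
          rw [← Finset.sum_add_distrib]
          exact Finset.sum_congr rfl fun i _ => Nat.sub_add_cancel (hle i)
        rw [sum_top] at h4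
        omega
      rw [h3] at h2
      exact h2
    · push Not at hle
      obtain ⟨i, hi⟩ := hle
      rw [Finset.prod_eq_zero (Finset.mem_univ i), mul_zero]
      · exact MvPolynomial.isWeightedHomogeneous_zero ℂ (wt d w r) _
      · by_contra h
        have := (cg_ne _ i _ h).2
        omega
  · exact MvPolynomial.isWeightedHomogeneous_zero ℂ (wt d w r) _

theorem wr_fy_zero (y : Io d w r → ℂ) (K : ℕ) (h : ¬ (K ≤ w * d ∧ K % r = (w * d) % r)) :
    (wronskDet d (fy y)).coeff K = 0 := by
  rw [wr_coeff d (w + d) K _ (fy_mem y)]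
  refine Finset.sum_eq_zero fun a _ => ?_
  split_ifs with hs
  · by_contra hne
    have h1 := Finset.prod_ne_zero_iff.1 (right_ne_zero_of_mul hne)
    simp only [fy_coeff] at h1
    have h2 : ∀ i, (a i : ℕ) ≤ w + i := fun i => by
      have := (cg_ne y i _ (h1 i (Finset.mem_univ i))).2
      omega
    have h3 : ∑ i, (a i : ℕ) ≤ ∑ i : Fin d, (w + (i:ℕ)) := Finset.sum_le_sum fun i _ => h2 i
    have h4 : (∑ i, (a i : ℕ)) ≡ ∑ i : Fin d, (w + (i:ℕ)) [MOD r] := by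
      apply Nat.ModEq.sum
      intro i _
      exact (cg_ne y i _ (h1 i (Finset.mem_univ i))).1.symm
    rw [sum_top] at h3 h4
    rw [← hs] at h3 h4
    exact h ⟨by omega, Nat.ModEq.add_right_cancel' _ h4⟩
  · rfl

theorem wr_fy_top (y : Io d w r → ℂ) : (wronskDet d (fy y)).coeff (w * d) = V0 d w := by
  rw [wr_coeff d (w + d) _ _ (fy_mem y)]
  rw [Finset.sum_eq_single (fun i : Fin d => (⟨w + (i:ℕ), by omega⟩ : Fin (w + d)))]
  · rw [if_pos (by rw [← sum_top])]
    simp only [fy_top, if_true, Finset.prod_const_one, mul_one]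
    rfl
  · intro a _ ha
    split_ifs with hs
    · by_contra hne
      have h1 := Finset.prod_ne_zero_iff.1 (right_ne_zero_of_mul hne)
      simp only [fy_coeff] at h1
      have h2 : ∀ i, (a i : ℕ) ≤ w + i := fun i => by
        have := (cg_ne y i _ (h1 i (Finset.mem_univ i))).2
        omega
      rw [← sum_top] at hs
      have h3 := (Finset.sum_eq_sum_iff_of_le fun i _ => h2 i).1 hs.symm
      apply ha
      funext i
      exact Fin.ext (h3 i (Finset.mem_univ i))
    · rfl
  · intro h; exact absurd (Finset.mem_univ _) h

end

end Geo

-- Part G5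
namespace Geo
open Wd

section
variable {d w r l : ℕ}

/-- The normalised equations. -/
noncomputable def gj (d w r l : ℕ) (j : Fin l) : MvPolynomial (Io d w r) ℂ :=
  MvPolynomial.C (V0 d w)⁻¹ * GK d w r (r * (l - 1 - j))

theorem gj_wh (h : r * l = w * d) (j : Fin l) :
    MvPolynomial.IsWeightedHomogeneous (wt d w r) (gj d w r l j) (r * (j + 1)) := by
  have h1 := (MvPolynomial.isWeightedHomogeneous_C (wt d w r) (V0 d w)⁻¹).mul
    (GK_wh (d := d) (w := w) (r := r) (r * (l - 1 - j)))
  have h2 : 0 + (w * d - r * (l - 1 - j)) = r * (j + 1) := by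
    rw [← h, zero_add, ← Nat.mul_sub]
    congr 1
    have := j.2
    omega
  rw [h2] at h1
  exact h1

theorem wr_eq (hr : 0 < r) (h : r * l = w * d) (y : Io d w r → ℂ) (H : Polynomial ℂ) (hm : H.Monic)
    (hdeg : H.natDegree = l) :
    wronskDet d (fy y) = V0 d w • Polynomial.expand ℂ r H ↔
      ∀ j : Fin l, MvPolynomial.eval y (gj d w r l j) = H.coeff (l - 1 - j) := by
  have hV := V0_ne d w
  constructor
  · intro hW j
    rw [gj, map_mul, MvPolynomial.eval_C, GK_eval, hW, Polynomial.coeff_smul, Polynomial.coeff_expand hr,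
      if_pos (dvd_mul_right _ _), Nat.mul_div_cancel_left _ hr, smul_eq_mul, inv_mul_cancel_left₀ hV]
  · intro hj
    ext K
    rw [Polynomial.coeff_smul, Polynomial.coeff_expand hr]
    split_ifs with hK
    · obtain ⟨m, rfl⟩ := hK
      rw [Nat.mul_div_cancel_left _ hr]
      rcases lt_trichotomy m l with hl | hl | hl
      · have h1 := hj ⟨l - 1 - m, by omega⟩
        rw [gj, map_mul, MvPolynomial.eval_C, GK_eval] at h1
        have h2 : l - 1 - (l - 1 - m) = m := by omega
        simp only [h2] at h1
        rw [← h1, smul_eq_mul, mul_inv_cancel_left₀ hV]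
      · subst hl
        have h3 : H.coeff m = 1 := by rw [← hdeg]; exact hm
        rw [h3, h, wr_fy_top, smul_eq_mul, mul_one]
      · rw [Polynomial.coeff_eq_zero_of_natDegree_lt (p := H) (by omega), smul_zero]
        apply wr_fy_zero
        rw [← h]
        rintro ⟨h1, -⟩
        have := (Nat.mul_lt_mul_left hr).2 hl
        omega
    · rw [smul_zero]
      apply wr_fy_zero
      rintro ⟨-, h1⟩
      rw [← h, Nat.mul_mod_right] at h1
      exact hK (Nat.dvd_of_mod_eq_zero h1)

/-- The polynomial in `z^r`. -/
noncomputable def qh {l : ℕ} (hs : Fin l → ℂ) : Polynomial ℂ := ∏ i, (X + C (hs i))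

theorem qh_monic (hs : Fin l → ℂ) : (qh hs).Monic := monic_prod_of_monic _ _ fun i _ => monic_X_add_C _

theorem qh_deg (hs : Fin l → ℂ) : (qh hs).natDegree = l := by
  rw [qh, natDegree_prod_of_monic _ _ fun i _ => monic_X_add_C _]
  simp

theorem cr_eq (r : ℕ) (hs : Fin l → ℂ) : crPoly r 0 l hs = Polynomial.expand ℂ r (qh hs) := by
  rw [crPoly, qh, map_prod]
  simp

theorem cr_top (hr : 0 < r) (hs : Fin l → ℂ) : (crPoly r 0 l hs).coeff (r * l) = 1 := by
  rw [cr_eq, Polynomial.coeff_expand hr, if_pos (dvd_mul_right _ _), Nat.mul_div_cancel_left _ hr]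
  have := qh_monic hs
  rw [Polynomial.Monic, Polynomial.leadingCoeff, qh_deg] at this
  exact this

theorem cr_bot (hr : 0 < r) (hs : Fin l → ℂ) : (crPoly r 0 l hs).coeff 0 = ∏ i, hs i := by
  rw [cr_eq, Polynomial.coeff_expand hr, if_pos (dvd_zero _), Nat.zero_div, qh,
    Polynomial.coeff_zero_eq_eval_zero, Polynomial.eval_prod]
  simp

theorem norm_form (hr : 0 < r) (h : r * l = w * d) (hs : Fin l → ℂ) (x : Submodule ℂ (Polynomial ℂ))
    (h1 : IsGrPoint (w + d) d x) (h2 : CrFixed r x) (h3 : InFibre d x (crPoly r 0 l hs)) :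
    ∃ y : Io d w r → ℂ, Submodule.span ℂ (Set.range (fy y)) = x ∧
      wronskDet d (fy y) = V0 d w • crPoly r 0 l hs := by
  obtain ⟨f, c, hc, hli, hsp, hW⟩ := h3
  have hfx : ∀ i, f i ∈ x := fun i => hsp ▸ Submodule.subset_span ⟨i, rfl⟩
  have hf : ∀ i, f i ∈ Polynomial.degreeLT ℂ (w + d) := fun i => h1.1 (hfx i)
  have hN : (wronskDet d f).coeff (w * d) ≠ 0 := by
    rw [hW, Polynomial.coeff_smul, ← h, cr_top hr, smul_eq_mul, mul_one]; exact hc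
  have hx : ∀ p ∈ x, (∀ j : Fin d, p.coeff (w + j) = 0) → p = 0 := fun p hp h0 =>
    top_zero f hf hN p (hsp ▸ hp) h0
  obtain ⟨e, he, htop⟩ := ech f hf hN hli
  rw [hsp] at he
  obtain ⟨ζ, hζ, hrot⟩ := crfixed_prim hr x h2
  have hpat := ech_pattern (r := r) x hx ζ hζ hr hrot e he htop
  obtain ⟨y, rfl⟩ := eq_fy e (fun i => h1.1 (he i)) htop hpat
  have hspan := span_top x hx _ he htop
  refine ⟨y, hspan, ?_⟩
  obtain ⟨k, hk⟩ := wr_span d (fy y) f (fun i => hsp ▸ he i)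
  rw [hW, smul_smul] at hk
  have h5 := wr_fy_top y
  rw [hk, Polynomial.coeff_smul, ← h, cr_top hr, smul_eq_mul, mul_one] at h5
  rw [hk, h5]

theorem fix_eq (hr : 0 < r) (h : r * l = w * d) (hs : Fin l → ℂ) :
    {x : Submodule ℂ (Polynomial ℂ) | IsGrPoint (w + d) d x ∧ CrFixed r x ∧ InFibre d x (crPoly r 0 l hs)} =
    (fun y : Io d w r → ℂ => Submodule.span ℂ (Set.range (fy y))) ''
      {y | ∀ j : Fin l, MvPolynomial.eval y (gj d w r l j) = (qh hs).coeff (l - 1 - j)} := by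
  ext x
  simp only [Set.mem_setOf_eq, Set.mem_image]
  constructor
  · rintro ⟨h1, h2, h3⟩
    obtain ⟨y, hy, hW⟩ := norm_form hr h hs x h1 h2 h3
    rw [cr_eq] at hW
    exact ⟨y, (wr_eq hr h y _ (qh_monic hs) (qh_deg hs)).1 hW, hy⟩
  · rintro ⟨y, hy, rfl⟩
    have hW := (wr_eq hr h y _ (qh_monic hs) (qh_deg hs)).2 hy
    rw [← cr_eq] at hW
    have hli := li_top (w := w) (fy y) (fy_top y)
    refine ⟨⟨?_, ?_⟩, fy_crfixed hr y, fy y, V0 d w, V0_ne d w, hli, rfl, hW⟩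
    · rw [Submodule.span_le]; rintro _ ⟨i, rfl⟩; exact fy_mem y i
    · rw [finrank_span_eq_card hli]; simp

theorem uniq_zero (hr : 0 < r) (h : r * l = w * d) (y : Io d w r → ℂ)
    (hy : ∀ j : Fin l, MvPolynomial.eval y (gj d w r l j) = 0) : y = 0 := by
  have hW := (wr_eq hr h y (X ^ l) (monic_X_pow l) (natDegree_X_pow l)).2 (fun j => by
    rw [hy, Polynomial.coeff_X_pow, if_neg]
    have := j.2
    omega)
  rw [map_pow, Polynomial.expand_X, ← pow_mul, h] at hW
  funext p
  have h2 := all_div (fy y) (fy_mem y) _ (V0_ne d w) hW p.1.1 p.1.2 p.1.2.2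
  rw [fy_coeff, cg_io] at h2
  exact h2

/-- Pulling back a nonzero polynomial along the coefficient map. -/
theorem pull (Q : MvPolynomial (Fin l) ℂ) (hQ : Q ≠ 0) :
    ∃ P : MvPolynomial (Fin l) ℂ, P ≠ 0 ∧ ∀ hs : Fin l → ℂ,
      MvPolynomial.eval hs P = MvPolynomial.eval (fun j : Fin l => (qh hs).coeff (l - 1 - j)) Q := by
  let q : Polynomial (MvPolynomial (Fin l) ℂ) := ∏ i : Fin l, (X + C (MvPolynomial.X i))
  let P : MvPolynomial (Fin l) ℂ := MvPolynomial.aeval (fun j : Fin l => q.coeff (l - 1 - j)) Q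
  have hP : ∀ hs : Fin l → ℂ,
      MvPolynomial.eval hs P = MvPolynomial.eval (fun j : Fin l => (qh hs).coeff (l - 1 - j)) Q := by
    intro hs
    have hq : ∀ k, MvPolynomial.eval hs (q.coeff k) = (qh hs).coeff k := by
      intro k
      rw [← Polynomial.coeff_map]
      congr 1
      show Polynomial.map _ (∏ i : Fin l, (X + C (MvPolynomial.X i))) = _
      rw [Polynomial.map_prod, qh]
      simp
    show MvPolynomial.eval hs (MvPolynomial.aeval _ Q) = _
    have h1 : (MvPolynomial.eval hs).comp
        ((MvPolynomial.aeval (R := ℂ) (fun j : Fin l => q.coeff (l - 1 - j))).toRingHom) =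
        MvPolynomial.eval (fun j : Fin l => (qh hs).coeff (l - 1 - j)) := by
      apply MvPolynomial.ringHom_ext
      · intro c; simp
      · intro j; simp [hq]
    exact congrArg (fun φ : MvPolynomial (Fin l) ℂ →+* ℂ => φ Q) h1
  refine ⟨P, ?_, hP⟩
  intro hP0
  apply hQ
  apply MvPolynomial.funext
  intro p
  rw [map_zero]
  -- polynomial with prescribed coefficients
  have hlow : (∑ j : Fin l, C (p j) * X ^ (l - 1 - (j:ℕ)) : Polynomial ℂ).degree < l := by
    refine lt_of_le_of_lt (Polynomial.degree_sum_le _ _) ?_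
    rw [Finset.sup_lt_iff (WithBot.bot_lt_coe _)]
    intro j _
    refine lt_of_le_of_lt (Polynomial.degree_C_mul_X_pow_le _ _) ?_
    have := j.2
    exact_mod_cast (by omega : l - 1 - (j:ℕ) < l)
  set F : Polynomial ℂ := X ^ l + ∑ j : Fin l, C (p j) * X ^ (l - 1 - (j:ℕ)) with hF
  have hFm : F.Monic := monic_X_pow_add hlow
  have hFd : F.natDegree = l := natDegree_eq_of_degree_eq_some (by
    rw [hF, add_comm, degree_add_eq_right_of_degree_lt (by rwa [degree_X_pow]), degree_X_pow])
  have hsplit : F.Splits := IsAlgClosed.splits F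
  have hcard : F.roots.card = l := by rw [← hFd]; exact (hsplit.natDegree_eq_card_roots).symm
  have hprod : (F.roots.map fun a => X - C a).prod = F := by
    have := hsplit.eq_prod_roots
    rw [hFm.leadingCoeff, C_1, one_mul] at this
    exact this.symm
  obtain ⟨L, hL⟩ := Quot.exists_rep F.roots
  have hL' : (L : Multiset ℂ) = F.roots := hL
  have hlen : L.length = l := by rw [← hcard, ← hL']; simp
  subst hlen
  let hs : Fin L.length → ℂ := fun i => - L.get i
  have hqF : qh hs = F := by
    rw [← hprod, ← hL', Multiset.map_coe, Multiset.prod_coe, qh]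
    have : ∀ i, X + C (hs i) = X - C (L.get i) := fun i => by simp [hs, sub_eq_add_neg]
    simp only [this]
    rw [← List.prod_ofFn]
    congr 1
    conv_rhs => rw [← List.ofFn_get L]
    rw [List.map_ofFn]
    rfl
  have h2 := hP hs
  rw [hP0, map_zero] at h2
  rw [h2]
  congr 1
  have h3 : (fun j : Fin L.length => (qh hs).coeff (L.length - 1 - (j:ℕ))) = p := by
    funext j
    rw [hqF, hF, Polynomial.coeff_add, Polynomial.coeff_X_pow, if_neg (by have := j.2; omega), zero_add,
      Polynomial.finsetSum_coeff]
    rw [Finset.sum_eq_single j]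
    · simp
    · intro b _ hb
      rw [Polynomial.coeff_C_mul, Polynomial.coeff_X_pow, if_neg, mul_zero]
      intro h
      apply hb
      have := j.2
      have := b.2
      apply Fin.ext
      omega
    · intro h; exact absurd (Finset.mem_univ _) h
  rw [h3]

end

end Geo

-- Part G6
namespace Geo
open Wd

theorem prod_wt {d w r l : ℕ} (hr : 0 < r) (hc : Fintype.card (Io d w r) = l) :
    ∏ p, wt d w r p = r ^ l * ∏ p : Io d w r, ((w + (p.1.1:ℕ) - p.1.2) / r) := by
  have h1 : ∀ p : Io d w r, wt d w r p = r * ((w + (p.1.1:ℕ) - p.1.2) / r) := by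
    intro p
    unfold wt
    rw [Nat.mul_div_cancel']
    have hb := p.1.2.2
    exact (Nat.modEq_iff_dvd' (by omega)).1 p.2.symm
  simp only [h1]
  rw [Finset.prod_mul_distrib, Finset.prod_const, Finset.card_univ, hc]

theorem main {d w r l : ℕ} (hd : 0 < d) (hw : 0 < w) (hr : 0 < r) (h : r * l = d * w) :
    ∃ P : MvPolynomial (Fin l) ℂ, P ≠ 0 ∧
      ∀ hs : Fin l → ℂ, (∀ i, hs i ≠ 0) → MvPolynomial.eval hs P ≠ 0 →
        Set.ncard {x : Submodule ℂ (Polynomial ℂ) |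
          IsGrPoint (w + d) d x ∧ CrFixed r x ∧ InFibre d x (crPoly r 0 l hs)} =
        Set.ncard {E : ℕ → ℕ → ℕ | IsSYT d w E ∧ (promo d w)^[l] E = E} := by
  have hN : 0 < d * w := Nat.mul_pos hd hw
  have h' : r * l = w * d := by rw [h, mul_comm]
  have htab := tab_count hN l
  rw [tr_final r l hr hN h] at htab
  by_cases hdv : r ∣ d ∨ r ∣ w
  · have hcard : Fintype.card (Io d w r) = l := Io_card hr hdv h
    obtain ⟨Q, hQ, hQc⟩ := Bz.bezout (σ := Io d w r) (τ := Fin l) (by rw [hcard, Fintype.card_fin])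
      (wt d w r) (fun j => r * ((j:ℕ) + 1))
      (fun p => by have := p.1.2.2; unfold wt; omega) (fun j => Nat.mul_pos hr (Nat.succ_pos _))
      (gj d w r l) (gj_wh h') (uniq_zero hr h')
    obtain ⟨P, hP, hPe⟩ := pull Q hQ
    refine ⟨P, hP, fun hs _ hne => ?_⟩
    rw [hPe] at hne
    have h1 := hQc _ hne
    rw [fix_eq hr h' hs, Set.ncard_image_of_injective _ fy_inj]
    set A := Set.ncard {y : Io d w r → ℂ | ∀ j : Fin l, MvPolynomial.eval y (gj d w r l j) = (qh hs).coeff (l - 1 - j)} with hA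
    rw [prod_wt hr hcard, Finset.prod_mul_distrib, Finset.prod_const, Finset.card_univ, Fintype.card_fin] at h1
    have hfac : ∏ j : Fin l, ((j:ℕ) + 1) = l.factorial := by
      rw [Fin.prod_univ_eq_prod_range (fun j => j + 1), Finset.prod_range_add_one_eq_factorial]
    rw [hfac, mul_left_comm] at h1
    have h2 := Nat.eq_of_mul_eq_mul_left (pow_pos hr l) h1
    have h3 := det_main (d := d) (w := w) hr hdv
    have h4 : (A : ℝ) * ∏ p : Io d w r, (((w + (p.1.1:ℕ) - p.1.2) / r : ℕ) : ℝ) = l.factorial := by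
      exact_mod_cast h2
    rw [abs_mul, Nat.abs_cast] at htab
    have h5 : ((Set.ncard {E : ℕ → ℕ → ℕ | IsSYT d w E ∧ (promo d w)^[l] E = E} : ℕ) : ℝ) = A := by
      rw [htab, ← h4, mul_assoc, mul_comm (∏ p : Io d w r, _), h3, mul_one]
    exact_mod_cast h5.symm
  · push Not at hdv
    refine ⟨1, one_ne_zero, fun hs hs0 _ => ?_⟩
    rw [bad_sum d w r hr hdv.1 hdv.2, mul_zero, abs_zero] at htab
    have h5 : Set.ncard {E : ℕ → ℕ → ℕ | IsSYT d w E ∧ (promo d w)^[l] E = E} = 0 := by exact_mod_cast htab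
    rw [h5]
    have h6 : {x : Submodule ℂ (Polynomial ℂ) |
          IsGrPoint (w + d) d x ∧ CrFixed r x ∧ InFibre d x (crPoly r 0 l hs)} = ∅ := by
      rw [Set.eq_empty_iff_forall_notMem]
      rintro x ⟨h1, h2, h3⟩
      obtain ⟨y, -, hW⟩ := norm_form hr h' hs x h1 h2 h3
      have h7 := bad_wr hr hdv.1 hdv.2 (fy y) (fun i b hb => (cg_ne y i b (by rwa [fy_coeff] at hb)).1)
      rw [hW, Polynomial.coeff_smul, cr_bot hr] at h7
      exact smul_ne_zero (V0_ne d w) (Finset.prod_ne_zero_iff.2 fun i _ => hs0 i) h7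
    rw [h6, Set.ncard_empty]

end Geo

/-- Suppose `r ∣ N` (`N = rℓ`). For generic
`h₁, …, h_{N/r} ∈ ℂˣ`, the number of `C_r`-fixed points in the fibre
`X(h)` of the Wronski map over `h(z) = (z^r + h₁) ⋯ (z^r + h_{N/r})`
equals the number of standard Young tableaux of rectangular shape
`(n-d)^d` fixed by `𝑗^{N/r}`, the `(N/r)`-th power of jeu de taquin promotion. -/
theorem statement1 (d n r ℓ : ℕ) (hd : 0 < d) (hdn : d < n) (hr : 1 ≤ r)
    (hrl : r * ℓ = d * (n - d)) :
    ∃ P : MvPolynomial (Fin ℓ) ℂ, P ≠ 0 ∧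
      ∀ hs : Fin ℓ → ℂ, (∀ i, hs i ≠ 0) → MvPolynomial.eval hs P ≠ 0 →
        Set.ncard {x : Submodule ℂ (Polynomial ℂ) |
            IsGrPoint n d x ∧ CrFixed r x ∧ InFibre d x (crPoly r 0 ℓ hs)} =
          Set.ncard {E : ℕ → ℕ → ℕ |
            IsSYT d (n - d) E ∧ (promo d (n - d))^[ℓ] E = E} := by
  obtain ⟨w, rfl⟩ : ∃ w, n = w + d := ⟨n - d, by omega⟩
  have hw : w + d - d = w := by omega
  rw [hw] at hrl ⊢
  exact Geo.main hd (by omega) hr hrl
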